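/- Let d ≥ 2 and δ > 0. There exist η₀ > 0 depending on δ and d, and for k = 1, 2 constants C(δ,k), such that: if v is a solution of the hodograph PDE on H₁ = {y : y_d ≥ 0, |y| ≥ 1} with |∇v(y)| ≤ η₀ on H₁, v is bounded from above or from below, and m := osc_K v, then for k = 1, 2 and all y with y_d ≥ 0 and |y| ≥ 2 one has |y|^{d−2+k−δ} · |∇^k v(y)| ≤ C(δ,k)·m (where |∇^k v| denotes the norm of the k-th derivative). Consequently, |Δv(y)| ≤ C(δ)·m²·|y|^{1−2d+δ} for y_d > 0, |y| ≥ 2, and 0 ≤ ∂_{y_d} v(y) ≤ C(δ)·m²·|y|^{2−2d+δ} for y_d = 0, |y| ≥ 2. -/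

import Mathlib

open Real Set Filter MeasureTheory

noncomputable section

/-- The last index of `Fin d`. -/
def lastIdx (d : ℕ) (hd : 0 < d) : Fin d := ⟨d - 1, by omega⟩

/-- The `i`-th partial derivative of `v` at `y`. -/
def gradC (d : ℕ) (v : EuclideanSpace ℝ (Fin d) → ℝ)
    (y : EuclideanSpace ℝ (Fin d)) (i : Fin d) : ℝ :=
  fderiv ℝ v y (EuclideanSpace.single i 1)

/-- The `(i,j)` entry of the Hessian of `v` at `y`. -/
def hessC (d : ℕ) (v : EuclideanSpace ℝ (Fin d) → ℝ)
    (y : EuclideanSpace ℝ (Fin d)) (i j : Fin d) : ℝ :=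
  fderiv ℝ (fun z => fderiv ℝ v z (EuclideanSpace.single i 1)) y (EuclideanSpace.single j 1)

/-- The squared euclidean norm of the tangential part `p'` of `p`. -/
def tangSq (d : ℕ) (hd : 0 < d) (p : Fin d → ℝ) : ℝ :=
  ∑ m : Fin d, if m = lastIdx d hd then 0 else (p m) ^ 2

/-- The coefficient matrix `A(p)` of the hodograph PDE. -/
def hodA (d : ℕ) (hd : 0 < d) (p : Fin d → ℝ) (i j : Fin d) : ℝ :=
  if i = lastIdx d hd then
    (if j = lastIdx d hd then (1 + tangSq d hd p) / (1 + p (lastIdx d hd)) ^ 2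
     else p j / (1 + p (lastIdx d hd)))
  else
    (if j = lastIdx d hd then p i / (1 + p (lastIdx d hd))
     else if i = j then 1 else 0)

/-- The boundary nonlinearity `N(p') = √(1 + |p'|²) - 1`. -/
def hodN (d : ℕ) (hd : 0 < d) (p : Fin d → ℝ) : ℝ :=
  Real.sqrt (1 + tangSq d hd p) - 1

/-- The quantity `tr(A(∇v(y)) D²v(y))`. -/
def hodOp (d : ℕ) (hd : 0 < d) (v : EuclideanSpace ℝ (Fin d) → ℝ)
    (y : EuclideanSpace ℝ (Fin d)) : ℝ :=
  ∑ i : Fin d, ∑ j : Fin d, hodA d hd (fun m => gradC d v y m) i j * hessC d v y i j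

/-- `v` is `C^∞` on an open neighborhood of `U`. -/
def SmoothNear (d : ℕ) (v : EuclideanSpace ℝ (Fin d) → ℝ)
    (U : Set (EuclideanSpace ℝ (Fin d))) : Prop :=
  ∃ W : Set (EuclideanSpace ℝ (Fin d)), IsOpen W ∧ U ⊆ W ∧ ContDiffOn ℝ (⊤ : ℕ∞) v W

/-- `v` is a (classical) solution of the hodograph PDE on `U`. -/
def IsHodSol (d : ℕ) (hd : 0 < d) (v : EuclideanSpace ℝ (Fin d) → ℝ)
    (U : Set (EuclideanSpace ℝ (Fin d))) : Prop :=
  SmoothNear d v U ∧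
  (∀ y ∈ U, 0 < y (lastIdx d hd) → hodOp d hd v y = 0) ∧
  (∀ y ∈ U, y (lastIdx d hd) = 0 →
    gradC d v y (lastIdx d hd) = hodN d hd (fun m => gradC d v y m))

/-- `v` is a subsolution of the hodograph PDE on `U`. -/
def IsHodSubsol (d : ℕ) (hd : 0 < d) (v : EuclideanSpace ℝ (Fin d) → ℝ)
    (U : Set (EuclideanSpace ℝ (Fin d))) : Prop :=
  SmoothNear d v U ∧
  (∀ y ∈ U, 0 < y (lastIdx d hd) → 0 ≤ hodOp d hd v y) ∧
  (∀ y ∈ U, y (lastIdx d hd) = 0 →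
    hodN d hd (fun m => gradC d v y m) ≤ gradC d v y (lastIdx d hd))

/-- `v` is a supersolution of the hodograph PDE on `U`. -/
def IsHodSupersol (d : ℕ) (hd : 0 < d) (v : EuclideanSpace ℝ (Fin d) → ℝ)
    (U : Set (EuclideanSpace ℝ (Fin d))) : Prop :=
  SmoothNear d v U ∧
  (∀ y ∈ U, 0 < y (lastIdx d hd) → hodOp d hd v y ≤ 0) ∧
  (∀ y ∈ U, y (lastIdx d hd) = 0 →
    gradC d v y (lastIdx d hd) ≤ hodN d hd (fun m => gradC d v y m))

/-- The exterior half-space domain `H₁ = {y : y_d ≥ 0, |y| ≥ 1}`. -/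
def extDom (d : ℕ) (hd : 0 < d) : Set (EuclideanSpace ℝ (Fin d)) :=
  {y | 0 ≤ y (lastIdx d hd) ∧ 1 ≤ ‖y‖}

/-- The half annulus `A_r = {y : 1 ≤ |y| ≤ r, y_d ≥ 0}`. -/
def halfAnn (d : ℕ) (hd : 0 < d) (r : ℝ) : Set (EuclideanSpace ℝ (Fin d)) :=
  {y | 0 ≤ y (lastIdx d hd) ∧ 1 ≤ ‖y‖ ∧ ‖y‖ ≤ r}

/-- The upper half sphere `∂B_ρ⁺ = {y : y_d ≥ 0, |y| = ρ}`. -/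
def upSphere (d : ℕ) (hd : 0 < d) (ρ : ℝ) : Set (EuclideanSpace ℝ (Fin d)) :=
  {y | 0 ≤ y (lastIdx d hd) ∧ ‖y‖ = ρ}

/-- The filter of `|y| → ∞` within `H₁`. -/
def farFilter (d : ℕ) (hd : 0 < d) : Filter (EuclideanSpace ℝ (Fin d)) :=
  (Filter.comap (fun y : EuclideanSpace ℝ (Fin d) => ‖y‖) Filter.atTop) ⊓
    Filter.principal (extDom d hd)

section Calculus

variable {E : Type*} [NormedAddCommGroup E] [NormedSpace ℝ E]

/-- The directional derivative of `f` in the direction `ξ`, as a function of the base point. -/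
def pd (ξ : E) (f : E → ℝ) (y : E) : ℝ := fderiv ℝ f y ξ

/-- `f` is smooth on `O`. -/
abbrev SmoothOn (O : Set E) (f : E → ℝ) : Prop := ContDiffOn ℝ (⊤ : ℕ∞) f O

variable {O : Set E} {f g : E → ℝ} {y ξ η : E}

lemma SmoothOn.differentiableAt (hO : IsOpen O) (hf : SmoothOn O f) (hy : y ∈ O) :
    DifferentiableAt ℝ f y :=
  (hf.contDiffAt (hO.mem_nhds hy)).differentiableAt (by simp)

lemma SmoothOn.pd (hO : IsOpen O) (hf : SmoothOn O f) (ξ : E) : SmoothOn O (pd ξ f) := by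
  have h : ContDiffOn ℝ (⊤ : ℕ∞) (fderiv ℝ f) O := hf.fderiv_of_isOpen hO (by simp)
  exact h.clm_apply contDiffOn_const

lemma pd_congr (hO : IsOpen O) (h : EqOn f g O) (hy : y ∈ O) (ξ : E) : pd ξ f y = pd ξ g y := by
  have : f =ᶠ[nhds y] g := Filter.eventuallyEq_of_mem (hO.mem_nhds hy) h
  simp only [_root_.pd, this.fderiv_eq]

lemma pd_eq_zero_of_eqOn (hO : IsOpen O) (h : ∀ z ∈ O, f z = 0) (hy : y ∈ O) (ξ : E) :
    pd ξ f y = 0 := by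
  rw [pd_congr hO (g := fun _ => 0) h hy]
  simp [_root_.pd]

lemma pd_add_dir (f : E → ℝ) (y ξ η : E) (a b : ℝ) :
    pd (a • ξ + b • η) f y = a * pd ξ f y + b * pd η f y := by
  simp [pd]

lemma pd_add (hf : DifferentiableAt ℝ f y) (hg : DifferentiableAt ℝ g y) (ξ : E) :
    pd ξ (fun z => f z + g z) y = pd ξ f y + pd ξ g y := by
  simp [pd, fderiv_fun_add hf hg]

lemma pd_sub (hf : DifferentiableAt ℝ f y) (hg : DifferentiableAt ℝ g y) (ξ : E) :
    pd ξ (fun z => f z - g z) y = pd ξ f y - pd ξ g y := by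
  simp [pd, fderiv_fun_sub hf hg]

lemma pd_mul (hf : DifferentiableAt ℝ f y) (hg : DifferentiableAt ℝ g y) (ξ : E) :
    pd ξ (fun z => f z * g z) y = f y * pd ξ g y + g y * pd ξ f y := by
  simp [pd, fderiv_fun_mul hf hg]

lemma pd_const_mul (hf : DifferentiableAt ℝ f y) (c : ℝ) (ξ : E) :
    pd ξ (fun z => c * f z) y = c * pd ξ f y := by
  simp [pd, fderiv_const_mul hf c]

lemma pd_const (c : ℝ) (ξ y : E) : pd ξ (fun _ => c) y = 0 := by
  simp [pd]

lemma pd_sum {ι : Type*} (s : Finset ι) (F : ι → E → ℝ)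
    (hF : ∀ i ∈ s, DifferentiableAt ℝ (F i) y) (ξ : E) :
    pd ξ (fun z => ∑ i ∈ s, F i z) y = ∑ i ∈ s, pd ξ (F i) y := by
  simp [pd, fderiv_fun_sum hF]

lemma pd_sq (hf : DifferentiableAt ℝ f y) (ξ : E) :
    pd ξ (fun z => f z ^ 2) y = 2 * f y * pd ξ f y := by
  have : (fun z => f z ^ 2) = fun z => f z * f z := by ext z; ring
  rw [this, pd_mul hf hf]; ring

lemma pd_pd_eq (hO : IsOpen O) (hf : SmoothOn O f) (hy : y ∈ O) (ξ η : E) :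
    pd ξ (pd η f) y = fderiv ℝ (fderiv ℝ f) y ξ η := by
  have h3 : DifferentiableAt ℝ (fderiv ℝ f) y :=
    ((hf.fderiv_of_isOpen hO (m := (⊤ : ℕ∞)) (by simp)).contDiffAt
      (hO.mem_nhds hy)).differentiableAt (by simp)
  have : pd η f = fun z => (fderiv ℝ f z) η := rfl
  rw [pd, this, fderiv_clm_apply h3 (by fun_prop)]
  simp

lemma pd_comm (hO : IsOpen O) (hf : SmoothOn O f) (hy : y ∈ O) (ξ η : E) :
    pd ξ (pd η f) y = pd η (pd ξ f) y := by
  have h1 : ContDiffAt ℝ (⊤ : ℕ∞) f y := hf.contDiffAt (hO.mem_nhds hy)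
  have h2 := h1.isSymmSndFDerivAt (by simpa using WithTop.coe_le_coe.2 (le_top : (2 : ℕ∞) ≤ ⊤))
  rw [pd_pd_eq hO hf hy, pd_pd_eq hO hf hy]; exact h2 ξ η

lemma pd_pd_add_dir (hO : IsOpen O) (hf : SmoothOn O f) (hy : y ∈ O) (ξ η : E) (a b : ℝ) :
    pd (a • ξ + b • η) (pd (a • ξ + b • η) f) y =
      a ^ 2 * pd ξ (pd ξ f) y + 2 * a * b * pd η (pd ξ f) y + b ^ 2 * pd η (pd η f) y := by
  have h := pd_comm hO hf hy ξ η
  simp only [pd_pd_eq hO hf hy] at h ⊢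
  simp only [map_add, map_smul, add_apply, smul_apply,
    smul_eq_mul]
  rw [h]; ring

lemma pd_pd_add (hO : IsOpen O) (hf : SmoothOn O f) (hg : SmoothOn O g) (hy : y ∈ O) (ξ : E) :
    pd ξ (pd ξ (fun z => f z + g z)) y = pd ξ (pd ξ f) y + pd ξ (pd ξ g) y := by
  rw [pd_congr hO (g := fun z => pd ξ f z + pd ξ g z)
    (fun z hz => pd_add (hf.differentiableAt hO hz) (hg.differentiableAt hO hz) ξ) hy]
  exact pd_add ((hf.pd hO ξ).differentiableAt hO hy) ((hg.pd hO ξ).differentiableAt hO hy) ξ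

lemma pd_pd_const_mul (hO : IsOpen O) (hf : SmoothOn O f) (hy : y ∈ O) (c : ℝ) (ξ : E) :
    pd ξ (pd ξ (fun z => c * f z)) y = c * pd ξ (pd ξ f) y := by
  rw [pd_congr hO (g := fun z => c * pd ξ f z)
    (fun z hz => pd_const_mul (hf.differentiableAt hO hz) c ξ) hy]
  exact pd_const_mul ((hf.pd hO ξ).differentiableAt hO hy) c ξ

lemma pd_pd_sum (hO : IsOpen O) {ι : Type*} (s : Finset ι) (F : ι → E → ℝ)
    (hF : ∀ i ∈ s, SmoothOn O (F i)) (hy : y ∈ O) (ξ : E) :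
    pd ξ (pd ξ (fun z => ∑ i ∈ s, F i z)) y = ∑ i ∈ s, pd ξ (pd ξ (F i)) y := by
  rw [pd_congr hO (g := fun z => ∑ i ∈ s, pd ξ (F i) z)
    (fun z hz => pd_sum s F (fun i hi => (hF i hi).differentiableAt hO hz) ξ) hy]
  exact pd_sum s _ (fun i hi => ((hF i hi).pd hO ξ).differentiableAt hO hy) ξ

lemma pd_pd_mul (hO : IsOpen O) (hf : SmoothOn O f) (hg : SmoothOn O g) (hy : y ∈ O) (ξ : E) :
    pd ξ (pd ξ (fun z => f z * g z)) y =
      f y * pd ξ (pd ξ g) y + g y * pd ξ (pd ξ f) y + 2 * (pd ξ f y * pd ξ g y) := by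
  rw [pd_congr hO (g := fun z => f z * pd ξ g z + g z * pd ξ f z)
    (fun z hz => pd_mul (hf.differentiableAt hO hz) (hg.differentiableAt hO hz) ξ) hy]
  have h1 := hf.differentiableAt hO hy
  have h2 := hg.differentiableAt hO hy
  have h3 := (hf.pd hO ξ).differentiableAt hO hy
  have h4 := (hg.pd hO ξ).differentiableAt hO hy
  rw [pd_add (h1.fun_mul h4) (h2.fun_mul h3), pd_mul h1 h4, pd_mul h2 h3]
  ring

/-- Second-order necessary condition at an interior maximum. -/
lemma pd_pd_nonpos_of_isLocalMax (hO : IsOpen O) (hf : SmoothOn O f) (hy : y ∈ O)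
    (hmax : IsLocalMax f y) (ξ : E) : pd ξ (pd ξ f) y ≤ 0 := by
  by_contra! hpos
  set γ : ℝ → E := fun t => y + t • ξ with hγ
  have hγd : ∀ t, HasDerivAt γ ξ t := by
    intro t
    simpa [hγ] using ((hasDerivAt_id t).smul_const ξ).const_add y
  have hγ0 : γ 0 = y := by simp [hγ]
  have hγc : Continuous γ := by fun_prop
  have hev : ∀ᶠ t in nhds (0 : ℝ), γ t ∈ O := by
    apply hγc.continuousAt.eventually_mem
    rw [hγ0]; exact hO.mem_nhds hy
  have key : ∀ (F : E → ℝ), SmoothOn O F → ∀ t, γ t ∈ O →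
      HasDerivAt (fun s => F (γ s)) (pd ξ F (γ t)) t := by
    intro F hF t ht
    exact (hF.differentiableAt hO ht).hasFDerivAt.comp_hasDerivAt t (hγd t)
  have hd1 : deriv (fun s => f (γ s)) =ᶠ[nhds 0] fun t => pd ξ f (γ t) := by
    filter_upwards [hev] with t ht using (key f hf t ht).deriv
  have hd2 : deriv (deriv (fun s => f (γ s))) 0 = pd ξ (pd ξ f) y := by
    rw [hd1.deriv_eq, (key _ (hf.pd hO ξ) 0 (by rw [hγ0]; exact hy)).deriv, hγ0]
  have hmax' : IsLocalMax (fun s => f (γ s)) 0 := by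
    have : IsLocalMax f (γ 0) := by rw [hγ0]; exact hmax
    exact hγc.continuousAt.eventually this
  have hmin : IsLocalMin (fun s => f (γ s)) 0 := by
    apply isLocalMin_of_deriv_deriv_pos
    · rw [hd2]; exact hpos
    · exact hmax'.deriv_eq_zero
    · exact (key f hf 0 (by rw [hγ0]; exact hy)).continuousAt
  have hconst : (fun s => f (γ s)) =ᶠ[nhds 0] fun _ => f (γ 0) := by
    filter_upwards [hmax', hmin] with t h1 h2 using le_antisymm h1 h2
  have : deriv (deriv (fun s => f (γ s))) 0 = 0 := by
    have h1 : deriv (fun s => f (γ s)) =ᶠ[nhds 0] deriv fun _ => f (γ 0) := hconst.deriv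
    rw [h1.deriv_eq]; simp
  linarith

end Calculus

section Frame

variable {d : ℕ}

/-- The `i`-th coordinate vector. -/
abbrev ev (i : Fin d) : EuclideanSpace ℝ (Fin d) := EuclideanSpace.single i 1

/-- The indicator of the tangential indices. -/
def chi (l i : Fin d) : ℝ := if i = l then 0 else 1

lemma chi_nonneg (l i : Fin d) : 0 ≤ chi l i := by unfold chi; split_ifs <;> norm_num

lemma chi_le_one (l i : Fin d) : chi l i ≤ 1 := by unfold chi; split_ifs <;> norm_num

lemma chi_self (l : Fin d) : chi l l = 0 := by simp [chi]

/-- The `i`-th coefficient of the frame in the direction of the `i`-th coordinate vector. -/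
def cfA (v : EuclideanSpace ℝ (Fin d) → ℝ) (l i : Fin d) (y : EuclideanSpace ℝ (Fin d)) : ℝ :=
  1 + chi l i * pd (ev l) v y

/-- The `i`-th coefficient of the frame in the normal direction. -/
def cfB (v : EuclideanSpace ℝ (Fin d) → ℝ) (l i : Fin d) (y : EuclideanSpace ℝ (Fin d)) : ℝ :=
  chi l i * pd (ev i) v y

/-- A frame in which the hodograph operator is a sum of pure second derivatives. -/
def frame (v : EuclideanSpace ℝ (Fin d) → ℝ) (l i : Fin d) (y : EuclideanSpace ℝ (Fin d)) :
    EuclideanSpace ℝ (Fin d) :=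
  cfA v l i y • ev i + cfB v l i y • ev l

/-- The linear operator with the coefficients of the hodograph PDE, multiplied by `(1 + v_d)²`. -/
def Lop (v : EuclideanSpace ℝ (Fin d) → ℝ) (l : Fin d) (f : EuclideanSpace ℝ (Fin d) → ℝ)
    (y : EuclideanSpace ℝ (Fin d)) : ℝ :=
  ∑ i, pd (frame v l i y) (pd (frame v l i y) f) y

/-- The carré du champ of `Lop`. -/
def Gam (v : EuclideanSpace ℝ (Fin d) → ℝ) (l : Fin d) (f g : EuclideanSpace ℝ (Fin d) → ℝ)
    (y : EuclideanSpace ℝ (Fin d)) : ℝ :=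
  ∑ i, pd (frame v l i y) f y * pd (frame v l i y) g y

variable {v : EuclideanSpace ℝ (Fin d) → ℝ} {l : Fin d} {O : Set (EuclideanSpace ℝ (Fin d))}
  {f g : EuclideanSpace ℝ (Fin d) → ℝ} {y : EuclideanSpace ℝ (Fin d)}

lemma Lop_add (hO : IsOpen O) (hf : SmoothOn O f) (hg : SmoothOn O g) (hy : y ∈ O) :
    Lop v l (fun z => f z + g z) y = Lop v l f y + Lop v l g y := by
  simp only [Lop, pd_pd_add hO hf hg hy, Finset.sum_add_distrib]

lemma Lop_const_mul (hO : IsOpen O) (hf : SmoothOn O f) (hy : y ∈ O) (c : ℝ) :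
    Lop v l (fun z => c * f z) y = c * Lop v l f y := by
  simp only [Lop, pd_pd_const_mul hO hf hy, Finset.mul_sum]

lemma Lop_sub (hO : IsOpen O) (hf : SmoothOn O f) (hg : SmoothOn O g) (hy : y ∈ O) :
    Lop v l (fun z => f z - g z) y = Lop v l f y - Lop v l g y := by
  have h1 : (fun z => f z - g z) = fun z => f z + (-1) * g z := by ext z; ring
  rw [h1, Lop_add hO hf (contDiffOn_const.mul hg) hy, Lop_const_mul hO hg hy]
  ring

lemma Lop_sum (hO : IsOpen O) {ι : Type*} (s : Finset ι) (F : ι → EuclideanSpace ℝ (Fin d) → ℝ)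
    (hF : ∀ i ∈ s, SmoothOn O (F i)) (hy : y ∈ O) :
    Lop v l (fun z => ∑ i ∈ s, F i z) y = ∑ i ∈ s, Lop v l (F i) y := by
  simp only [Lop, pd_pd_sum hO s F hF hy]
  exact Finset.sum_comm

lemma Lop_mul (hO : IsOpen O) (hf : SmoothOn O f) (hg : SmoothOn O g) (hy : y ∈ O) :
    Lop v l (fun z => f z * g z) y = f y * Lop v l g y + g y * Lop v l f y + 2 * Gam v l f g y := by
  simp only [Lop, Gam, pd_pd_mul hO hf hg hy, Finset.sum_add_distrib, Finset.mul_sum]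

lemma Lop_sq (hO : IsOpen O) (hf : SmoothOn O f) (hy : y ∈ O) :
    Lop v l (fun z => f z ^ 2) y = 2 * f y * Lop v l f y + 2 * Gam v l f f y := by
  have : (fun z => f z ^ 2) = fun z => f z * f z := by ext z; ring
  rw [this, Lop_mul hO hf hf hy]; ring

lemma Lop_const (c : ℝ) : Lop v l (fun _ => c) y = 0 := by
  have h : ∀ ξ : EuclideanSpace ℝ (Fin d), pd ξ (fun _ => c) = fun _ => (0 : ℝ) := by
    intro ξ; ext z; exact pd_const c ξ z
  simp only [Lop, h, pd_const, Finset.sum_const_zero]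

lemma Lop_congr (hO : IsOpen O) (hfg : EqOn f g O) (hy : y ∈ O) : Lop v l f y = Lop v l g y := by
  unfold Lop
  refine Finset.sum_congr rfl fun i _ => ?_
  exact pd_congr hO (fun z hz => pd_congr hO hfg hz _) hy _

lemma Gam_self_nonneg : 0 ≤ Gam v l f f y :=
  Finset.sum_nonneg fun _ _ => mul_self_nonneg _

lemma Gam_sq_le : (Gam v l f g y) ^ 2 ≤ Gam v l f f y * Gam v l g g y := by
  have := Finset.sum_mul_sq_le_sq_mul_sq Finset.univ (fun i => pd (frame v l i y) f y)
    (fun i => pd (frame v l i y) g y)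
  simpa [Gam, sq] using this

lemma Lop_coord (hO : IsOpen O) (hf : SmoothOn O f) (hy : y ∈ O) :
    Lop v l f y = ∑ i, (cfA v l i y ^ 2 * pd (ev i) (pd (ev i) f) y +
      2 * cfA v l i y * cfB v l i y * pd (ev l) (pd (ev i) f) y +
      cfB v l i y ^ 2 * pd (ev l) (pd (ev l) f) y) := by
  simp only [Lop, frame, pd_pd_add_dir hO hf hy]

/-- At a maximum relative to the closed half space, `Lop` is nonpositive in the interior and all
inward derivatives are nonpositive on the boundary. -/
lemma max_principle {D S : Set (EuclideanSpace ℝ (Fin d))} (hO : IsOpen O) (hD : IsCompact D)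
    (hf : ContinuousOn f D) (hfO : SmoothOn O f)
    (hDS : ∀ z ∈ D, z ∉ S → z ∈ O) (hOD : ∀ z ∈ O, 0 ≤ z l → z ∈ D) (hDl : ∀ z ∈ D, 0 ≤ z l)
    (hint : ∀ z ∈ D, z ∉ S → 0 < z l → 0 < Lop v l f z)
    (hbd : ∀ z ∈ D, z ∉ S → z l = 0 → ∃ ξ : EuclideanSpace ℝ (Fin d), 0 < ξ l ∧ 0 < pd ξ f z)
    (hy : y ∈ D) : ∃ z ∈ D, z ∈ S ∧ f y ≤ f z := by
  obtain ⟨z, hz, hmax⟩ := hD.exists_isMaxOn ⟨y, hy⟩ hf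
  refine ⟨z, hz, ?_, hmax hy⟩
  by_contra hzS
  have hzO := hDS z hz hzS
  have hOz := hO.mem_nhds hzO
  have hcl : Continuous fun w : EuclideanSpace ℝ (Fin d) => w l := by fun_prop
  rcases (hDl z hz).lt_or_eq with hpos | hzero
  · have hloc : IsLocalMax f z := by
      have h1 : ∀ᶠ w in nhds z, 0 < w l :=
        hcl.continuousAt.eventually (lt_mem_nhds hpos)
      filter_upwards [hOz, h1] with w hw hwl
      exact hmax (hOD w hw hwl.le)
    have h2 : Lop v l f z ≤ 0 :=
      Finset.sum_nonpos fun i _ => pd_pd_nonpos_of_isLocalMax hO hfO hzO hloc _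
    linarith [hint z hz hzS hpos]
  · obtain ⟨ξ, hξ, hpd⟩ := hbd z hz hzS hzero.symm
    have hloc : IsLocalMaxOn f {w | 0 ≤ w l} z := by
      filter_upwards [mem_nhdsWithin_of_mem_nhds hOz, self_mem_nhdsWithin] with w hw hwl
      exact hmax (hOD w hw hwl)
    have hcone : ξ ∈ posTangentConeAt {w : EuclideanSpace ℝ (Fin d) | 0 ≤ w l} z := by
      apply mem_posTangentConeAt_of_segment_subset
      intro w hw
      rw [segment_eq_image'] at hw
      obtain ⟨t, ht, rfl⟩ := hw
      have : 0 ≤ t * ξ l := mul_nonneg ht.1 hξ.le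
      simp [← hzero, this]
    have h3 := hloc.hasFDerivWithinAt_nonpos
      (hfO.differentiableAt hO hzO).hasFDerivAt.hasFDerivWithinAt hcone
    rw [pd] at hpd
    linarith

end Frame

section Jets

variable {d : ℕ}

/-- The polarized coefficient form of `Lop` in a two dimensional coordinate plane. -/
def qf (a b c e X Y Z : ℝ) : ℝ := a * c * X + (a * e + b * c) * Y + b * e * Z

lemma abs_qf_le {a b c e X Y Z A B M : ℝ} (ha : |a| ≤ A) (hb : |b| ≤ A) (hc : |c| ≤ B)
    (he : |e| ≤ B) (hX : |X| ≤ M) (hY : |Y| ≤ M) (hZ : |Z| ≤ M) :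
    |qf a b c e X Y Z| ≤ 4 * A * B * M := by
  have hA : 0 ≤ A := (abs_nonneg _).trans ha
  have hB : 0 ≤ B := (abs_nonneg _).trans hc
  have key : ∀ {p q s : ℝ}, |p| ≤ A → |q| ≤ B → |s| ≤ M → |p * q * s| ≤ A * B * M := by
    intro p q s hp hq hs
    rw [abs_mul, abs_mul]
    gcongr
  have h1 := key ha hc hX
  have h2 := key ha he hY
  have h3 := key hb hc hY
  have h4 := key hb he hZ
  have : qf a b c e X Y Z = a * c * X + a * e * Y + b * c * Y + b * e * Z := by
    unfold qf; ring
  rw [this]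
  rw [abs_le] at *
  constructor <;> linarith [h1.1, h2.1, h3.1, h4.1, h1.2, h2.2, h3.2, h4.2]

lemma pd_qf {E : Type*} [NormedAddCommGroup E] [NormedSpace ℝ E] {a b c e X Y Z : E → ℝ} {y : E}
    (ha : DifferentiableAt ℝ a y) (hb : DifferentiableAt ℝ b y) (hc : DifferentiableAt ℝ c y)
    (he : DifferentiableAt ℝ e y) (hX : DifferentiableAt ℝ X y) (hY : DifferentiableAt ℝ Y y)
    (hZ : DifferentiableAt ℝ Z y) (ξ : E) :
    pd ξ (fun z => qf (a z) (b z) (c z) (e z) (X z) (Y z) (Z z)) y =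
      qf (pd ξ a y) (pd ξ b y) (c y) (e y) (X y) (Y y) (Z y) +
      qf (a y) (b y) (pd ξ c y) (pd ξ e y) (X y) (Y y) (Z y) +
      qf (a y) (b y) (c y) (e y) (pd ξ X y) (pd ξ Y y) (pd ξ Z y) := by
  have h1 := ha.fun_mul hc
  have h2 := ha.fun_mul he
  have h3 := hb.fun_mul hc
  have h4 := hb.fun_mul he
  unfold qf
  rw [pd_add ((h1.fun_mul hX).fun_add ((h2.fun_add h3).fun_mul hY)) (h4.fun_mul hZ),
    pd_add (h1.fun_mul hX) ((h2.fun_add h3).fun_mul hY), pd_mul h1 hX, pd_mul (h2.fun_add h3) hY,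
    pd_mul h4 hZ, pd_add h2 h3, pd_mul ha hc, pd_mul ha he, pd_mul hb hc, pd_mul hb he]
  ring

variable {v : EuclideanSpace ℝ (Fin d) → ℝ} {l : Fin d} {O : Set (EuclideanSpace ℝ (Fin d))}
  {f g : EuclideanSpace ℝ (Fin d) → ℝ} {y : EuclideanSpace ℝ (Fin d)} {ε : ℝ}

lemma abs_pd_ev_le (i : Fin d) : |pd (ev i) f y| ≤ ‖fderiv ℝ f y‖ := by
  have := (fderiv ℝ f y).le_opNorm (ev i)
  simpa [pd] using this

lemma pd_frame (i : Fin d) :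
    pd (frame v l i y) f y = cfA v l i y * pd (ev i) f y + cfB v l i y * pd (ev l) f y :=
  pd_add_dir _ _ _ _ _ _

lemma smoothOn_cfA (hO : IsOpen O) (hv : SmoothOn O v) (i : Fin d) : SmoothOn O (cfA v l i) :=
  contDiffOn_const.add (contDiffOn_const.mul (hv.pd hO _))

lemma smoothOn_cfB (hO : IsOpen O) (hv : SmoothOn O v) (i : Fin d) : SmoothOn O (cfB v l i) :=
  contDiffOn_const.mul (hv.pd hO _)

lemma pd_cfA (hO : IsOpen O) (hv : SmoothOn O v) (hy : y ∈ O) (i : Fin d)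
    (ξ : EuclideanSpace ℝ (Fin d)) :
    pd ξ (cfA v l i) y = chi l i * pd ξ (pd (ev l) v) y := by
  have h := (hv.pd hO (ev l)).differentiableAt hO hy
  have : cfA v l i = fun z => (fun _ => (1 : ℝ)) z + chi l i * pd (ev l) v z := rfl
  rw [this, pd_add (by fun_prop) (h.const_mul _), pd_const, pd_const_mul h]
  ring

lemma pd_cfB (hO : IsOpen O) (hv : SmoothOn O v) (hy : y ∈ O) (i : Fin d)
    (ξ : EuclideanSpace ℝ (Fin d)) :
    pd ξ (cfB v l i) y = chi l i * pd ξ (pd (ev i) v) y :=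
  pd_const_mul ((hv.pd hO (ev i)).differentiableAt hO hy) _ _

lemma abs_chi_mul_le (i : Fin d) {x M : ℝ} (h : |x| ≤ M) : |chi l i * x| ≤ M := by
  rw [abs_mul, abs_of_nonneg (chi_nonneg l i)]
  have := mul_le_mul (chi_le_one l i) h (abs_nonneg x) zero_le_one
  linarith

lemma abs_cfA_sub_one_le (h : ‖fderiv ℝ v y‖ ≤ ε) (i : Fin d) : |cfA v l i y - 1| ≤ ε := by
  simp only [cfA, add_sub_cancel_left]
  exact abs_chi_mul_le i ((abs_pd_ev_le l).trans h)

lemma abs_cfB_le (h : ‖fderiv ℝ v y‖ ≤ ε) (i : Fin d) : |cfB v l i y| ≤ ε :=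
  abs_chi_mul_le i ((abs_pd_ev_le i).trans h)

lemma abs_cfA_le (h : ‖fderiv ℝ v y‖ ≤ ε) (hε : ε ≤ 1) (i : Fin d) : |cfA v l i y| ≤ 2 := by
  have := abs_le.1 (abs_cfA_sub_one_le (l := l) h i)
  rw [abs_le]; constructor <;> linarith

/-- The second order jet form of `Lop` differentiated coefficientwise. -/
lemma Lop_eq_sum_qf (hO : IsOpen O) (hf : SmoothOn O f) (hy : y ∈ O) :
    Lop v l f y = ∑ i, qf (cfA v l i y) (cfB v l i y) (cfA v l i y) (cfB v l i y)
      (pd (ev i) (pd (ev i) f) y) (pd (ev l) (pd (ev i) f) y) (pd (ev l) (pd (ev l) f) y) := by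
  rw [Lop_coord hO hf hy]
  refine Finset.sum_congr rfl fun i _ => ?_
  unfold qf; ring

/-- Local solutions of the hodograph problem with small gradient. -/
structure HodLoc (l : Fin d) (v : EuclideanSpace ℝ (Fin d) → ℝ)
    (O : Set (EuclideanSpace ℝ (Fin d))) (ε : ℝ) : Prop where
  isOpen : IsOpen O
  smooth : SmoothOn O v
  pde : ∀ y ∈ O, 0 < y l → Lop v l v y = 0
  bc : ∀ y ∈ O, y l = 0 →
    pd (ev l) v y + (pd (ev l) v y ^ 2 - ∑ i, chi l i * pd (ev i) v y ^ 2) / 2 = 0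
  small : ∀ y ∈ O, 0 ≤ y l → ‖fderiv ℝ v y‖ ≤ ε

lemma isOpen_pos (hO : IsOpen O) : IsOpen (O ∩ {y | 0 < y l}) :=
  hO.inter (isOpen_lt continuous_const (by fun_prop))

lemma pd_Lop (hO : IsOpen O) (hv : SmoothOn O v) (hf : SmoothOn O f) (hy : y ∈ O) (k : Fin d) :
    pd (ev k) (Lop v l f) y = Lop v l (pd (ev k) f) y +
      2 * ∑ i, qf (pd (ev k) (cfA v l i) y) (pd (ev k) (cfB v l i) y) (cfA v l i y) (cfB v l i y)
        (pd (ev i) (pd (ev i) f) y) (pd (ev l) (pd (ev i) f) y) (pd (ev l) (pd (ev l) f) y) := by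
  have dA := fun i => (smoothOn_cfA (l := l) hO hv i).differentiableAt hO hy
  have dB := fun i => (smoothOn_cfB (l := l) hO hv i).differentiableAt hO hy
  have d2 := fun i j => ((hf.pd hO (ev j)).pd hO (ev i)).differentiableAt hO hy
  have hc : ∀ i j : Fin d, pd (ev k) (pd (ev i) (pd (ev j) f)) y =
      pd (ev i) (pd (ev j) (pd (ev k) f)) y := by
    intro i j
    rw [pd_comm hO (hf.pd hO _) hy]
    exact pd_congr hO (fun z hz => pd_comm hO hf hz _ _) hy _
  rw [pd_congr hO (fun z hz => Lop_eq_sum_qf hO hf hz) hy, pd_sum, Finset.mul_sum,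
    Lop_eq_sum_qf hO (hf.pd hO _) hy, ← Finset.sum_add_distrib]
  · refine Finset.sum_congr rfl fun i _ => ?_
    rw [pd_qf (dA i) (dB i) (dA i) (dB i) (d2 i i) (d2 l i) (d2 l l), hc, hc, hc]
    unfold qf; ring
  · intro i _
    unfold qf
    have h1 := dA i
    have h2 := dB i
    have h3 := d2 i i
    have h4 := d2 l i
    have h5 := d2 l l
    fun_prop

lemma abs_sum_fin_le {F : Fin d → ℝ} {c : ℝ} (h : ∀ i, |F i| ≤ c) : |∑ i, F i| ≤ d * c := by
  refine (Finset.abs_sum_le_sum_abs _ _).trans ?_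
  refine (Finset.sum_le_card_nsmul _ _ c fun i _ => h i).trans ?_
  simp

/-- The first differentiated equation. -/
lemma HodLoc.abs_Lop_pd_le (H : HodLoc l v O ε) (hε : ε ≤ 1) (hy : y ∈ O) (hyl : 0 < y l) {h : ℝ}
    (h2 : ∀ i j, |pd (ev i) (pd (ev j) v) y| ≤ h) (k : Fin d) :
    |Lop v l (pd (ev k) v) y| ≤ 16 * d * h ^ 2 := by
  have hO := H.isOpen
  have hv := H.smooth
  have hs := H.small y hy hyl.le
  have e1 : pd (ev k) (Lop v l v) y = 0 :=
    pd_eq_zero_of_eqOn (isOpen_pos (l := l) hO) (fun z hz => H.pde z hz.1 hz.2) ⟨hy, hyl⟩ _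
  rw [pd_Lop hO hv hv hy] at e1
  have := abs_sum_fin_le (fun i => abs_qf_le (A := h) (B := 2) (M := h)
    ((pd_cfA (l := l) hO hv hy i (ev k)).symm ▸ abs_chi_mul_le i (h2 k l))
    ((pd_cfB (l := l) hO hv hy i (ev k)).symm ▸ abs_chi_mul_le i (h2 k i))
    (abs_cfA_le (l := l) hs hε i) ((abs_cfB_le (l := l) hs i).trans (by linarith))
    (h2 i i) (h2 l i) (h2 l l))
  rw [abs_le] at *
  constructor <;> nlinarith [this.1, this.2]

/-- The second differentiated equation. -/
lemma HodLoc.abs_Lop_pd_pd_le (H : HodLoc l v O ε) (hε : ε ≤ 1) (hy : y ∈ O) (hyl : 0 < y l)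
    {h t : ℝ} (h2 : ∀ i j, |pd (ev i) (pd (ev j) v) y| ≤ h)
    (h3 : ∀ i j k, |pd (ev i) (pd (ev j) (pd (ev k) v)) y| ≤ t) (k m : Fin d) :
    |Lop v l (pd (ev m) (pd (ev k) v)) y| ≤ 64 * d * (h * t + h ^ 3) := by
  have hO := H.isOpen
  have hv := H.smooth
  have hs := H.small y hy hyl.le
  have hO' := isOpen_pos (l := l) hO
  have hk := hv.pd hO (ev k)
  have hh : 0 ≤ h := (abs_nonneg _).trans (h2 k m)
  have ht : 0 ≤ t := (abs_nonneg _).trans (h3 k m m)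
  set U : Fin d → EuclideanSpace ℝ (Fin d) → ℝ := fun i z =>
    qf (pd (ev k) (cfA v l i) z) (pd (ev k) (cfB v l i) z) (cfA v l i z) (cfB v l i z)
      (pd (ev i) (pd (ev i) v) z) (pd (ev l) (pd (ev i) v) z) (pd (ev l) (pd (ev l) v) z) with hU
  have dA := fun i => (smoothOn_cfA (l := l) hO hv i).differentiableAt hO hy
  have dB := fun i => (smoothOn_cfB (l := l) hO hv i).differentiableAt hO hy
  have dA' := fun i => ((smoothOn_cfA (l := l) hO hv i).pd hO (ev k)).differentiableAt hO hy
  have dB' := fun i => ((smoothOn_cfB (l := l) hO hv i).pd hO (ev k)).differentiableAt hO hy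
  have d2 := fun i j => ((hv.pd hO (ev j)).pd hO (ev i)).differentiableAt hO hy
  have dU : ∀ i, DifferentiableAt ℝ (U i) y := by
    intro i
    have q1 := dA i
    have q2 := dB i
    have q3 := dA' i
    have q4 := dB' i
    have q5 := d2 i i
    have q6 := d2 l i
    have q7 := d2 l l
    simp only [hU, qf]
    fun_prop
  have bA : ∀ i m, |pd (ev m) (cfA v l i) y| ≤ h := fun i m =>
    (pd_cfA (l := l) hO hv hy i (ev m)).symm ▸ abs_chi_mul_le i (h2 m l)
  have bB : ∀ i m, |pd (ev m) (cfB v l i) y| ≤ h := fun i m =>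
    (pd_cfB (l := l) hO hv hy i (ev m)).symm ▸ abs_chi_mul_le i (h2 m i)
  have bA' : ∀ i, |pd (ev m) (pd (ev k) (cfA v l i)) y| ≤ t := by
    intro i
    rw [pd_congr hO (fun z hz => pd_cfA (l := l) hO hv hz i (ev k)) hy, pd_const_mul (d2 k l)]
    exact abs_chi_mul_le i (h3 m k l)
  have bB' : ∀ i, |pd (ev m) (pd (ev k) (cfB v l i)) y| ≤ t := by
    intro i
    rw [pd_congr hO (fun z hz => pd_cfB (l := l) hO hv hz i (ev k)) hy, pd_const_mul (d2 k i)]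
    exact abs_chi_mul_le i (h3 m k i)
  have cA := fun i => abs_cfA_le (l := l) hs hε i
  have cB := fun i => (abs_cfB_le (l := l) hs i).trans (show ε ≤ 2 by linarith)
  have e1 : pd (ev m) (fun z => Lop v l (pd (ev k) v) z + 2 * ∑ i, U i z) y = 0 := by
    refine pd_eq_zero_of_eqOn hO' (fun z hz => ?_) ⟨hy, hyl⟩ _
    rw [← pd_Lop hO hv hv hz.1]
    exact pd_eq_zero_of_eqOn hO' (fun z hz => H.pde z hz.1 hz.2) hz _
  have dL : DifferentiableAt ℝ (Lop v l (pd (ev k) v)) y := by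
    have : DifferentiableAt ℝ (fun z => ∑ i, qf (cfA v l i z) (cfB v l i z) (cfA v l i z)
        (cfB v l i z) (pd (ev i) (pd (ev i) (pd (ev k) v)) z)
        (pd (ev l) (pd (ev i) (pd (ev k) v)) z) (pd (ev l) (pd (ev l) (pd (ev k) v)) z)) y := by
      refine DifferentiableAt.fun_sum fun i _ => ?_
      have q1 := dA i
      have q2 := dB i
      have q3 := fun i j => ((hk.pd hO (ev j)).pd hO (ev i)).differentiableAt hO hy
      have q5 := q3 i i
      have q6 := q3 l i
      have q7 := q3 l l
      simp only [qf]
      fun_prop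
    refine this.congr_of_eventuallyEq ?_
    exact Filter.eventuallyEq_of_mem (hO.mem_nhds hy) fun z hz => Lop_eq_sum_qf hO hk hz
  rw [pd_add dL ((DifferentiableAt.fun_sum fun i _ => dU i).const_mul 2),
    pd_const_mul (DifferentiableAt.fun_sum fun i _ => dU i), pd_sum _ _ (fun i _ => dU i),
    pd_Lop hO hv hk hy] at e1
  have b1 := abs_sum_fin_le (fun i => abs_qf_le (bA i m) (bB i m) (cA i) (cB i)
    (h3 i i k) (h3 l i k) (h3 l l k))
  have b2 : |∑ i, pd (ev m) (U i) y| ≤ d * (16 * h * t + 4 * h ^ 3) := by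
    refine abs_sum_fin_le fun i => ?_
    simp only [hU]
    rw [pd_qf (dA' i) (dB' i) (dA i) (dB i) (d2 i i) (d2 l i) (d2 l l)]
    have c1 := abs_qf_le (bA' i) (bB' i) (cA i) (cB i) (h2 i i) (h2 l i) (h2 l l)
    have c2 := abs_qf_le (bA i k) (bB i k) (bA i m) (bB i m) (h2 i i) (h2 l i) (h2 l l)
    have c3 := abs_qf_le (bA i k) (bB i k) (cA i) (cB i) (h3 m i i) (h3 m l i) (h3 m l l)
    rw [abs_le] at *
    constructor <;> nlinarith [c1.1, c2.1, c3.1, c1.2, c2.2, c3.2]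
  have hd0 : (0 : ℝ) ≤ d := Nat.cast_nonneg d
  have p1 : 0 ≤ d * (h * t) := by positivity
  have p2 : 0 ≤ d * h ^ 3 := by positivity
  rw [abs_le] at *
  constructor <;> nlinarith [b1.1, b1.2, b2.1, b2.2]

/-- The equation controls the pure normal derivative by the others. -/
lemma abs_normal_le (hs : ‖fderiv ℝ v y‖ ≤ ε) (hε : ε ≤ 1) {X : Fin d → Fin d → ℝ} {B e : ℝ}
    (hB : ∀ i j, |X i j| ≤ B)
    (he : |∑ i, qf (cfA v l i y) (cfB v l i y) (cfA v l i y) (cfB v l i y)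
      (X i i) (X l i) (X l l)| ≤ e) :
    |X l l| ≤ e + 4 * ∑ i, chi l i * |X i i| + 5 * d * ε * B := by
  have hε0 : 0 ≤ ε := (norm_nonneg _).trans hs
  have hB0 : 0 ≤ B := (abs_nonneg _).trans (hB l l)
  have key : ∀ i, |qf (cfA v l i y) (cfB v l i y) (cfA v l i y) (cfB v l i y)
      (X i i) (X l i) (X l l) - (if i = l then X l l else 0)| ≤
      4 * (chi l i * |X i i|) + 5 * ε * B := by
    intro i
    by_cases hi : i = l
    · subst hi
      simp [qf, cfA, cfB, chi_self]
      positivity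
    · have hchi : chi l i = 1 := by simp [chi, hi]
      have hA := abs_cfA_le (l := l) hs hε i
      have hBb := abs_cfB_le (l := l) hs i
      simp only [hi, if_false, sub_zero, hchi, one_mul, qf]
      set α := cfA v l i y
      set β := cfB v l i y
      have t1 : |α * α * X i i| ≤ 4 * |X i i| := by
        rw [abs_mul, abs_mul]
        have := mul_le_mul hA hA (abs_nonneg _) (by norm_num)
        nlinarith [abs_nonneg (X i i)]
      have t2 : |(α * β + β * α) * X l i| ≤ 4 * ε * B := by
        rw [abs_mul]
        have : |α * β + β * α| ≤ 4 * ε := by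
          have h0 : α * β + β * α = 2 * (α * β) := by ring
          rw [h0, abs_mul, abs_mul]
          have := mul_le_mul hA hBb (abs_nonneg _) (by norm_num)
          norm_num; linarith
        exact mul_le_mul this (hB l i) (abs_nonneg _) (by positivity)
      have t3 : |β * β * X l l| ≤ ε * B := by
        rw [abs_mul, abs_mul]
        have h1 := mul_le_mul hBb (hBb.trans hε) (abs_nonneg _) hε0
        have := mul_le_mul h1 (hB l l) (abs_nonneg _) (by linarith)
        linarith
      rw [abs_le] at *
      constructor <;> linarith [t1.1, t2.1, t3.1, t1.2, t2.2, t3.2]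
  have hsum := Finset.sum_le_sum fun i (_ : i ∈ Finset.univ) => key i
  have h1 := (Finset.abs_sum_le_sum_abs _ _).trans hsum
  rw [Finset.sum_sub_distrib, Finset.sum_add_distrib, ← Finset.mul_sum] at h1
  simp only [Finset.sum_ite_eq', Finset.mem_univ, if_true, Finset.sum_const, Finset.card_univ,
    Fintype.card_fin, nsmul_eq_mul] at h1
  rw [abs_le] at *
  constructor <;> linarith [h1.1, h1.2]

end Jets

section Bernstein

variable {d : ℕ} {v : EuclideanSpace ℝ (Fin d) → ℝ} {l : Fin d}
  {O : Set (EuclideanSpace ℝ (Fin d))}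
  {f g : EuclideanSpace ℝ (Fin d) → ℝ} {y : EuclideanSpace ℝ (Fin d)} {ε : ℝ}

/-- The inward oblique direction on the flat boundary. -/
def bv (v : EuclideanSpace ℝ (Fin d) → ℝ) (l : Fin d) (y : EuclideanSpace ℝ (Fin d)) :
    EuclideanSpace ℝ (Fin d) :=
  (1 + pd (ev l) v y) • ev l - ∑ i, (chi l i * pd (ev i) v y) • ev i

lemma pd_bv : pd (bv v l y) f y =
    (1 + pd (ev l) v y) * pd (ev l) f y - ∑ i, chi l i * pd (ev i) v y * pd (ev i) f y := by
  simp [pd, bv, map_sub, map_sum]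

lemma bv_apply_self : bv v l y l = 1 + pd (ev l) v y := by
  have : ∀ i, (chi l i * pd (ev i) v y) * (EuclideanSpace.single i (1 : ℝ) : EuclideanSpace ℝ (Fin d)) l
      = 0 := by
    intro i
    by_cases h : i = l
    · simp [h, chi_self]
    · simp [Ne.symm h]
  simp only [bv, PiLp.sub_apply, PiLp.smul_apply, smul_eq_mul, WithLp.ofLp_sum, Finset.sum_apply,
    this, Finset.sum_const_zero]
  simp

lemma sum_chi_le (h : ‖fderiv ℝ v y‖ ≤ ε) (x : EuclideanSpace ℝ (Fin d)) :
    |∑ i, chi l i * pd (ev i) v y * x i| ≤ 2 * ε * ‖x‖ := by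
  have e1 : ∑ i, chi l i * pd (ev i) v y * x i = fderiv ℝ v y x - pd (ev l) v y * x l := by
    have hx : x = ∑ i, x i • ev i := by
      ext j; simp [WithLp.ofLp_sum, Finset.sum_apply, Pi.single_apply]
    have h2 : fderiv ℝ v y x = ∑ i, pd (ev i) v y * x i := by
      conv_lhs => rw [hx]
      simp [map_sum, pd, mul_comm]
    rw [h2, eq_sub_iff_add_eq, ← Finset.sum_erase_add _ _ (Finset.mem_univ l),
      ← Finset.sum_erase_add (a := l) _ (fun i => pd (ev i) v y * x i) (Finset.mem_univ l)]
    simp only [chi_self, zero_mul, add_zero, add_left_inj]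
    refine Finset.sum_congr rfl fun i hi => ?_
    simp [chi, Finset.ne_of_mem_erase hi]
  rw [e1]
  have h1 := (fderiv ℝ v y).le_opNorm x
  rw [Real.norm_eq_abs] at h1
  have h2 := (abs_pd_ev_le (f := v) (y := y) l).trans h
  have h3 : |x l| ≤ ‖x‖ := by simpa using PiLp.norm_apply_le x l
  have h4 : |pd (ev l) v y * x l| ≤ ε * ‖x‖ := by
    rw [abs_mul]
    exact mul_le_mul h2 h3 (abs_nonneg _) ((abs_nonneg _).trans h2)
  have h5 : ‖fderiv ℝ v y‖ * ‖x‖ ≤ ε * ‖x‖ := mul_le_mul_of_nonneg_right h (norm_nonneg _)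
  calc _ ≤ |fderiv ℝ v y x| + |pd (ev l) v y * x l| := abs_sub _ _
    _ ≤ _ := by linarith

/-- The cutoff function. -/
def cutoff (x₀ : EuclideanSpace ℝ (Fin d)) (r : ℝ) (y : EuclideanSpace ℝ (Fin d)) : ℝ :=
  r ^ 2 - ‖y - x₀‖ ^ 2

lemma smoothOn_cutoff (x₀ : EuclideanSpace ℝ (Fin d)) (r : ℝ) : SmoothOn O (cutoff x₀ r) := by
  have : ContDiff ℝ (⊤ : ℕ∞) (fun y : EuclideanSpace ℝ (Fin d) => ‖y - x₀‖ ^ 2) :=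
    (contDiff_id.sub contDiff_const).norm_sq ℝ
  exact contDiffOn_const.sub this.contDiffOn

lemma pd_cutoff (x₀ : EuclideanSpace ℝ (Fin d)) (r : ℝ) (ξ z : EuclideanSpace ℝ (Fin d)) :
    pd ξ (cutoff x₀ r) z = -2 * inner ℝ (z - x₀) ξ := by
  have h : HasFDerivAt (fun y : EuclideanSpace ℝ (Fin d) => r ^ 2 - ‖y - x₀‖ ^ 2)
      (-(2 • (innerSL ℝ (z - x₀)).comp (ContinuousLinearMap.id ℝ _))) z :=
    (((hasFDerivAt_id z).sub_const x₀).norm_sq).const_sub _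
  unfold pd
  change fderiv ℝ (fun y : EuclideanSpace ℝ (Fin d) => r ^ 2 - ‖y - x₀‖ ^ 2) z ξ = _
  rw [h.fderiv]
  simp [inner_sub_left]

lemma pd_pd_cutoff (x₀ : EuclideanSpace ℝ (Fin d)) (r : ℝ) (ξ z : EuclideanSpace ℝ (Fin d)) :
    pd ξ (pd ξ (cutoff x₀ r)) z = -2 * ‖ξ‖ ^ 2 := by
  have e : pd ξ (cutoff x₀ r) = fun z => -2 * inner ℝ (z - x₀) ξ := by
    ext z; exact pd_cutoff x₀ r ξ z
  have h : HasFDerivAt (fun y : EuclideanSpace ℝ (Fin d) => inner ℝ (y - x₀) ξ)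
      (innerSL ℝ ξ) z := by
    have := ((innerSL ℝ ξ).hasFDerivAt (x := z - x₀)).comp z ((hasFDerivAt_id z).sub_const x₀)
    simpa [Function.comp_def, real_inner_comm] using this
  rw [e, pd_const_mul h.differentiableAt]
  unfold pd
  rw [h.fderiv]
  simp

lemma norm_frame_le (hs : ‖fderiv ℝ v y‖ ≤ ε) (hε : ε ≤ 1) (i : Fin d) :
    ‖frame v l i y‖ ≤ 3 := by
  have h1 := abs_cfA_le (l := l) hs hε i
  have h2 := abs_cfB_le (l := l) hs i
  unfold frame
  refine (norm_add_le _ _).trans ?_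
  simp only [norm_smul, Real.norm_eq_abs, PiLp.norm_single, abs_one, mul_one]
  linarith

lemma Gam_cutoff_le (hs : ‖fderiv ℝ v y‖ ≤ ε) (hε : ε ≤ 1) {x₀ : EuclideanSpace ℝ (Fin d)} {r : ℝ}
    (hr : ‖y - x₀‖ ≤ r) : Gam v l (cutoff x₀ r) (cutoff x₀ r) y ≤ 36 * d * r ^ 2 := by
  have h0 : ∀ i, |pd (frame v l i y) (cutoff x₀ r) y * pd (frame v l i y) (cutoff x₀ r) y| ≤
      36 * r ^ 2 := by
    intro i
    rw [pd_cutoff, abs_mul, abs_mul]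
    have h1 := abs_real_inner_le_norm (y - x₀) (frame v l i y)
    have h2 := mul_le_mul hr (norm_frame_le (l := l) hs hε i) (norm_nonneg _)
      ((norm_nonneg _).trans hr)
    have h3 : |inner ℝ (y - x₀) (frame v l i y)| ≤ r * 3 := h1.trans h2
    have h4 := mul_le_mul h3 h3 (abs_nonneg _) ((abs_nonneg _).trans h3)
    norm_num
    nlinarith
  have := (le_abs_self _).trans (abs_sum_fin_le h0)
  unfold Gam
  linarith

lemma Lop_cutoff_ge (hs : ‖fderiv ℝ v y‖ ≤ ε) (hε : ε ≤ 1) (x₀ : EuclideanSpace ℝ (Fin d)) (r : ℝ) :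
    -(18 * d) ≤ Lop v l (cutoff x₀ r) y := by
  have h0 : ∀ i, |pd (frame v l i y) (pd (frame v l i y) (cutoff x₀ r)) y| ≤ 18 := by
    intro i
    rw [pd_pd_cutoff, abs_mul, abs_of_nonneg (by positivity : 0 ≤ ‖frame v l i y‖ ^ 2)]
    have h2 := norm_frame_le (l := l) hs hε i
    have h3 := norm_nonneg (frame v l i y)
    norm_num
    nlinarith
  have := (abs_le.1 (abs_sum_fin_le h0)).1
  unfold Lop
  linarith

lemma pd_bv_cutoff_ge (hs : ‖fderiv ℝ v y‖ ≤ ε) (hε : ε ≤ 1 / 64) (hy : y l = 0)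
    {x₀ : EuclideanSpace ℝ (Fin d)} {r : ℝ} (hr : ‖y - x₀‖ ≤ r) (hx₀ : r / 8 ≤ x₀ l) :
    r / 8 ≤ pd (bv v l y) (cutoff x₀ r) y := by
  have e : ∀ i, pd (ev i) (cutoff x₀ r) y = -2 * (y - x₀) i := by
    intro i
    rw [pd_cutoff]
    simp [ev, EuclideanSpace.inner_single_right]
  have h1 := abs_le.1 (sum_chi_le (l := l) hs (y - x₀))
  have h2 := abs_le.1 ((abs_pd_ev_le (f := v) (y := y) l).trans hs)
  have hr0 : 0 ≤ r := (norm_nonneg _).trans hr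
  have hε0 : 0 ≤ ε := (norm_nonneg _).trans hs
  rw [pd_bv]
  have e2 : ∑ i, chi l i * pd (ev i) v y * pd (ev i) (cutoff x₀ r) y =
      -2 * ∑ i, chi l i * pd (ev i) v y * (y - x₀) i := by
    rw [Finset.mul_sum]
    exact Finset.sum_congr rfl fun i _ => by rw [e]; ring
  rw [e2, e l]
  have e3 : (y - x₀) l = - x₀ l := by simp [hy]
  rw [e3]
  have h3 : 2 * ε * ‖y - x₀‖ ≤ 2 * (1 / 64) * r := by gcongr
  nlinarith [h1.1, h2.1]

/-- The sum of the squares of a finite family. -/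
def sumSq {ι : Type} [Fintype ι] (F : ι → EuclideanSpace ℝ (Fin d) → ℝ)
    (y : EuclideanSpace ℝ (Fin d)) : ℝ := ∑ k, F k y ^ 2

section

variable {ι : Type} [Fintype ι] {F : ι → EuclideanSpace ℝ (Fin d) → ℝ}

lemma sumSq_nonneg : 0 ≤ sumSq F y := Finset.sum_nonneg fun _ _ => sq_nonneg _

lemma smoothOn_sumSq (hF : ∀ k, SmoothOn O (F k)) : SmoothOn O (sumSq F) :=
  ContDiffOn.sum fun k _ => (hF k).pow 2

lemma pd_sumSq (hO : IsOpen O) (hF : ∀ k, SmoothOn O (F k)) (hy : y ∈ O)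
    (ξ : EuclideanSpace ℝ (Fin d)) :
    pd ξ (sumSq F) y = 2 * ∑ k, F k y * pd ξ (F k) y := by
  have h := fun k => (hF k).differentiableAt hO hy
  have e : sumSq F = fun z => ∑ k, F k z ^ 2 := rfl
  rw [e, pd_sum _ (fun k z => F k z ^ 2) (fun k _ => (h k).fun_pow 2), Finset.mul_sum]
  refine Finset.sum_congr rfl fun k _ => ?_
  rw [pd_sq (h k)]; ring

lemma Lop_sumSq (hO : IsOpen O) (hF : ∀ k, SmoothOn O (F k)) (hy : y ∈ O) :
    Lop v l (sumSq F) y = 2 * ∑ k, F k y * Lop v l (F k) y + 2 * ∑ k, Gam v l (F k) (F k) y := by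
  have e : sumSq F = fun z => ∑ k, F k z ^ 2 := rfl
  rw [e, Lop_sum hO _ (fun k z => F k z ^ 2) (fun k _ => (hF k).pow 2) hy, Finset.mul_sum,
    Finset.mul_sum, ← Finset.sum_add_distrib]
  refine Finset.sum_congr rfl fun k _ => ?_
  rw [Lop_sq hO (hF k) hy]; ring

lemma Gam_sumSq_le (hO : IsOpen O) (hF : ∀ k, SmoothOn O (F k)) (hy : y ∈ O) :
    Gam v l (sumSq F) (sumSq F) y ≤ 4 * sumSq F y * ∑ k, Gam v l (F k) (F k) y := by
  unfold Gam
  rw [Finset.sum_comm, Finset.mul_sum]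
  refine Finset.sum_le_sum fun i _ => ?_
  rw [pd_sumSq hO hF hy]
  have := Finset.sum_mul_sq_le_sq_mul_sq Finset.univ (fun k => F k y)
    (fun k => pd (frame v l i y) (F k) y)
  simp only [sumSq, ← sq]
  nlinarith

end

set_option maxHeartbeats 1600000 in
/-- An interior and oblique boundary estimate of Bernstein type. -/
lemma bernstein_estimate (d : ℕ) (C₀ c : ℝ) (hc : 0 < c) : ∃ K : ℝ, 0 < K ∧
    ∀ (ι : Type) [Fintype ι] (l : Fin d) (v : EuclideanSpace ℝ (Fin d) → ℝ)
      (O : Set (EuclideanSpace ℝ (Fin d))) (ε : ℝ) (x₀ : EuclideanSpace ℝ (Fin d)) (r Λ : ℝ)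
      (F : ι → EuclideanSpace ℝ (Fin d) → ℝ) (R : EuclideanSpace ℝ (Fin d) → ℝ),
      HodLoc l v O ε → ε ≤ 1 / 64 → 0 < r → r / 8 ≤ x₀ l →
      (∀ y, ‖y - x₀‖ ≤ r → 0 ≤ y l → y ∈ O) →
      (∀ k, SmoothOn O (F k)) → SmoothOn O R →
      (∀ y, ‖y - x₀‖ ≤ r → 0 ≤ y l → 0 ≤ R y ∧ R y ≤ Λ) →
      (∀ y, ‖y - x₀‖ ≤ r → 0 < y l →
        -(1 / 2 * ∑ k, Gam v l (F k) (F k) y) - C₀ * sumSq F y / r ^ 2 ≤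
          ∑ k, F k y * Lop v l (F k) y ∧
        c * sumSq F y ≤ Lop v l R y) →
      (∀ y, ‖y - x₀‖ ≤ r → y l = 0 →
        -(sumSq F y / (16 * r)) ≤ ∑ k, F k y * pd (bv v l y) (F k) y ∧
        0 ≤ pd (bv v l y) R y) →
      ∀ y, ‖y - x₀‖ ≤ r / 2 → 0 ≤ y l → r ^ 2 * sumSq F y ≤ K * Λ := by
  have hd0 : (0 : ℝ) ≤ d := Nat.cast_nonneg d
  set C' : ℝ := 2 * |C₀| + 612 * d with hC'
  have hC'0 : 0 ≤ C' := by positivity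
  set K : ℝ := (C' + 1) / c with hK
  have hK0 : 0 < K := by positivity
  refine ⟨2 * K, by positivity, ?_⟩
  intro ι _ l v O ε x₀ r Λ F R H hε hr hx₀ hball hF hR hRb hint hflat y hy hyl
  have hO := H.isOpen
  set P := sumSq F with hP
  have hPs : SmoothOn O P := smoothOn_sumSq hF
  set η := cutoff x₀ r with hη
  have hηs : SmoothOn O η := smoothOn_cutoff x₀ r
  set f : EuclideanSpace ℝ (Fin d) → ℝ := fun z => η z ^ 2 * P z + K * r ^ 2 * R z with hf
  have hη2 : SmoothOn O (fun z => η z ^ 2) := hηs.pow 2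
  have hηP : SmoothOn O (fun z => η z ^ 2 * P z) := hη2.mul hPs
  have hKR : SmoothOn O (fun z => K * r ^ 2 * R z) := contDiffOn_const.mul hR
  have hfs : SmoothOn O f := hηP.add hKR
  set D : Set (EuclideanSpace ℝ (Fin d)) := Metric.closedBall x₀ r ∩ {z | 0 ≤ z l} with hD
  have hDO : ∀ z ∈ D, z ∈ O := fun z hz => hball z (by simpa [dist_eq_norm] using hz.1) hz.2
  have hDc : IsCompact D := (isCompact_closedBall x₀ r).inter_right
    (isClosed_le continuous_const (by fun_prop))
  set S : Set (EuclideanSpace ℝ (Fin d)) := {z | ‖z - x₀‖ = r ∨ P z = 0} with hS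
  have hmain : ∃ z ∈ D, z ∈ S ∧ f y ≤ f z := by
    refine max_principle (v := v) (l := l) (O := O ∩ Metric.ball x₀ r)
      (hO.inter Metric.isOpen_ball) hDc
      (hfs.continuousOn.mono hDO) (hfs.mono inter_subset_left) ?_ ?_ (fun z hz => hz.2) ?_ ?_ ?_
    · intro z hz hzS
      refine ⟨hDO z hz, ?_⟩
      have h1 : ‖z - x₀‖ ≤ r := by simpa [dist_eq_norm] using hz.1
      have h2 : ‖z - x₀‖ ≠ r := fun h => hzS (Or.inl h)
      simpa [dist_eq_norm] using lt_of_le_of_ne h1 h2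
    · intro z hz hzl
      exact ⟨Metric.ball_subset_closedBall hz.2, hzl⟩
    · intro z hz hzS hzl
      have hzO := hDO z hz
      have hs := H.small z hzO hzl.le
      have h1 : ‖z - x₀‖ ≤ r := by simpa [dist_eq_norm] using hz.1
      have hPz : 0 < P z := lt_of_le_of_ne sumSq_nonneg fun h => hzS (Or.inr h.symm)
      obtain ⟨hi1, hi2⟩ := hint z h1 hzl
      set G := ∑ k, Gam v l (F k) (F k) z with hG
      have hG0 : 0 ≤ G := Finset.sum_nonneg fun k _ => Gam_self_nonneg
      have hη0 : 0 ≤ η z := by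
        simp only [hη, cutoff]; nlinarith [norm_nonneg (z - x₀)]
      have hηr : η z ≤ r ^ 2 := by
        simp only [hη, cutoff]; nlinarith [norm_nonneg (z - x₀)]
      have e1 : Lop v l f z = η z ^ 2 * Lop v l P z +
          P z * (2 * η z * Lop v l η z + 2 * Gam v l η η z) + 4 * η z * Gam v l η P z +
          K * r ^ 2 * Lop v l R z := by
        rw [hf, Lop_add hO hηP hKR hzO, Lop_mul hO hη2 hPs hzO, Lop_sq hO hηs hzO,
          Lop_const_mul hO hR hzO]
        have : Gam v l (fun z => η z ^ 2) P z = 2 * η z * Gam v l η P z := by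
          simp only [Gam, Finset.mul_sum]
          refine Finset.sum_congr rfl fun i _ => ?_
          rw [pd_sq (hηs.differentiableAt hO hzO)]; ring
        rw [this]; ring
      have e2 : Lop v l P z = 2 * ∑ k, F k z * Lop v l (F k) z + 2 * G := Lop_sumSq hO hF hzO
      have b1 := Lop_cutoff_ge (l := l) hs (by linarith) x₀ r
      have b2 := Gam_cutoff_le (l := l) hs (by linarith) h1
      have b3 : Gam v l P P z ≤ 4 * P z * G := Gam_sumSq_le hO hF hzO
      have b4 : (Gam v l η P z) ^ 2 ≤ 36 * d * r ^ 2 * (4 * P z * G) :=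
        Gam_sq_le.trans (mul_le_mul b2 b3 Gam_self_nonneg (by positivity))
      have b5 : |4 * η z * Gam v l η P z| ≤ η z ^ 2 * G + 576 * d * r ^ 2 * P z := by
        refine abs_le_of_sq_le_sq ?_ (by positivity)
        have : (4 * η z * Gam v l η P z) ^ 2 ≤ 4 * (η z ^ 2 * G) * (576 * d * r ^ 2 * P z) := by
          have := mul_le_mul_of_nonneg_left b4 (sq_nonneg (4 * η z))
          nlinarith
        nlinarith [sq_nonneg (η z ^ 2 * G - 576 * d * r ^ 2 * P z)]
      have b6 : -(|C₀| * r ^ 2 * P z) ≤ - (η z ^ 2 * (C₀ * P z / r ^ 2)) := by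
        have h2 : η z ^ 2 ≤ r ^ 2 * r ^ 2 := by nlinarith
        have h3 : η z ^ 2 * (C₀ * P z / r ^ 2) ≤ (r ^ 2 * r ^ 2) * (|C₀| * P z / r ^ 2) := by
          have : C₀ * P z / r ^ 2 ≤ |C₀| * P z / r ^ 2 := by gcongr; exact le_abs_self _
          refine (mul_le_mul_of_nonneg_left this (sq_nonneg _)).trans ?_
          gcongr
        have h4 : (r ^ 2 * r ^ 2) * (|C₀| * P z / r ^ 2) = |C₀| * r ^ 2 * P z := by
          field_simp
        linarith
      have b7 : -(36 * d * r ^ 2 * P z) ≤ P z * (2 * η z * Lop v l η z + 2 * Gam v l η η z) := by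
        have h2 : -(18 * d * r ^ 2) ≤ η z * Lop v l η z := by
          have := mul_le_mul_of_nonneg_left b1 hη0
          nlinarith
        have h3 : 0 ≤ Gam v l η η z := Gam_self_nonneg
        nlinarith
      have b8 : (C' + 1) * r ^ 2 * P z ≤ K * r ^ 2 * Lop v l R z := by
        have : K * r ^ 2 * (c * P z) ≤ K * r ^ 2 * Lop v l R z := by gcongr
        have h5 : K * c = C' + 1 := by rw [hK]; field_simp
        calc (C' + 1) * r ^ 2 * P z = K * r ^ 2 * (c * P z) := by rw [← h5]; ring
          _ ≤ _ := this
      have b9 : η z ^ 2 * G - 2 * (|C₀| * r ^ 2 * P z) ≤ η z ^ 2 * Lop v l P z := by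
        rw [e2]
        have := mul_le_mul_of_nonneg_left hi1 (sq_nonneg (η z))
        linarith
      have b5' := (abs_le.1 b5).1
      have hpos : 0 < r ^ 2 * P z := by positivity
      rw [e1]
      have : C' * r ^ 2 * P z = 2 * (|C₀| * r ^ 2 * P z) + 36 * d * r ^ 2 * P z +
        576 * d * r ^ 2 * P z := by rw [hC']; ring
      linarith
    · intro z hz hzS hzl
      have hzO := hDO z hz
      have hs := H.small z hzO hzl.ge
      have h1 : ‖z - x₀‖ ≤ r := by simpa [dist_eq_norm] using hz.1
      have h1' : ‖z - x₀‖ < r := lt_of_le_of_ne h1 fun h => hzS (Or.inl h)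
      have hPz : 0 < P z := lt_of_le_of_ne sumSq_nonneg fun h => hzS (Or.inr h.symm)
      obtain ⟨hi1, hi2⟩ := hflat z h1 hzl
      have hη0 : 0 < η z := by
        simp only [hη, cutoff]; nlinarith [norm_nonneg (z - x₀)]
      have hηr : η z ≤ r ^ 2 := by
        simp only [hη, cutoff]; nlinarith [norm_nonneg (z - x₀)]
      refine ⟨bv v l z, ?_, ?_⟩
      · rw [bv_apply_self]
        have := (abs_le.1 ((abs_pd_ev_le (f := v) (y := z) l).trans hs)).1
        linarith
      · have e1 : pd (bv v l z) f z = η z ^ 2 * (2 * ∑ k, F k z * pd (bv v l z) (F k) z) +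
            P z * (2 * η z * pd (bv v l z) η z) + K * r ^ 2 * pd (bv v l z) R z := by
          rw [hf, pd_add (hηP.differentiableAt hO hzO) (hKR.differentiableAt hO hzO),
            pd_mul (hη2.differentiableAt hO hzO) (hPs.differentiableAt hO hzO),
            pd_sq (hηs.differentiableAt hO hzO), pd_const_mul (hR.differentiableAt hO hzO),
            pd_sumSq hO hF hzO]
        have b1 := pd_bv_cutoff_ge (l := l) hs hε hzl h1 hx₀
        have b2 : -(η z * r / 8 * P z) ≤ η z ^ 2 * (2 * ∑ k, F k z * pd (bv v l z) (F k) z) := by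
          have h2 : -(η z ^ 2 * (2 * (P z / (16 * r)))) ≤
              η z ^ 2 * (2 * ∑ k, F k z * pd (bv v l z) (F k) z) := by
            have := mul_le_mul_of_nonneg_left hi1 (sq_nonneg (η z))
            linarith
          have h3 : η z ^ 2 * (2 * (P z / (16 * r))) ≤ (η z * r ^ 2) * (2 * (P z / (16 * r))) := by
            gcongr; nlinarith
          have h4 : (η z * r ^ 2) * (2 * (P z / (16 * r))) = η z * r / 8 * P z := by
            field_simp; ring
          linarith
        have b3 : η z * r / 4 * P z ≤ P z * (2 * η z * pd (bv v l z) η z) := by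
          have : η z * P z * (r / 8) ≤ η z * P z * pd (bv v l z) η z := by gcongr
          linarith
        have b4 : 0 ≤ K * r ^ 2 * pd (bv v l z) R z := by positivity
        have b5 : 0 < η z * r / 8 * P z := by positivity
        rw [e1]; linarith
    · exact ⟨by simpa [dist_eq_norm] using (by linarith : ‖y - x₀‖ ≤ r), hyl⟩
  obtain ⟨z, hz, hzS, hle⟩ := hmain
  have hz1 : ‖z - x₀‖ ≤ r := by simpa [dist_eq_norm] using hz.1
  have hfz : f z = K * r ^ 2 * R z := by
    rcases hzS with h | h
    · simp [hf, hη, cutoff, h]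
    · simp [hf, h]
  have hy1 : ‖y - x₀‖ ≤ r := by linarith
  have hRy := (hRb y hy1 hyl).1
  have hRz := (hRb z hz1 hz.2).2
  have hηy : 3 / 4 * r ^ 2 ≤ η y := by
    simp only [hη, cutoff]; nlinarith [norm_nonneg (y - x₀)]
  have hη2y : 1 / 2 * r ^ 4 ≤ η y ^ 2 := by
    have : (3 / 4 * r ^ 2) ^ 2 ≤ η y ^ 2 := by gcongr
    have h4 : 0 < r ^ 4 := by positivity
    nlinarith
  have h5 : 1 / 2 * r ^ 4 * P y ≤ K * r ^ 2 * Λ := by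
    have h6 : 1 / 2 * r ^ 4 * P y ≤ η y ^ 2 * P y :=
      mul_le_mul_of_nonneg_right hη2y sumSq_nonneg
    have h7 : 0 ≤ K * r ^ 2 * R y := by positivity
    have h8 : K * r ^ 2 * R z ≤ K * r ^ 2 * Λ := by gcongr
    have h9 : f y = η y ^ 2 * P y + K * r ^ 2 * R y := rfl
    linarith
  have hr2 : 0 < r ^ 2 := by positivity
  refine le_of_mul_le_mul_left ?_ hr2
  nlinarith

end Bernstein

section Gradient

variable {d : ℕ} {v : EuclideanSpace ℝ (Fin d) → ℝ} {l : Fin d}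
  {O : Set (EuclideanSpace ℝ (Fin d))}
  {f g : EuclideanSpace ℝ (Fin d) → ℝ} {y : EuclideanSpace ℝ (Fin d)} {ε : ℝ}

/-- The defining function of the boundary condition. -/
def zet (v : EuclideanSpace ℝ (Fin d) → ℝ) (l : Fin d) (y : EuclideanSpace ℝ (Fin d)) : ℝ :=
  pd (ev l) v y + (pd (ev l) v y ^ 2 - ∑ i, chi l i * pd (ev i) v y ^ 2) / 2

lemma zet_eq : zet v l = fun y => pd (ev l) v y +
    ((1 / 2) * pd (ev l) v y ^ 2 + ∑ i, (-(1 / 2) * chi l i) * pd (ev i) v y ^ 2) := by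
  ext y
  simp only [zet, mul_assoc, ← Finset.mul_sum]
  ring

lemma smoothOn_zet (hO : IsOpen O) (hv : SmoothOn O v) : SmoothOn O (zet v l) := by
  rw [zet_eq]
  exact (hv.pd hO _).add ((contDiffOn_const.mul ((hv.pd hO _).pow 2)).add
    (ContDiffOn.sum fun i _ => contDiffOn_const.mul ((hv.pd hO _).pow 2)))

lemma pd_zet (hO : IsOpen O) (hv : SmoothOn O v) (hy : y ∈ O) (ξ : EuclideanSpace ℝ (Fin d)) :
    pd ξ (zet v l) y = (1 + pd (ev l) v y) * pd ξ (pd (ev l) v) y -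
      ∑ i, chi l i * pd (ev i) v y * pd ξ (pd (ev i) v) y := by
  have h := fun i => (hv.pd hO (ev i)).differentiableAt hO hy
  have h2 := fun i => (h i).fun_pow 2
  rw [zet_eq, pd_add (h l) (((h2 l).const_mul _).fun_add
    (DifferentiableAt.fun_sum fun i _ => (h2 i).const_mul _)),
    pd_add ((h2 l).const_mul _) (DifferentiableAt.fun_sum fun i _ => (h2 i).const_mul _),
    pd_const_mul (h2 l), pd_sq (h l),
    pd_sum _ (fun i z => (-(1 / 2) * chi l i) * pd (ev i) v z ^ 2)
      (fun i _ => (h2 i).const_mul _)]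
  have : ∀ i, pd ξ (fun z => (-(1 / 2) * chi l i) * pd (ev i) v z ^ 2) y =
      -(chi l i * pd (ev i) v y * pd ξ (pd (ev i) v) y) := by
    intro i
    rw [pd_const_mul (h2 i), pd_sq (h i)]; ring
  simp only [this, Finset.sum_neg_distrib]
  ring

lemma Lop_zet (hO : IsOpen O) (hv : SmoothOn O v) (hy : y ∈ O) :
    Lop v l (zet v l) y = (1 + pd (ev l) v y) * Lop v l (pd (ev l) v) y +
      Gam v l (pd (ev l) v) (pd (ev l) v) y -
      ∑ i, chi l i * (pd (ev i) v y * Lop v l (pd (ev i) v) y +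
        Gam v l (pd (ev i) v) (pd (ev i) v) y) := by
  have h := fun i => hv.pd hO (ev i)
  have h2 : ∀ i, SmoothOn O (fun z => pd (ev i) v z ^ 2) := fun i => (h i).pow 2
  have h3 : ∀ i, SmoothOn O (fun z => (-(1 / 2) * chi l i) * pd (ev i) v z ^ 2) :=
    fun i => contDiffOn_const.mul (h2 i)
  have h4 : SmoothOn O (fun z => (1 / 2) * pd (ev l) v z ^ 2) := contDiffOn_const.mul (h2 l)
  have h5 : SmoothOn O (fun z => ∑ i, (-(1 / 2) * chi l i) * pd (ev i) v z ^ 2) :=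
    ContDiffOn.sum fun i _ => h3 i
  rw [zet_eq, Lop_add hO (h l) (h4.add h5) hy, Lop_add hO h4 h5 hy, Lop_const_mul hO (h2 l) hy,
    Lop_sq hO (h l) hy, Lop_sum hO _ (fun i z => (-(1 / 2) * chi l i) * pd (ev i) v z ^ 2)
      (fun i _ => h3 i) hy]
  have : ∀ i, Lop v l (fun z => (-(1 / 2) * chi l i) * pd (ev i) v z ^ 2) y =
      -(chi l i * (pd (ev i) v y * Lop v l (pd (ev i) v) y +
        Gam v l (pd (ev i) v) (pd (ev i) v) y)) := by
    intro i
    rw [Lop_const_mul hO (h2 i) hy, Lop_sq hO (h i) hy]; ring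
  simp only [this, Finset.sum_neg_distrib]
  ring

lemma pd_tangential_eq_zero (hO : IsOpen O) (hf : DifferentiableAt ℝ f y) (hy : y ∈ O)
    (hyl : y l = 0) (h0 : ∀ z ∈ O, z l = 0 → f z = 0) {k : Fin d} (hk : k ≠ l) :
    pd (ev k) f y = 0 := by
  set γ : ℝ → EuclideanSpace ℝ (Fin d) := fun t => y + t • ev k with hγ
  have hγ0 : γ 0 = y := by simp [hγ]
  have hγd : HasDerivAt γ (ev k) 0 := by
    simpa [hγ] using ((hasDerivAt_id (0 : ℝ)).smul_const (ev k)).const_add y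
  have h1 : HasDerivAt (f ∘ γ) (fderiv ℝ f y (ev k)) 0 := by
    have : HasFDerivAt f (fderiv ℝ f y) (γ 0) := by rw [hγ0]; exact hf.hasFDerivAt
    exact this.comp_hasDerivAt 0 hγd
  have h2 : f ∘ γ =ᶠ[nhds 0] fun _ => (0 : ℝ) := by
    have hc : ContinuousAt γ 0 := hγd.continuousAt
    filter_upwards [hc.preimage_mem_nhds (by rw [hγ0]; exact hO.mem_nhds hy)] with t ht
    refine h0 _ ht ?_
    simp [hγ, hyl, Ne.symm hk]
  have h3 := h1.congr_of_eventuallyEq h2.symm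
  exact h3.unique (hasDerivAt_const (0 : ℝ) (0 : ℝ))

lemma HodLoc.pd_zet_flat (H : HodLoc l v O ε) (hy : y ∈ O) (hyl : y l = 0) {k : Fin d}
    (hk : k ≠ l) : pd (ev k) (zet v l) y = 0 :=
  pd_tangential_eq_zero H.isOpen ((smoothOn_zet H.isOpen H.smooth).differentiableAt H.isOpen hy)
    hy hyl H.bc hk

lemma pd_bv_pd (hO : IsOpen O) (hv : SmoothOn O v) (hy : y ∈ O) (k : Fin d) :
    pd (bv v l y) (pd (ev k) v) y = pd (ev k) (zet v l) y := by
  rw [pd_bv, pd_zet hO hv hy, pd_comm hO hv hy (ev l)]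
  congr 1
  exact Finset.sum_congr rfl fun i _ => by rw [pd_comm hO hv hy (ev i)]

lemma sum_chi_sq_flat (h : zet v l y = 0) :
    ∑ i, chi l i * pd (ev i) v y ^ 2 = 2 * pd (ev l) v y + pd (ev l) v y ^ 2 := by
  unfold zet at h; linarith

lemma pd_normal_nonneg (h : zet v l y = 0) (hs : ‖fderiv ℝ v y‖ ≤ ε) (hε : ε ≤ 1) :
    0 ≤ pd (ev l) v y := by
  have h1 := sum_chi_sq_flat h
  have h2 : 0 ≤ ∑ i, chi l i * pd (ev i) v y ^ 2 :=
    Finset.sum_nonneg fun i _ => mul_nonneg (chi_nonneg l i) (sq_nonneg _)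
  have h3 := (abs_le.1 ((abs_pd_ev_le (f := v) (y := y) l).trans hs)).1
  by_contra! hneg
  nlinarith

lemma pd_bv_self (h : zet v l y = 0) : pd (bv v l y) v y = - pd (ev l) v y := by
  have h1 := sum_chi_sq_flat h
  rw [pd_bv]
  have : ∑ i, chi l i * pd (ev i) v y * pd (ev i) v y = ∑ i, chi l i * pd (ev i) v y ^ 2 :=
    Finset.sum_congr rfl fun i _ => by ring
  rw [this, h1]; ring

lemma norm_fderiv_le_of_pd {M : ℝ} (h : ∀ i, |pd (ev i) f y| ≤ M) :
    ‖fderiv ℝ f y‖ ≤ d * M := by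
  rcases Nat.eq_zero_or_pos d with rfl | hd
  · refine ContinuousLinearMap.opNorm_le_bound _ (by simp) fun x => ?_
    have : x = 0 := Subsingleton.elim _ _
    simp [this]
  have hM : 0 ≤ M := (abs_nonneg _).trans (h ⟨0, hd⟩)
  refine ContinuousLinearMap.opNorm_le_bound _ (by positivity) fun x => ?_
  have hx : x = ∑ i, x i • ev i := by
    ext j; simp [WithLp.ofLp_sum, Finset.sum_apply, Pi.single_apply]
  have h2 : fderiv ℝ f y x = ∑ i, x i * pd (ev i) f y := by
    conv_lhs => rw [hx]
    simp [map_sum, pd]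
  rw [h2, Real.norm_eq_abs, mul_assoc]
  refine abs_sum_fin_le fun i => ?_
  rw [abs_mul, mul_comm]
  have h3 : |x i| ≤ ‖x‖ := by simpa using PiLp.norm_apply_le x i
  exact mul_le_mul (h i) h3 (abs_nonneg _) hM

/-- The euclidean norm of the Hessian. -/
def hnorm (v : EuclideanSpace ℝ (Fin d) → ℝ) (y : EuclideanSpace ℝ (Fin d)) : ℝ :=
  √(∑ i, ∑ j, pd (ev i) (pd (ev j) v) y ^ 2)

lemma hnorm_nonneg : 0 ≤ hnorm v y := sqrt_nonneg _

lemma abs_le_hnorm (i j : Fin d) : |pd (ev i) (pd (ev j) v) y| ≤ hnorm v y := by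
  refine Real.abs_le_sqrt ?_
  exact (Finset.single_le_sum (f := fun j => pd (ev i) (pd (ev j) v) y ^ 2)
    (fun _ _ => sq_nonneg _) (Finset.mem_univ j)).trans
    (Finset.single_le_sum (f := fun i => ∑ j, pd (ev i) (pd (ev j) v) y ^ 2)
      (fun _ _ => Finset.sum_nonneg fun _ _ => sq_nonneg _) (Finset.mem_univ i))

lemma hnorm_le {M : ℝ} (h : ∀ i j, |pd (ev i) (pd (ev j) v) y| ≤ M) (hM : 0 ≤ M) :
    hnorm v y ≤ d * M := by
  refine Real.sqrt_le_iff.2 ⟨by positivity, ?_⟩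
  have h1 : ∀ i, |∑ j, pd (ev i) (pd (ev j) v) y ^ 2| ≤ d * M ^ 2 := fun i =>
    abs_sum_fin_le fun j => by rw [abs_pow]; exact pow_le_pow_left₀ (abs_nonneg _) (h i j) 2
  have := (le_abs_self _).trans (abs_sum_fin_le h1)
  nlinarith

lemma abs_pd_frame_le {M : ℝ} (hs : ‖fderiv ℝ v y‖ ≤ ε) (hε : ε ≤ 1)
    (h : ∀ i, |pd (ev i) f y| ≤ M) (i : Fin d) : |pd (frame v l i y) f y| ≤ 3 * M := by
  rw [pd_frame]
  have h1 := abs_cfA_le (l := l) hs hε i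
  have h2 := (abs_cfB_le (l := l) hs i).trans hε
  refine (abs_add_le _ _).trans ?_
  rw [abs_mul, abs_mul]
  have h3 := mul_le_mul h1 (h i) (abs_nonneg _) (by norm_num)
  have h4 := mul_le_mul h2 (h l) (abs_nonneg _) (by norm_num)
  linarith

lemma abs_Gam_le {M N : ℝ} (hs : ‖fderiv ℝ v y‖ ≤ ε) (hε : ε ≤ 1)
    (hf : ∀ i, |pd (ev i) f y| ≤ M) (hg : ∀ i, |pd (ev i) g y| ≤ N) :
    |Gam v l f g y| ≤ 9 * d * (M * N) := by
  have : |Gam v l f g y| ≤ d * (9 * (M * N)) := by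
    refine abs_sum_fin_le fun i => ?_
    rw [abs_mul]
    have h1 := abs_pd_frame_le (l := l) hs hε hf i
    have h2 := abs_pd_frame_le (l := l) hs hε hg i
    have := mul_le_mul h1 h2 (abs_nonneg _) ((abs_nonneg _).trans h1)
    linarith
  linarith

lemma abs_pd_ev_le_of_frame {M N : ℝ} (hs : ‖fderiv ℝ v y‖ ≤ ε)
    (h : ∀ i, |pd (ev i) f y| ≤ M) {i : Fin d} (hN : |pd (frame v l i y) f y| ≤ N) :
    |pd (ev i) f y| ≤ N + 2 * ε * M := by
  rw [pd_frame] at hN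
  have h1 := abs_cfA_sub_one_le (l := l) hs i
  have h2 := abs_cfB_le (l := l) hs i
  have h3 := mul_le_mul h1 (h i) (abs_nonneg _) ((abs_nonneg _).trans h1)
  have h4 := mul_le_mul h2 (h l) (abs_nonneg _) ((abs_nonneg _).trans h2)
  rw [← abs_mul] at h3 h4
  rw [abs_le] at *
  constructor <;> linarith [h3.1, h3.2, h4.1, h4.2]

lemma abs_pd_frame_le_sqrt_Gam (i : Fin d) : |pd (frame v l i y) f y| ≤ √(Gam v l f f y) := by
  refine Real.abs_le_sqrt ?_
  rw [sq]
  exact Finset.single_le_sum (f := fun i => pd (frame v l i y) f y * pd (frame v l i y) f y)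
    (fun _ _ => mul_self_nonneg _) (Finset.mem_univ i)

/-- The boundary adapted gradient. -/
def grd (v : EuclideanSpace ℝ (Fin d) → ℝ) (l k : Fin d) : EuclideanSpace ℝ (Fin d) → ℝ :=
  if k = l then zet v l else pd (ev k) v

lemma smoothOn_grd (hO : IsOpen O) (hv : SmoothOn O v) (k : Fin d) : SmoothOn O (grd v l k) := by
  unfold grd
  split_ifs
  · exact smoothOn_zet hO hv
  · exact hv.pd hO _

lemma abs_zet_sub_le {n : ℝ} (hn : ∀ i, |pd (ev i) v y| ≤ n) :
    |zet v l y - pd (ev l) v y| ≤ d * n ^ 2 := by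
  have hd : (1 : ℝ) ≤ d := by exact_mod_cast (Fin.pos l)
  have h1 : |∑ i, chi l i * pd (ev i) v y ^ 2| ≤ d * n ^ 2 :=
    abs_sum_fin_le fun i => abs_chi_mul_le i (by
      rw [abs_pow]; exact pow_le_pow_left₀ (abs_nonneg _) (hn i) 2)
  have h2 : pd (ev l) v y ^ 2 ≤ n ^ 2 := by
    rw [← sq_abs]; exact pow_le_pow_left₀ (abs_nonneg _) (hn l) 2
  have h3 := sq_nonneg (pd (ev l) v y)
  have h4 : n ^ 2 ≤ d * n ^ 2 := by nlinarith [sq_nonneg n]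
  simp only [zet, add_sub_cancel_left]
  rw [abs_le] at *
  constructor <;> linarith [h1.1, h1.2]

lemma abs_Lop_zet_le (H : HodLoc l v O ε) (hε : ε ≤ 1) (hy : y ∈ O) (hyl : 0 < y l) :
    |Lop v l (zet v l) y| ≤ 66 * d ^ 2 * hnorm v y ^ 2 := by
  have hO := H.isOpen
  have hv := H.smooth
  have hs := H.small y hy hyl.le
  have hd : (1 : ℝ) ≤ d := by exact_mod_cast (Fin.pos l)
  set h := hnorm v y
  have h1 := fun i => (abs_pd_ev_le (f := v) (y := y) i).trans (hs.trans hε)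
  have hL := fun k => H.abs_Lop_pd_le hε hy hyl (fun i j => abs_le_hnorm (v := v) i j) k
  have hG := fun k => abs_Gam_le (l := l) (f := pd (ev k) v) (g := pd (ev k) v) hs hε
    (fun i => abs_le_hnorm i k) (fun i => abs_le_hnorm i k)
  rw [Lop_zet hO hv hy]
  have b0 : ∀ i, |pd (ev i) v y * Lop v l (pd (ev i) v) y| ≤ 16 * d * h ^ 2 := by
    intro i
    rw [abs_mul]
    have := mul_le_mul (h1 i) (hL i) (abs_nonneg _) (by norm_num)
    linarith
  have b1 : |∑ i, chi l i * (pd (ev i) v y * Lop v l (pd (ev i) v) y +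
        Gam v l (pd (ev i) v) (pd (ev i) v) y)| ≤ d * (25 * d * h ^ 2) := by
    refine abs_sum_fin_le fun i => abs_chi_mul_le i ?_
    refine (abs_add_le _ _).trans ?_
    have := hG i
    have := b0 i
    linarith
  have b2 := b0 l
  have b3 := hL l
  have b4 := hG l
  have h5 : d * h ^ 2 ≤ d ^ 2 * h ^ 2 := by
    have := sq_nonneg h
    have : (d : ℝ) ≤ d ^ 2 := by nlinarith
    gcongr
  rw [abs_le] at *
  constructor <;> linarith [b1.1, b1.2, b2.1, b2.2, b3.1, b3.2, b4.1, b4.2]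

/-- The smallness threshold of the gradient. -/
def eps1 (d : ℕ) : ℝ := 1 / (30000 * d ^ 8)

lemma eps1_mul_le (hd : 1 ≤ d) : eps1 d * d ^ 8 ≤ 1 / 30000 := by
  have : (0 : ℝ) < d := by exact_mod_cast hd
  unfold eps1
  field_simp
  norm_num

lemma eps_mul_pow_le (l : Fin d) (hε : ε ≤ eps1 d) {j : ℕ} (hj : j ≤ 8) :
    ε * d ^ j ≤ 1 / 30000 := by
  have hd : (1 : ℝ) ≤ d := by exact_mod_cast (Fin.pos l)
  have h1 : (d : ℝ) ^ j ≤ d ^ 8 := pow_le_pow_right₀ hd hj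
  have h2 := eps1_mul_le (d := d) (Fin.pos l)
  have h3 : 0 < eps1 d := by unfold eps1; positivity
  calc ε * d ^ j ≤ eps1 d * d ^ j := by gcongr
    _ ≤ eps1 d * d ^ 8 := by gcongr
    _ ≤ _ := h2

lemma hnorm_sq_le_Gam (H : HodLoc l v O ε) (hε : ε ≤ eps1 d) (hy : y ∈ O) (hyl : 0 < y l) :
    hnorm v y ^ 2 ≤ 64 * d ^ 4 * ∑ k, Gam v l (grd v l k) (grd v l k) y := by
  have hO := H.isOpen
  have hv := H.smooth
  have hs := H.small y hy hyl.le
  have hε0 : 0 ≤ ε := (norm_nonneg _).trans hs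
  have hd : (1 : ℝ) ≤ d := by exact_mod_cast (Fin.pos l)
  have hε1 := eps_mul_pow_le l hε (j := 0) (by norm_num)
  have hε2 := eps_mul_pow_le l hε (j := 2) (by norm_num)
  set h := hnorm v y with hh
  have hh0 : 0 ≤ h := hnorm_nonneg
  set G := ∑ k, Gam v l (grd v l k) (grd v l k) y with hG
  have hGk : ∀ k, Gam v l (grd v l k) (grd v l k) y ≤ G := fun k =>
    Finset.single_le_sum (f := fun k => Gam v l (grd v l k) (grd v l k) y)
      (fun _ _ => Gam_self_nonneg) (Finset.mem_univ k)
  have hG0 : 0 ≤ G := (Gam_self_nonneg).trans (hGk l)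
  have b1 : ∀ k, k ≠ l → ∀ i, |pd (ev i) (pd (ev k) v) y| ≤ √G + 2 * ε * h := by
    intro k hk i
    refine abs_pd_ev_le_of_frame (l := l) hs (fun i => abs_le_hnorm i k) ?_
    refine (abs_pd_frame_le_sqrt_Gam i).trans (Real.sqrt_le_sqrt ?_)
    simpa [grd, hk] using hGk k
  have hq : 0 ≤ √G + 2 * ε * h := by positivity
  have b2 : |pd (ev l) (pd (ev l) v) y| ≤
      0 + 4 * ∑ i, chi l i * |pd (ev i) (pd (ev i) v) y| + 5 * d * ε * h := by
    refine abs_normal_le (l := l) (X := fun i j => pd (ev i) (pd (ev j) v) y) hs (by linarith)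
      (fun i j => abs_le_hnorm i j) ?_
    rw [← Lop_eq_sum_qf hO hv hy, H.pde y hy hyl, abs_zero]
  have b3 : abs (∑ i, chi l i * |pd (ev i) (pd (ev i) v) y|) ≤ d * (√G + 2 * ε * h) := by
    refine abs_sum_fin_le fun i => ?_
    by_cases hi : i = l
    · simpa [hi, chi_self] using hq
    · exact abs_chi_mul_le i (by rw [abs_abs]; exact b1 i hi i)
  have b3' := (le_abs_self _).trans b3
  set M := 4 * d * √G + 13 * d * ε * h with hM
  have hdG : √G ≤ d * √G := by nlinarith [Real.sqrt_nonneg G]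
  have hdε : ε * h ≤ d * (ε * h) := by nlinarith [mul_nonneg hε0 hh0]
  have hdG' := Real.sqrt_nonneg G
  have hdε' := mul_nonneg hε0 hh0
  have b4 : ∀ i j, |pd (ev i) (pd (ev j) v) y| ≤ M := by
    intro i j
    by_cases hj : j = l
    · by_cases hi : i = l
      · subst hj; subst hi
        nlinarith
      · rw [pd_comm hO hv hy]
        have := b1 i hi j
        nlinarith
    · have := b1 j hj i
      nlinarith
  have hM0 : 0 ≤ M := by positivity
  have b5 : h ≤ d * M := hnorm_le b4 hM0
  have b6 : h ≤ 8 * d ^ 2 * √G := by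
    have : d * M = 4 * d ^ 2 * √G + 13 * (ε * d ^ 2) * h := by rw [hM]; ring
    nlinarith
  calc h ^ 2 ≤ (8 * d ^ 2 * √G) ^ 2 := by gcongr
    _ = 64 * d ^ 4 * G := by rw [mul_pow, Real.sq_sqrt hG0]; ring

lemma grd_interior (H : HodLoc l v O ε) (hε : ε ≤ eps1 d) (hy : y ∈ O) (hyl : 0 < y l) :
    -(1 / 2 * ∑ k, Gam v l (grd v l k) (grd v l k) y) ≤
      ∑ k, grd v l k y * Lop v l (grd v l k) y := by
  have hs := H.small y hy hyl.le
  have hε0 : 0 ≤ ε := (norm_nonneg _).trans hs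
  have hd : (1 : ℝ) ≤ d := by exact_mod_cast (Fin.pos l)
  have hε1 := eps_mul_pow_le l hε (j := 0) (by norm_num)
  have hε1' : ε ≤ 1 := by linarith
  have hε8 := eps_mul_pow_le l hε (j := 8) le_rfl
  have hG := hnorm_sq_le_Gam H hε hy hyl
  set G := ∑ k, Gam v l (grd v l k) (grd v l k) y with hGdef
  set h := hnorm v y with hh
  have hG0 : 0 ≤ G := Finset.sum_nonneg fun _ _ => Gam_self_nonneg
  have h1 := fun i => (abs_pd_ev_le (f := v) (y := y) i).trans hs
  have b1 : ∀ k, |grd v l k y| ≤ 2 * d * ε := by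
    intro k
    unfold grd
    split_ifs
    · have h2 := abs_zet_sub_le (l := l) h1
      have h3 := h1 l
      have h4 : d * ε ^ 2 ≤ d * ε := by
        have : ε ^ 2 ≤ ε := by nlinarith
        gcongr
      have h5 : ε ≤ d * ε := by nlinarith
      rw [abs_le] at *
      constructor <;> linarith [h2.1, h2.2]
    · have := h1 k
      nlinarith
  have b2 : ∀ k, |Lop v l (grd v l k) y| ≤ 66 * d ^ 2 * h ^ 2 := by
    intro k
    unfold grd
    split_ifs
    · exact abs_Lop_zet_le H hε1' hy hyl
    · have := H.abs_Lop_pd_le hε1' hy hyl (fun i j => abs_le_hnorm (v := v) i j) k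
      have h6 : d * h ^ 2 ≤ d ^ 2 * h ^ 2 := by
        have : (d : ℝ) ≤ d ^ 2 := by nlinarith
        gcongr
      have : 0 ≤ (d : ℝ) ^ 2 * h ^ 2 := by positivity
      linarith
  have b3 : |∑ k, grd v l k y * Lop v l (grd v l k) y| ≤
      d * ((2 * d * ε) * (66 * d ^ 2 * h ^ 2)) := by
    refine abs_sum_fin_le fun k => ?_
    rw [abs_mul]
    exact mul_le_mul (b1 k) (b2 k) (abs_nonneg _) (by positivity)
  have b4 : d * ((2 * d * ε) * (66 * d ^ 2 * h ^ 2)) ≤ 1 / 2 * G := by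
    calc d * ((2 * d * ε) * (66 * d ^ 2 * h ^ 2)) = 132 * (d ^ 4 * ε) * h ^ 2 := by ring
      _ ≤ 132 * (d ^ 4 * ε) * (64 * d ^ 4 * G) := by gcongr
      _ = 8448 * (ε * d ^ 8) * G := by ring
      _ ≤ 8448 * (1 / 30000) * G := by gcongr
      _ ≤ 1 / 2 * G := by nlinarith
  linarith [(abs_le.1 b3).1]

lemma grd_flat (H : HodLoc l v O ε) (hy : y ∈ O) (hyl : y l = 0) (k : Fin d) :
    grd v l k y * pd (bv v l y) (grd v l k) y = 0 := by
  unfold grd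
  split_ifs with hk
  · have : zet v l y = 0 := H.bc y hy hyl
    rw [this, zero_mul]
  · rw [pd_bv_pd H.isOpen H.smooth hy, H.pd_zet_flat hy hyl hk, mul_zero]

lemma sq_grd_le_sumSq (k : Fin d) : |grd v l k y| ≤ √(sumSq (grd v l) y) :=
  Real.abs_le_sqrt (Finset.single_le_sum (f := fun k => grd v l k y ^ 2)
    (fun _ _ => sq_nonneg _) (Finset.mem_univ k))

lemma norm_fderiv_le_sumSq (hs : ‖fderiv ℝ v y‖ ≤ ε) (hε : ε ≤ eps1 d) (l : Fin d) :
    ‖fderiv ℝ v y‖ ≤ 2 * d * √(sumSq (grd v l) y) := by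
  set n := ‖fderiv ℝ v y‖ with hn
  have hn0 : 0 ≤ n := norm_nonneg _
  have hd : (1 : ℝ) ≤ d := by exact_mod_cast (Fin.pos l)
  have hε2 := eps_mul_pow_le l hε (j := 2) (by norm_num)
  set q := √(sumSq (grd v l) y) with hq
  have h1 : ∀ i, |pd (ev i) v y| ≤ q + d * n ^ 2 := by
    intro i
    have h2 := sq_grd_le_sumSq (v := v) (l := l) (y := y) i
    by_cases hi : i = l
    · subst hi
      have h3 := abs_zet_sub_le (l := i) (fun j => abs_pd_ev_le (f := v) (y := y) j)
      simp only [grd, if_true] at h2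
      rw [abs_le] at *
      constructor <;> linarith [h2.1, h2.2, h3.1, h3.2]
    · simp only [grd, hi, if_false] at h2
      have : 0 ≤ d * n ^ 2 := by positivity
      linarith
  have h2 := norm_fderiv_le_of_pd h1
  rw [← hn] at h2
  have h3 : d * (d * n ^ 2) ≤ 1 / 2 * n := by
    have : d ^ 2 * n ≤ 1 / 2 := by
      calc d ^ 2 * n ≤ d ^ 2 * ε := by gcongr
        _ ≤ _ := by linarith
    calc d * (d * n ^ 2) = (d ^ 2 * n) * n := by ring
      _ ≤ _ := by gcongr
  nlinarith

lemma sumSq_grd_le_norm (hs : ‖fderiv ℝ v y‖ ≤ ε) (hε : ε ≤ eps1 d) (l : Fin d) :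
    sumSq (grd v l) y ≤ 4 * d * ‖fderiv ℝ v y‖ ^ 2 := by
  set n := ‖fderiv ℝ v y‖ with hn
  have hn0 : 0 ≤ n := norm_nonneg _
  have hd : (1 : ℝ) ≤ d := by exact_mod_cast (Fin.pos l)
  have hε2 := eps_mul_pow_le l hε (j := 1) (by norm_num)
  have h1 : ∀ k, |grd v l k y ^ 2| ≤ 4 * n ^ 2 := by
    intro k
    have h0 := fun j => abs_pd_ev_le (f := v) (y := y) j
    have h2 : |grd v l k y| ≤ 2 * n := by
      unfold grd
      split_ifs
      · have h3 := abs_zet_sub_le (l := l) h0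
        have h4 := h0 l
        have : d * n ^ 2 ≤ n := by
          have : d * n ≤ 1 := by nlinarith
          nlinarith
        rw [abs_le] at *
        constructor <;> linarith [h3.1, h3.2]
      · linarith [h0 k]
    rw [abs_pow]
    nlinarith [abs_nonneg (grd v l k y)]
  have := (le_abs_self _).trans (abs_sum_fin_le h1)
  unfold sumSq
  linarith

lemma norm_sq_le_Gam (hs : ‖fderiv ℝ v y‖ ≤ ε) (hε : ε ≤ eps1 d) (l : Fin d) :
    ‖fderiv ℝ v y‖ ^ 2 ≤ 4 * d ^ 2 * Gam v l v v y := by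
  set n := ‖fderiv ℝ v y‖ with hn
  have hn0 : 0 ≤ n := norm_nonneg _
  have hd : (1 : ℝ) ≤ d := by exact_mod_cast (Fin.pos l)
  have hε2 := eps_mul_pow_le l hε (j := 1) (by norm_num)
  have hG0 : 0 ≤ Gam v l v v y := Gam_self_nonneg
  have h1 : ∀ i, |pd (ev i) v y| ≤ √(Gam v l v v y) + 2 * ε * n := fun i =>
    abs_pd_ev_le_of_frame (l := l) hs (fun i => abs_pd_ev_le i) (abs_pd_frame_le_sqrt_Gam i)
  have h2 := norm_fderiv_le_of_pd h1
  rw [← hn] at h2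
  have h3 : n ≤ 2 * d * √(Gam v l v v y) := by nlinarith
  calc n ^ 2 ≤ (2 * d * √(Gam v l v v y)) ^ 2 := by gcongr
    _ = _ := by rw [mul_pow, Real.sq_sqrt hG0]; ring

/-- The interior and boundary gradient estimate. -/
lemma grad_estimate (d : ℕ) (hd : 1 ≤ d) : ∃ C : ℝ, 0 < C ∧
    ∀ (l : Fin d) (v : EuclideanSpace ℝ (Fin d) → ℝ) (O : Set (EuclideanSpace ℝ (Fin d)))
      (ε : ℝ) (x : EuclideanSpace ℝ (Fin d)) (r m M : ℝ),
      HodLoc l v O ε → ε ≤ eps1 d → 0 < r → 0 ≤ x l →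
      (∀ y, ‖y - x‖ ≤ 2 * r → 0 ≤ y l → y ∈ O ∧ m ≤ v y ∧ v y ≤ M) →
      r * ‖fderiv ℝ v x‖ ≤ C * (M - m) := by
  have hd1 : (1 : ℝ) ≤ d := by exact_mod_cast hd
  obtain ⟨K, hK, hB⟩ := bernstein_estimate d 0 (1 / (8 * d ^ 3)) (by positivity)
  refine ⟨2 * d * √K, by positivity, ?_⟩
  intro l v O ε x r m M H hε hr hxl hball
  have hO := H.isOpen
  have hv := H.smooth
  have hε1 := eps_mul_pow_le l hε (j := 0) (by norm_num)
  set x₀ : EuclideanSpace ℝ (Fin d) := x + (r / 8) • ev l with hx₀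
  have hx0 : ‖x - x₀‖ = r / 8 := by
    simp [hx₀, norm_smul, abs_of_pos hr]
  have hx0l : r / 8 ≤ x₀ l := by simpa [hx₀] using hxl
  have hsub : ∀ y, ‖y - x₀‖ ≤ r → 0 ≤ y l → y ∈ O ∧ m ≤ v y ∧ v y ≤ M := by
    intro y hy hyl
    refine hball y ?_ hyl
    have : ‖y - x‖ ≤ ‖y - x₀‖ + ‖x - x₀‖ := by
      rw [← norm_neg (x - x₀)]
      have : y - x = (y - x₀) + -(x - x₀) := by abel
      rw [this]; exact norm_add_le _ _
    linarith
  have hvM : SmoothOn O (fun z => v z - M) := hv.sub contDiffOn_const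
  obtain ⟨hxO, hxm, hxM⟩ := hsub x (by rw [hx0]; linarith) hxl
  have key := hB (Fin d) l v O ε x₀ r ((M - m) ^ 2) (grd v l) (fun z => (v z - M) ^ 2) H
    (by linarith) hr hx0l (fun y h1 h2 => (hsub y h1 h2).1) (smoothOn_grd hO hv) (hvM.pow 2)
    (fun y h1 h2 => ⟨sq_nonneg _, by obtain ⟨_, h3, h4⟩ := hsub y h1 h2; nlinarith⟩)
    (fun y h1 h2 => ?_) (fun y h1 h2 => ?_) x (by rw [hx0]; linarith) hxl
  · have hs := H.small x hxO hxl
    have h1 := norm_fderiv_le_sumSq hs hε l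
    have h2 : r * √(sumSq (grd v l) x) ≤ √K * (M - m) := by
      refine abs_le_of_sq_le_sq' ?_ (by have := Real.sqrt_nonneg K; nlinarith) |>.2
      rw [mul_pow, mul_pow, Real.sq_sqrt sumSq_nonneg, Real.sq_sqrt hK.le]
      exact key
    calc r * ‖fderiv ℝ v x‖ ≤ r * (2 * d * √(sumSq (grd v l) x)) := by gcongr
      _ = 2 * d * (r * √(sumSq (grd v l) x)) := by ring
      _ ≤ 2 * d * (√K * (M - m)) := by gcongr
      _ = _ := by ring
  · have hyO := (hsub y h1 h2.le).1
    have hs := H.small y hyO h2.le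
    constructor
    · have := grd_interior H hε hyO h2
      simpa using this
    · rw [Lop_sq hO hvM hyO, Lop_sub hO hv contDiffOn_const hyO, Lop_const, H.pde y hyO h2]
      have e : Gam v l (fun z => v z - M) (fun z => v z - M) y = Gam v l v v y := by
        unfold Gam
        refine Finset.sum_congr rfl fun i _ => ?_
        rw [pd_sub (hv.differentiableAt hO hyO) (differentiableAt_const M), pd_const, sub_zero]
      rw [e]
      have h3 := sumSq_grd_le_norm hs hε l
      have h4 := norm_sq_le_Gam hs hε l
      have h5 : sumSq (grd v l) y ≤ 16 * d ^ 3 * Gam v l v v y := by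
        calc _ ≤ 4 * d * ‖fderiv ℝ v y‖ ^ 2 := h3
          _ ≤ 4 * d * (4 * d ^ 2 * Gam v l v v y) := by gcongr
          _ = _ := by ring
      calc 1 / (8 * (d : ℝ) ^ 3) * sumSq (grd v l) y
          ≤ 1 / (8 * (d : ℝ) ^ 3) * (16 * d ^ 3 * Gam v l v v y) := by gcongr
        _ = 2 * Gam v l v v y := by field_simp; ring
        _ ≤ _ := by simp
  · obtain ⟨hyO, hym, hyM⟩ := hsub y h1 h2.ge
    have hs := H.small y hyO h2.ge
    have hz : zet v l y = 0 := H.bc y hyO h2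
    constructor
    · rw [Finset.sum_eq_zero fun k _ => grd_flat H hyO h2 k]
      have : 0 ≤ sumSq (grd v l) y / (16 * r) := div_nonneg sumSq_nonneg (by positivity)
      linarith
    · rw [pd_sq (hvM.differentiableAt hO hyO),
        pd_sub (hv.differentiableAt hO hyO) (differentiableAt_const M), pd_const, sub_zero,
        pd_bv_self hz]
      have := pd_normal_nonneg hz hs (by linarith)
      nlinarith

end Gradient

section Hessian

variable {d : ℕ} {v : EuclideanSpace ℝ (Fin d) → ℝ} {l : Fin d}
  {O : Set (EuclideanSpace ℝ (Fin d))}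
  {f g : EuclideanSpace ℝ (Fin d) → ℝ} {y : EuclideanSpace ℝ (Fin d)} {ε : ℝ}

lemma continuousOn_Lop (hO : IsOpen O) (hv : SmoothOn O v) (hf : SmoothOn O f) :
    ContinuousOn (Lop v l f) O := by
  have e : EqOn (Lop v l f) (fun y => ∑ i, qf (cfA v l i y) (cfB v l i y) (cfA v l i y)
      (cfB v l i y) (pd (ev i) (pd (ev i) f) y) (pd (ev l) (pd (ev i) f) y)
      (pd (ev l) (pd (ev l) f) y)) O := fun z hz => Lop_eq_sum_qf hO hf hz
  refine ContinuousOn.congr ?_ e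
  have h2 := fun i j => ((hf.pd hO (ev j)).pd hO (ev i)).continuousOn
  have hA := fun i => (smoothOn_cfA (l := l) hO hv i).continuousOn
  have hB := fun i => (smoothOn_cfB (l := l) hO hv i).continuousOn
  refine continuousOn_finsetSum _ fun i _ => ?_
  have q1 := hA i
  have q2 := hB i
  have q3 := h2 i i
  have q4 := h2 l i
  have q5 := h2 l l
  unfold qf
  fun_prop

lemma HodLoc.pde_flat (H : HodLoc l v O ε) (hy : y ∈ O) (hyl : 0 ≤ y l) : Lop v l v y = 0 := by
  have hc := (continuousOn_Lop (l := l) H.isOpen H.smooth H.smooth).continuousAt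
    (H.isOpen.mem_nhds hy)
  set γ : ℝ → EuclideanSpace ℝ (Fin d) := fun t => y + t • ev l with hγ
  have hγ0 : γ 0 = y := by simp [hγ]
  have hγc : Continuous γ := by fun_prop
  have h1 : Tendsto (fun t => Lop v l v (γ t)) (nhdsWithin 0 (Ioi 0)) (nhds (Lop v l v y)) := by
    have : Tendsto γ (nhdsWithin 0 (Ioi 0)) (nhds y) := by
      rw [← hγ0]; exact hγc.continuousAt.tendsto.mono_left nhdsWithin_le_nhds
    exact hc.tendsto.comp this
  have h2 : (fun t => Lop v l v (γ t)) =ᶠ[nhdsWithin 0 (Ioi 0)] fun _ => 0 := by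
    have h3 : ∀ᶠ t in nhdsWithin (0 : ℝ) (Ioi 0), γ t ∈ O := by
      refine hγc.continuousAt.mono_left nhdsWithin_le_nhds ?_
      rw [hγ0]; exact H.isOpen.mem_nhds hy
    filter_upwards [h3, self_mem_nhdsWithin] with t ht htp
    have htp : 0 < t := htp
    exact H.pde _ ht (by simp [hγ]; linarith)
  exact tendsto_nhds_unique (h1.congr' h2) tendsto_const_nhds

/-- The euclidean norm of the third derivatives. -/
def tnorm (v : EuclideanSpace ℝ (Fin d) → ℝ) (y : EuclideanSpace ℝ (Fin d)) : ℝ :=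
  √(∑ i, ∑ j, ∑ k, pd (ev i) (pd (ev j) (pd (ev k) v)) y ^ 2)

lemma tnorm_nonneg : 0 ≤ tnorm v y := sqrt_nonneg _

lemma abs_le_tnorm (i j k : Fin d) : |pd (ev i) (pd (ev j) (pd (ev k) v)) y| ≤ tnorm v y := by
  refine Real.abs_le_sqrt ?_
  exact (Finset.single_le_sum (f := fun k => pd (ev i) (pd (ev j) (pd (ev k) v)) y ^ 2)
    (fun _ _ => sq_nonneg _) (Finset.mem_univ k)).trans <|
    (Finset.single_le_sum (f := fun j => ∑ k, pd (ev i) (pd (ev j) (pd (ev k) v)) y ^ 2)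
      (fun _ _ => Finset.sum_nonneg fun _ _ => sq_nonneg _) (Finset.mem_univ j)).trans
    (Finset.single_le_sum (f := fun i => ∑ j, ∑ k, pd (ev i) (pd (ev j) (pd (ev k) v)) y ^ 2)
      (fun _ _ => Finset.sum_nonneg fun _ _ => Finset.sum_nonneg fun _ _ => sq_nonneg _)
      (Finset.mem_univ i))

lemma tnorm_le {M : ℝ} (hd : 1 ≤ d) (h : ∀ i j k, |pd (ev i) (pd (ev j) (pd (ev k) v)) y| ≤ M)
    (hM : 0 ≤ M) : tnorm v y ≤ d ^ 2 * M := by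
  have hd1 : (1 : ℝ) ≤ d := by exact_mod_cast hd
  refine Real.sqrt_le_iff.2 ⟨by positivity, ?_⟩
  have h1 : ∀ i j, |∑ k, pd (ev i) (pd (ev j) (pd (ev k) v)) y ^ 2| ≤ d * M ^ 2 := fun i j =>
    abs_sum_fin_le fun k => by rw [abs_pow]; exact pow_le_pow_left₀ (abs_nonneg _) (h i j k) 2
  have := (le_abs_self _).trans (abs_sum_fin_le fun i => abs_sum_fin_le (h1 i))
  have h2 : (d : ℝ) ^ 3 * M ^ 2 ≤ d ^ 4 * M ^ 2 := by
    gcongr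
    norm_num
  nlinarith

lemma pd_pd_pd_comm (hO : IsOpen O) (hv : SmoothOn O v) (hy : y ∈ O) (i j k : Fin d) :
    pd (ev i) (pd (ev j) (pd (ev k) v)) y = pd (ev i) (pd (ev k) (pd (ev j) v)) y :=
  pd_congr hO (fun _ hz => pd_comm hO hv hz _ _) hy _

/-- The differentiated boundary function, expanded. -/
lemma pd_zet_eqOn (hO : IsOpen O) (hv : SmoothOn O v) (k : Fin d) :
    EqOn (pd (ev k) (zet v l)) (fun y => (1 + pd (ev l) v y) * pd (ev k) (pd (ev l) v) y -
      ∑ j, chi l j * (pd (ev j) v y * pd (ev k) (pd (ev j) v) y)) O := by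
  intro y hy
  rw [pd_zet hO hv hy]
  simp only [mul_assoc]

lemma pd_pd_zet (hO : IsOpen O) (hv : SmoothOn O v) (hy : y ∈ O) (k : Fin d)
    (ξ : EuclideanSpace ℝ (Fin d)) :
    pd ξ (pd (ev k) (zet v l)) y =
      (1 + pd (ev l) v y) * pd ξ (pd (ev k) (pd (ev l) v)) y +
      pd (ev k) (pd (ev l) v) y * pd ξ (pd (ev l) v) y -
      ∑ j, chi l j * (pd (ev j) v y * pd ξ (pd (ev k) (pd (ev j) v)) y +
        pd (ev k) (pd (ev j) v) y * pd ξ (pd (ev j) v) y) := by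
  have h1 := fun i => (hv.pd hO (ev i)).differentiableAt hO hy
  have h2 := fun i => ((hv.pd hO (ev i)).pd hO (ev k)).differentiableAt hO hy
  have h3 := fun i => (h1 i).fun_mul (h2 i)
  have h4 : DifferentiableAt ℝ (fun z => 1 + pd (ev l) v z) y := (h1 l).const_add _
  have h5 : pd ξ (fun z => 1 + pd (ev l) v z) y = pd ξ (pd (ev l) v) y := by
    rw [pd_add (differentiableAt_const _) (h1 l), pd_const, zero_add]
  rw [pd_congr hO (pd_zet_eqOn hO hv k) hy, pd_sub (h4.fun_mul (h2 l))
    (DifferentiableAt.fun_sum fun j _ => (h3 j).const_mul _), pd_mul h4 (h2 l), h5,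
    pd_sum _ (fun j z => chi l j * (pd (ev j) v z * pd (ev k) (pd (ev j) v) z))
      (fun j _ => (h3 j).const_mul _)]
  congr 1
  refine Finset.sum_congr rfl fun j _ => ?_
  rw [pd_const_mul (h3 j), pd_mul (h1 j) (h2 j)]

lemma abs_pd_zet_sub_le {p h : ℝ} (hs : ‖fderiv ℝ v y‖ ≤ ε) (hO : IsOpen O) (hv : SmoothOn O v)
    (hy : y ∈ O) (k : Fin d) (hh : |pd (ev k) (pd (ev l) v) y| ≤ h)
    (hp : ∀ j, |chi l j * pd (ev k) (pd (ev j) v) y| ≤ p) :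
    |pd (ev k) (zet v l) y - pd (ev k) (pd (ev l) v) y| ≤ ε * h + d * (ε * p) := by
  rw [pd_zet_eqOn hO hv k hy]
  have h1 := fun j => (abs_pd_ev_le (f := v) (y := y) j).trans hs
  have hε0 : 0 ≤ ε := (norm_nonneg _).trans hs
  have b1 : |∑ j, chi l j * (pd (ev j) v y * pd (ev k) (pd (ev j) v) y)| ≤ d * (ε * p) := by
    refine abs_sum_fin_le fun j => ?_
    rw [mul_left_comm, abs_mul]
    exact mul_le_mul (h1 j) (hp j) (abs_nonneg _) hε0
  have b2 : |pd (ev l) v y * pd (ev k) (pd (ev l) v) y| ≤ ε * h := by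
    rw [abs_mul]
    exact mul_le_mul (h1 l) hh (abs_nonneg _) hε0
  rw [abs_le] at *
  constructor <;> linarith [b1.1, b1.2, b2.1, b2.2]

lemma abs_pd_pd_zet_sub_le (hs : ‖fderiv ℝ v y‖ ≤ ε) (hO : IsOpen O) (hv : SmoothOn O v)
    (hy : y ∈ O) (i k : Fin d) :
    |pd (ev i) (pd (ev k) (zet v l)) y - pd (ev i) (pd (ev k) (pd (ev l) v)) y| ≤
      2 * d * (ε * tnorm v y + hnorm v y ^ 2) := by
  have hd : (1 : ℝ) ≤ d := by exact_mod_cast (Fin.pos l)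
  rw [pd_pd_zet hO hv hy]
  have h1 := fun j => (abs_pd_ev_le (f := v) (y := y) j).trans hs
  have hε0 : 0 ≤ ε := (norm_nonneg _).trans hs
  set h := hnorm v y
  set t := tnorm v y
  have ht : 0 ≤ t := tnorm_nonneg
  have b0 : ∀ j, |pd (ev j) v y * pd (ev i) (pd (ev k) (pd (ev j) v)) y| ≤ ε * t := by
    intro j
    rw [abs_mul]
    exact mul_le_mul (h1 j) (abs_le_tnorm i k j) (abs_nonneg _) hε0
  have b1 : ∀ j, |pd (ev k) (pd (ev j) v) y * pd (ev i) (pd (ev j) v) y| ≤ h ^ 2 := by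
    intro j
    rw [abs_mul, sq]
    exact mul_le_mul (abs_le_hnorm k j) (abs_le_hnorm i j) (abs_nonneg _) hnorm_nonneg
  have b2 : |∑ j, chi l j * (pd (ev j) v y * pd (ev i) (pd (ev k) (pd (ev j) v)) y +
        pd (ev k) (pd (ev j) v) y * pd (ev i) (pd (ev j) v) y)| ≤ d * (ε * t + h ^ 2) := by
    refine abs_sum_fin_le fun j => abs_chi_mul_le j ?_
    exact (abs_add_le _ _).trans (add_le_add (b0 j) (b1 j))
  have b3 : ε * t + h ^ 2 ≤ d * (ε * t + h ^ 2) := by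
    have : 0 ≤ ε * t + h ^ 2 := by positivity
    nlinarith
  have b4 := b0 l
  have b5 := b1 l
  rw [abs_le] at *
  constructor <;> linarith [b2.1, b2.2, b4.1, b4.2, b5.1, b5.2]

lemma abs_Lop_pd_zet_le (H : HodLoc l v O ε) (hε : ε ≤ 1) (hy : y ∈ O) (hyl : 0 < y l)
    (k : Fin d) : |Lop v l (pd (ev k) (zet v l)) y| ≤
      246 * d ^ 2 * (hnorm v y * tnorm v y + hnorm v y ^ 3) := by
  have hO := H.isOpen
  have hv := H.smooth
  have hs := H.small y hy hyl.le
  have hd : (1 : ℝ) ≤ d := by exact_mod_cast (Fin.pos l)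
  have s1 := fun i => hv.pd hO (ev i)
  have s2 := fun i => (hv.pd hO (ev i)).pd hO (ev k)
  have s3 := fun i => (s1 i).mul (s2 i)
  have s4 : ∀ i, SmoothOn O (fun z => chi l i * (pd (ev i) v z * pd (ev k) (pd (ev i) v) z)) :=
    fun i => contDiffOn_const.mul (s3 i)
  have s5 : SmoothOn O (fun z => 1 + pd (ev l) v z) := contDiffOn_const.add (s1 l)
  have s6 : SmoothOn O (fun z => (1 + pd (ev l) v z) * pd (ev k) (pd (ev l) v) z) := s5.mul (s2 l)
  have e1 : Lop v l (pd (ev k) (zet v l)) y =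
      Lop v l (pd (ev k) (pd (ev l) v)) y +
      (pd (ev l) v y * Lop v l (pd (ev k) (pd (ev l) v)) y +
        pd (ev k) (pd (ev l) v) y * Lop v l (pd (ev l) v) y +
        2 * Gam v l (pd (ev l) v) (pd (ev k) (pd (ev l) v)) y) -
      ∑ j, chi l j * (pd (ev j) v y * Lop v l (pd (ev k) (pd (ev j) v)) y +
        pd (ev k) (pd (ev j) v) y * Lop v l (pd (ev j) v) y +
        2 * Gam v l (pd (ev j) v) (pd (ev k) (pd (ev j) v)) y) := by
    have e2 : (fun z => (1 + pd (ev l) v z) * pd (ev k) (pd (ev l) v) z) = fun z =>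
        pd (ev k) (pd (ev l) v) z + pd (ev l) v z * pd (ev k) (pd (ev l) v) z := by
      ext z; ring
    rw [Lop_congr hO (pd_zet_eqOn hO hv k) hy,
      Lop_sub hO s6 (ContDiffOn.sum fun j _ => s4 j) hy, e2, Lop_add hO (s2 l) (s3 l) hy,
      Lop_mul hO (s1 l) (s2 l) hy,
      Lop_sum hO _ (fun j z => chi l j * (pd (ev j) v z * pd (ev k) (pd (ev j) v) z))
        (fun j _ => s4 j) hy]
    congr 1
    refine Finset.sum_congr rfl fun j _ => ?_
    rw [Lop_const_mul hO (s3 j) hy, Lop_mul hO (s1 j) (s2 j) hy]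
  set h := hnorm v y
  set t := tnorm v y
  have hh : 0 ≤ h := hnorm_nonneg
  have ht : 0 ≤ t := tnorm_nonneg
  have h1 := fun j => (abs_pd_ev_le (f := v) (y := y) j).trans (hs.trans hε)
  have L1 := fun j => H.abs_Lop_pd_le hε hy hyl (fun i j => abs_le_hnorm (v := v) i j) j
  have L2 := fun j => H.abs_Lop_pd_pd_le hε hy hyl (fun i j => abs_le_hnorm (v := v) i j)
    (fun i j k => abs_le_tnorm (v := v) i j k) j k
  have L3 := fun j => abs_Gam_le (l := l) (f := pd (ev j) v) (g := pd (ev k) (pd (ev j) v)) hs hε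
    (fun i => abs_le_hnorm i j) (fun i => abs_le_tnorm i k j)
  have b1 : ∀ j, |pd (ev j) v y * Lop v l (pd (ev k) (pd (ev j) v)) y +
        pd (ev k) (pd (ev j) v) y * Lop v l (pd (ev j) v) y +
        2 * Gam v l (pd (ev j) v) (pd (ev k) (pd (ev j) v)) y| ≤ 82 * d * (h * t + h ^ 3) := by
    intro j
    have c1 : |pd (ev j) v y * Lop v l (pd (ev k) (pd (ev j) v)) y| ≤
        1 * (64 * d * (h * t + h ^ 3)) := by
      rw [abs_mul]
      exact mul_le_mul (h1 j) (L2 j) (abs_nonneg _) zero_le_one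
    have c2 : |pd (ev k) (pd (ev j) v) y * Lop v l (pd (ev j) v) y| ≤ h * (16 * d * h ^ 2) := by
      rw [abs_mul]
      exact mul_le_mul (abs_le_hnorm k j) (L1 j) (abs_nonneg _) hh
    have c3 := L3 j
    have p1 : 0 ≤ d * (h * t) := by positivity
    have p2 : 0 ≤ d * h ^ 3 := by positivity
    rw [abs_le] at *
    constructor <;> nlinarith [c1.1, c1.2, c2.1, c2.2, c3.1, c3.2]
  have b2 := abs_sum_fin_le fun j => abs_chi_mul_le (l := l) j (b1 j)
  have b3 := b1 l
  have b4 := L2 l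
  have p3 : d * (h * t + h ^ 3) ≤ d ^ 2 * (h * t + h ^ 3) := by
    have : (d : ℝ) ≤ d ^ 2 := by nlinarith
    gcongr
  have p4 : 0 ≤ d * (h * t + h ^ 3) := by positivity
  rw [e1]
  rw [abs_le] at *
  constructor <;> nlinarith [b2.1, b2.2, b3.1, b3.2, b4.1, b4.2]

/-- The boundary adapted Hessian. -/
def hes (v : EuclideanSpace ℝ (Fin d) → ℝ) (l : Fin d) (q : Fin d × Fin d) :
    EuclideanSpace ℝ (Fin d) → ℝ :=
  if q.1 = l then fun _ => 0 else if q.2 = l then pd (ev q.1) (zet v l)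
    else pd (ev q.2) (pd (ev q.1) v)

lemma smoothOn_hes (hO : IsOpen O) (hv : SmoothOn O v) (q : Fin d × Fin d) :
    SmoothOn O (hes v l q) := by
  unfold hes
  split_ifs
  · exact contDiffOn_const
  · exact (smoothOn_zet hO hv).pd hO _
  · exact (hv.pd hO _).pd hO _

lemma abs_hes_le (hs : ‖fderiv ℝ v y‖ ≤ ε) (hε : ε ≤ eps1 d) (hO : IsOpen O) (hv : SmoothOn O v)
    (hy : y ∈ O) (q : Fin d × Fin d) : |hes v l q y| ≤ 2 * hnorm v y := by
  have hh : 0 ≤ hnorm v y := hnorm_nonneg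
  have hε1 := eps_mul_pow_le l hε (j := 1) (by norm_num)
  have hε0 := eps_mul_pow_le l hε (j := 0) (by norm_num)
  unfold hes
  split_ifs
  · simpa using hh
  · have h1 := abs_pd_zet_sub_le (l := l) hs hO hv hy q.1 (abs_le_hnorm q.1 l)
      (fun j => abs_chi_mul_le j (abs_le_hnorm q.1 j))
    have h2 := abs_le_hnorm (v := v) (y := y) q.1 l
    rw [abs_le] at *
    constructor <;> nlinarith [h1.1, h1.2, h2.1, h2.2]
  · have := abs_le_hnorm (v := v) (y := y) q.2 q.1
    linarith

lemma abs_hes_le_sqrt (q : Fin d × Fin d) : |hes v l q y| ≤ √(sumSq (hes v l) y) :=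
  Real.abs_le_sqrt (Finset.single_le_sum (f := fun k => hes v l k y ^ 2)
    (fun _ _ => sq_nonneg _) (Finset.mem_univ q))

lemma abs_tangential_le (hO : IsOpen O) (hv : SmoothOn O v) (hy : y ∈ O) {k : Fin d} (hk : k ≠ l)
    (j : Fin d) : |chi l j * pd (ev k) (pd (ev j) v) y| ≤ √(sumSq (hes v l) y) := by
  by_cases hj : j = l
  · simp [hj, chi_self]
  · refine abs_chi_mul_le j ?_
    have := abs_hes_le_sqrt (v := v) (l := l) (y := y) (k, j)
    simp only [hes, hk, hj, if_false] at this
    rwa [pd_comm hO hv hy]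

lemma hnorm_le_hes (H : HodLoc l v O ε) (hε : ε ≤ eps1 d) (hy : y ∈ O) (hyl : 0 ≤ y l) :
    hnorm v y ≤ 8 * d ^ 2 * √(sumSq (hes v l) y) := by
  have hO := H.isOpen
  have hv := H.smooth
  have hs := H.small y hy hyl
  have hε0' : 0 ≤ ε := (norm_nonneg _).trans hs
  have hd : (1 : ℝ) ≤ d := by exact_mod_cast (Fin.pos l)
  have hε0 := eps_mul_pow_le l hε (j := 0) (by norm_num)
  have hε2 := eps_mul_pow_le l hε (j := 2) (by norm_num)
  set h := hnorm v y
  set p := √(sumSq (hes v l) y)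
  have hh : 0 ≤ h := hnorm_nonneg
  have hp : 0 ≤ p := sqrt_nonneg _
  have hdε : ε * h ≤ d * (ε * h) := by nlinarith [mul_nonneg hε0' hh]
  have b1 : ∀ k, k ≠ l → ∀ j, |pd (ev k) (pd (ev j) v) y| ≤ p + 2 * d * ε * h := by
    intro k hk j
    by_cases hj : j = l
    · have h1 := abs_pd_zet_sub_le (l := l) hs hO hv hy k (abs_le_hnorm k l)
        (fun j => abs_chi_mul_le j (abs_le_hnorm k j))
      have h2 := abs_hes_le_sqrt (v := v) (l := l) (y := y) (k, l)
      simp only [hes, hk, if_false, if_true] at h2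
      subst hj
      rw [abs_le] at *
      constructor <;> linarith [h1.1, h1.2, h2.1, h2.2]
    · have h1 := abs_tangential_le hO hv hy hk j
      have : chi l j = 1 := by simp [chi, hj]
      rw [this, one_mul] at h1
      have : 0 ≤ 2 * d * ε * h := by positivity
      linarith
  have b2 : |pd (ev l) (pd (ev l) v) y| ≤
      0 + 4 * ∑ i, chi l i * |pd (ev i) (pd (ev i) v) y| + 5 * d * ε * h := by
    refine abs_normal_le (l := l) (X := fun i j => pd (ev i) (pd (ev j) v) y) hs (by linarith)
      (fun i j => abs_le_hnorm i j) ?_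
    rw [← Lop_eq_sum_qf hO hv hy, H.pde_flat hy hyl, abs_zero]
  have b3 : abs (∑ i, chi l i * |pd (ev i) (pd (ev i) v) y|) ≤ d * p := by
    refine abs_sum_fin_le fun i => ?_
    by_cases hi : i = l
    · simpa [hi, chi_self] using hp
    · have := abs_tangential_le hO hv hy hi i
      rwa [abs_mul, abs_abs, ← abs_mul]
  have b3' := (le_abs_self _).trans b3
  set M := 4 * d * p + 5 * d * ε * h with hM
  have hdp : p ≤ d * p := by nlinarith
  have q1 : 0 ≤ d * (ε * h) := by positivity
  have b4 : ∀ i j, |pd (ev i) (pd (ev j) v) y| ≤ M := by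
    intro i j
    by_cases hi : i = l
    · by_cases hj : j = l
      · subst hi; subst hj
        linarith
      · rw [pd_comm hO hv hy]
        have := b1 j hj i
        linarith
    · have := b1 i hi j
      linarith
  have b5 : h ≤ d * M := hnorm_le b4 (by positivity)
  have : d * M = 4 * d ^ 2 * p + 5 * (ε * d ^ 2) * h := by rw [hM]; ring
  nlinarith

lemma tnorm_le_Gam (H : HodLoc l v O ε) (hε : ε ≤ eps1 d) (hy : y ∈ O) (hyl : 0 < y l) :
    tnorm v y ≤ 8 * d ^ 3 * √(∑ q, Gam v l (hes v l q) (hes v l q) y) +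
      80 * d ^ 4 * hnorm v y ^ 2 := by
  have hO := H.isOpen
  have hv := H.smooth
  have hs := H.small y hy hyl.le
  have hε0' : 0 ≤ ε := (norm_nonneg _).trans hs
  have hd : (1 : ℝ) ≤ d := by exact_mod_cast (Fin.pos l)
  have hε0 := eps_mul_pow_le l hε (j := 0) (by norm_num)
  have hε1 := eps_mul_pow_le l hε (j := 1) (by norm_num)
  have hε4 := eps_mul_pow_le l hε (j := 4) (by norm_num)
  set h := hnorm v y
  set t := tnorm v y
  set g := √(∑ q, Gam v l (hes v l q) (hes v l q) y)
  have hh : 0 ≤ h := hnorm_nonneg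
  have ht : 0 ≤ t := tnorm_nonneg
  have hg : 0 ≤ g := sqrt_nonneg _
  have hGq : ∀ q i, |pd (frame v l i y) (hes v l q) y| ≤ g := fun q i =>
    (abs_pd_frame_le_sqrt_Gam i).trans (Real.sqrt_le_sqrt
      (Finset.single_le_sum (f := fun q => Gam v l (hes v l q) (hes v l q) y)
        (fun _ _ => Gam_self_nonneg) (Finset.mem_univ q)))
  have et : 0 ≤ ε * t := mul_nonneg hε0' ht
  have edt : ε * t ≤ d * (ε * t) := by nlinarith
  have h2 : 0 ≤ h ^ 2 := sq_nonneg _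
  have dh2 : h ^ 2 ≤ d * h ^ 2 := by nlinarith
  set Q := g + 6 * d * ε * t + 6 * d * h ^ 2 with hQ
  have b1 : ∀ i k j, k ≠ l → |pd (ev i) (pd (ev k) (pd (ev j) v)) y| ≤ Q := by
    intro i k j hk
    by_cases hj : j = l
    · have h3 := fun i => abs_pd_pd_zet_sub_le (l := l) hs hO hv hy i k
      have h4 : ∀ i, |pd (ev i) (pd (ev k) (zet v l)) y| ≤ 2 * t + 2 * d * h ^ 2 := by
        intro i
        have h5 := h3 i
        have h6 := abs_le_tnorm (v := v) (y := y) i k l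
        have h7 : 2 * d * (ε * t) ≤ t := by nlinarith
        rw [abs_le] at *
        constructor <;> linarith [h5.1, h5.2, h6.1, h6.2]
      have h5 := hGq (k, l) i
      simp only [hes, hk, if_false, if_true] at h5
      have h6 := abs_pd_ev_le_of_frame (l := l) hs h4 h5
      have h7 := h3 i
      have h8 : 2 * ε * (2 * t + 2 * d * h ^ 2) ≤ 4 * (ε * t) + 4 * (d * h ^ 2) := by
        have : ε * (d * h ^ 2) ≤ 1 * (d * h ^ 2) := by gcongr; linarith
        linarith
      subst hj
      rw [abs_le] at *
      constructor <;> linarith [h6.1, h6.2, h7.1, h7.2]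
    · have h5 := hGq (k, j) i
      simp only [hes, hk, hj, if_false] at h5
      have h6 := abs_pd_ev_le_of_frame (l := l) hs (fun i => abs_le_tnorm (v := v) i j k) h5
      rw [pd_pd_pd_comm hO hv hy]
      linarith
  have b2 : |pd (ev l) (pd (ev l) (pd (ev l) v)) y| ≤ 16 * d * h ^ 2 +
      4 * ∑ i, chi l i * |pd (ev i) (pd (ev i) (pd (ev l) v)) y| + 5 * d * ε * t := by
    refine abs_normal_le (l := l) (X := fun i j => pd (ev i) (pd (ev j) (pd (ev l) v)) y) hs
      (by linarith) (fun i j => abs_le_tnorm i j l) ?_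
    rw [← Lop_eq_sum_qf hO (hv.pd hO _) hy]
    exact H.abs_Lop_pd_le (by linarith) hy hyl (fun i j => abs_le_hnorm i j) l
  have hQ0 : 0 ≤ Q := by positivity
  have b3 : abs (∑ i, chi l i * |pd (ev i) (pd (ev i) (pd (ev l) v)) y|) ≤ d * Q := by
    refine abs_sum_fin_le fun i => ?_
    by_cases hi : i = l
    · simpa [hi, chi_self] using hQ0
    · exact abs_chi_mul_le i (by rw [abs_abs]; exact b1 i i l hi)
  have b3' := (le_abs_self _).trans b3
  set M := 4 * d * Q + 16 * d * h ^ 2 + 5 * d * ε * t with hM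
  have hM0 : 0 ≤ M := by positivity
  have hQM : Q ≤ M := by
    have : Q ≤ d * Q := by nlinarith
    have : 0 ≤ 16 * d * h ^ 2 + 5 * d * ε * t := by positivity
    linarith
  have b4 : ∀ i k j, |pd (ev i) (pd (ev k) (pd (ev j) v)) y| ≤ M := by
    intro i k j
    by_cases hk : k = l
    · by_cases hj : j = l
      · by_cases hi : i = l
        · subst hi; subst hj; subst hk
          linarith
        · rw [pd_comm hO (hv.pd hO _) hy]
          exact (b1 k i j hi).trans hQM
      · rw [pd_pd_pd_comm hO hv hy]
        exact (b1 i j k hj).trans hQM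
    · exact (b1 i k j hk).trans hQM
  have b5 : t ≤ d ^ 2 * M := tnorm_le (Fin.pos l) b4 hM0
  have e5 : d ^ 2 * M = 4 * d ^ 3 * g + 24 * (ε * d ^ 4) * t + 24 * d ^ 4 * h ^ 2 +
      16 * d ^ 3 * h ^ 2 + 5 * (ε * d ^ 3) * t := by rw [hM, hQ]; ring
  have hε3 := eps_mul_pow_le l hε (j := 3) (by norm_num)
  have hd34 : (d : ℝ) ^ 3 * h ^ 2 ≤ d ^ 4 * h ^ 2 := by
    gcongr
    norm_num
  nlinarith

lemma abs_sum_prod_le {F : Fin d × Fin d → ℝ} {c : ℝ} (h : ∀ q, |F q| ≤ c) :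
    |∑ q, F q| ≤ d ^ 2 * c := by
  rw [Fintype.sum_prod_type]
  have := abs_sum_fin_le (fun i => abs_sum_fin_le fun j => h (i, j))
  refine this.trans (le_of_eq (by ring))

lemma hes_interior (H : HodLoc l v O ε) (hε : ε ≤ eps1 d) (hy : y ∈ O) (hyl : 0 < y l) {r : ℝ}
    (hr : 0 < r) (hκ : r * hnorm v y ≤ 1) :
    -(1 / 2 * ∑ q, Gam v l (hes v l q) (hes v l q) y) -
      (2 * 10 ^ 9 * d ^ 18) * sumSq (hes v l) y / r ^ 2 ≤
      ∑ q, hes v l q y * Lop v l (hes v l q) y := by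
  have hO := H.isOpen
  have hv := H.smooth
  have hs := H.small y hy hyl.le
  have hd : (1 : ℝ) ≤ d := by exact_mod_cast (Fin.pos l)
  have hε0 := eps_mul_pow_le l hε (j := 0) (by norm_num)
  have T := tnorm_le_Gam H hε hy hyl
  have Hh := hnorm_le_hes H hε hy hyl.le
  set G := ∑ q, Gam v l (hes v l q) (hes v l q) y with hG
  have hG0 : 0 ≤ G := Finset.sum_nonneg fun _ _ => Gam_self_nonneg
  have hP0 : 0 ≤ sumSq (hes v l) y := sumSq_nonneg
  set P := sumSq (hes v l) y
  have hgs : √G ^ 2 = G := Real.sq_sqrt hG0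
  have hg : 0 ≤ √G := sqrt_nonneg _
  set g := √G
  have hps : √P ^ 2 = P := Real.sq_sqrt hP0
  have hp : 0 ≤ √P := sqrt_nonneg _
  set p := √P
  have hL : ∀ q, |Lop v l (hes v l q) y| ≤
      246 * d ^ 2 * (hnorm v y * tnorm v y + hnorm v y ^ 3) := by
    intro q
    have hnn : 0 ≤ hnorm v y * tnorm v y + hnorm v y ^ 3 := by
      have := hnorm_nonneg (v := v) (y := y)
      have := tnorm_nonneg (v := v) (y := y)
      positivity
    unfold hes
    split_ifs
    · rw [Lop_const, abs_zero]; positivity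
    · exact abs_Lop_pd_zet_le H (by linarith) hy hyl _
    · refine (H.abs_Lop_pd_pd_le (by linarith) hy hyl (fun i j => abs_le_hnorm (v := v) i j)
        (fun i j k => abs_le_tnorm (v := v) i j k) q.1 q.2).trans ?_
      have : (d : ℝ) ≤ d ^ 2 := by nlinarith
      have h3 := mul_le_mul_of_nonneg_right this hnn
      have : 0 ≤ (d : ℝ) ^ 2 * (hnorm v y * tnorm v y + hnorm v y ^ 3) := by positivity
      linarith
  have hF := fun q => abs_hes_le (l := l) hs hε hO hv hy q
  set h := hnorm v y
  set t := tnorm v y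
  have hh : 0 ≤ h := hnorm_nonneg
  have ht : 0 ≤ t := tnorm_nonneg
  have b1 : |∑ q, hes v l q y * Lop v l (hes v l q) y| ≤
      d ^ 2 * ((2 * h) * (246 * d ^ 2 * (h * t + h ^ 3))) := by
    refine abs_sum_prod_le fun q => ?_
    rw [abs_mul]
    exact mul_le_mul (hF q) (hL q) (abs_nonneg _) (by positivity)
  have hd14 : (d : ℝ) ^ 8 ≤ d ^ 14 := pow_le_pow_right₀ hd (by norm_num)
  have hd4 : (d : ℝ) ^ 4 ≤ d ^ 8 := pow_le_pow_right₀ hd (by norm_num)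
  have b2 : d ^ 2 * ((2 * h) * (246 * d ^ 2 * (h * t + h ^ 3))) ≤
      1 / 2 * G + 2 * 10 ^ 7 * d ^ 14 * h ^ 4 := by
    have c1 : d ^ 4 * h ^ 2 * t ≤ d ^ 4 * h ^ 2 * (8 * d ^ 3 * g + 80 * d ^ 4 * h ^ 2) := by
      gcongr
    have c2 : 3936 * (d ^ 7 * h ^ 2) * g ≤ 1 / 2 * G + 1 / 2 * (3936 * (d ^ 7 * h ^ 2)) ^ 2 := by
      rw [← hgs]
      nlinarith [sq_nonneg (3936 * (d ^ 7 * h ^ 2) - g)]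
    have c3 : d ^ 8 * h ^ 4 ≤ d ^ 14 * h ^ 4 := by gcongr
    have c4 : d ^ 4 * h ^ 4 ≤ d ^ 14 * h ^ 4 := by gcongr; norm_num
    have c5 : 0 ≤ d ^ 14 * h ^ 4 := by positivity
    calc d ^ 2 * ((2 * h) * (246 * d ^ 2 * (h * t + h ^ 3)))
        = 492 * (d ^ 4 * h ^ 2 * t) + 492 * (d ^ 4 * h ^ 4) := by ring
      _ ≤ 492 * (d ^ 4 * h ^ 2 * (8 * d ^ 3 * g + 80 * d ^ 4 * h ^ 2)) +
          492 * (d ^ 14 * h ^ 4) := by gcongr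
      _ = 3936 * (d ^ 7 * h ^ 2) * g + 39360 * (d ^ 8 * h ^ 4) + 492 * (d ^ 14 * h ^ 4) := by ring
      _ ≤ (1 / 2 * G + 1 / 2 * (3936 * (d ^ 7 * h ^ 2)) ^ 2) + 39360 * (d ^ 14 * h ^ 4) +
          492 * (d ^ 14 * h ^ 4) := by gcongr
      _ ≤ _ := by nlinarith
  have b3 : 2 * 10 ^ 7 * d ^ 14 * h ^ 4 ≤ (2 * 10 ^ 9 * d ^ 18) * P / r ^ 2 := by
    rw [le_div_iff₀ (by positivity)]
    have c1 : (r * h) ^ 2 ≤ 1 := by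
      have : 0 ≤ r * h := by positivity
      nlinarith
    have c2 : h ^ 2 ≤ 64 * d ^ 4 * P := by
      calc h ^ 2 ≤ (8 * d ^ 2 * p) ^ 2 := by gcongr
        _ = 64 * d ^ 4 * P := by rw [← hps]; ring
    calc 2 * 10 ^ 7 * d ^ 14 * h ^ 4 * r ^ 2 = 2 * 10 ^ 7 * d ^ 14 * (h ^ 2 * (r * h) ^ 2) := by
          ring
      _ ≤ 2 * 10 ^ 7 * d ^ 14 * ((64 * d ^ 4 * P) * 1) := by gcongr
      _ ≤ 2 * 10 ^ 9 * d ^ 18 * P := by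
          have : 0 ≤ (d : ℝ) ^ 18 * P := by positivity
          nlinarith
  linarith [(abs_le.1 b1).1]

lemma pd_bv_hes (H : HodLoc l v O ε) (hy : y ∈ O) (hyl : y l = 0) {k m : Fin d} (hk : k ≠ l)
    (hm : m ≠ l) : pd (bv v l y) (pd (ev m) (pd (ev k) v)) y =
      ∑ j, chi l j * (pd (ev k) (pd (ev j) v) y * pd (ev m) (pd (ev j) v) y) -
        pd (ev k) (pd (ev l) v) y * pd (ev m) (pd (ev l) v) y := by
  have hO := H.isOpen
  have hv := H.smooth
  have h0 : pd (ev m) (pd (ev k) (zet v l)) y = 0 :=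
    pd_tangential_eq_zero hO (((smoothOn_zet hO hv).pd hO _).differentiableAt hO hy) hy hyl
      (fun z hz hzl => H.pd_zet_flat hz hzl hk) hm
  have hc : ∀ j, pd (ev j) (pd (ev m) (pd (ev k) v)) y = pd (ev m) (pd (ev k) (pd (ev j) v)) y := by
    intro j
    rw [pd_comm hO (hv.pd hO _) hy, pd_pd_pd_comm hO hv hy]
  rw [pd_pd_zet hO hv hy] at h0
  rw [pd_bv, hc l]
  have e1 : ∑ j, chi l j * pd (ev j) v y * pd (ev j) (pd (ev m) (pd (ev k) v)) y =
      ∑ j, chi l j * (pd (ev j) v y * pd (ev m) (pd (ev k) (pd (ev j) v)) y) :=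
    Finset.sum_congr rfl fun j _ => by rw [hc, mul_assoc]
  rw [e1]
  simp only [mul_add, Finset.sum_add_distrib] at h0
  linarith

lemma hes_flat (H : HodLoc l v O ε) (hε : ε ≤ eps1 d) (hy : y ∈ O) (hyl : y l = 0) {r : ℝ}
    (hr : 0 < r) (hκ : 32 * d ^ 3 * (r * hnorm v y) ≤ 1) :
    -(sumSq (hes v l) y / (16 * r)) ≤ ∑ q, hes v l q y * pd (bv v l y) (hes v l q) y := by
  have hO := H.isOpen
  have hv := H.smooth
  have hs := H.small y hy hyl.ge
  have hε0' : 0 ≤ ε := (norm_nonneg _).trans hs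
  have hd : (1 : ℝ) ≤ d := by exact_mod_cast (Fin.pos l)
  have hε1 := eps_mul_pow_le l hε (j := 1) (by norm_num)
  have hε0 := eps_mul_pow_le l hε (j := 0) (by norm_num)
  have hP0 : 0 ≤ sumSq (hes v l) y := sumSq_nonneg
  have hT := fun {k} (hk : k ≠ l) j => abs_tangential_le hO hv hy hk j
  have hSq := fun q => abs_hes_le_sqrt (v := v) (l := l) (y := y) q
  set P := sumSq (hes v l) y
  have hps : √P ^ 2 = P := Real.sq_sqrt hP0
  have hp : 0 ≤ √P := sqrt_nonneg _
  set p := √P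
  set h := hnorm v y
  have hh : 0 ≤ h := hnorm_nonneg
  have hN : ∀ k, k ≠ l → |pd (ev k) (pd (ev l) v) y| ≤ p := by
    intro k hk
    have h1 := abs_pd_zet_sub_le (l := l) hs hO hv hy k le_rfl (hT hk)
    rw [H.pd_zet_flat hy hyl hk, zero_sub, abs_neg] at h1
    have := abs_nonneg (pd (ev k) (pd (ev l) v) y)
    nlinarith
  have b1 : ∀ q, |hes v l q y * pd (bv v l y) (hes v l q) y| ≤ p * (2 * d * (p * h)) := by
    intro q
    by_cases hk : q.1 = l
    · have : hes v l q y = 0 := by simp [hes, hk]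
      rw [this, zero_mul, abs_zero]; positivity
    by_cases hm : q.2 = l
    · have : hes v l q y = 0 := by
        simp only [hes, hk, hm, if_false, if_true]
        exact H.pd_zet_flat hy hyl hk
      rw [this, zero_mul, abs_zero]; positivity
    rw [abs_mul]
    refine mul_le_mul (hSq q) ?_ (abs_nonneg _) hp
    have e : hes v l q = pd (ev q.2) (pd (ev q.1) v) := by simp [hes, hk, hm]
    rw [e, pd_bv_hes H hy hyl hk hm]
    have c1 : |∑ j, chi l j * (pd (ev q.1) (pd (ev j) v) y * pd (ev q.2) (pd (ev j) v) y)| ≤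
        d * (p * h) := by
      refine abs_sum_fin_le fun j => ?_
      rw [← mul_assoc, abs_mul]
      exact mul_le_mul (hT hk j) (abs_le_hnorm _ _) (abs_nonneg _) hp
    have c2 : |pd (ev q.1) (pd (ev l) v) y * pd (ev q.2) (pd (ev l) v) y| ≤ p * h := by
      rw [abs_mul]
      exact mul_le_mul (hN _ hk) (abs_le_hnorm _ _) (abs_nonneg _) hp
    have c3 : p * h ≤ d * (p * h) := by nlinarith [mul_nonneg hp hh]
    rw [abs_le] at *
    constructor <;> linarith [c1.1, c1.2, c2.1, c2.2]
  have b2 := abs_sum_prod_le b1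
  have b3 : d ^ 2 * (p * (2 * d * (p * h))) ≤ P / (16 * r) := by
    rw [le_div_iff₀ (by positivity), ← hps]
    have : p ^ 2 * (32 * d ^ 3 * (r * h)) ≤ p ^ 2 * 1 := by gcongr
    nlinarith
  linarith [(abs_le.1 b2).1]

/-- The Hessian estimate under an a priori bound on the scale of the Hessian. -/
lemma hess_estimate_of_bound (d : ℕ) (hd : 1 ≤ d) : ∃ C : ℝ, 0 < C ∧
    ∀ (l : Fin d) (v : EuclideanSpace ℝ (Fin d) → ℝ) (O : Set (EuclideanSpace ℝ (Fin d)))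
      (ε : ℝ) (x : EuclideanSpace ℝ (Fin d)) (r N : ℝ),
      HodLoc l v O ε → ε ≤ eps1 d → 0 < r → 0 ≤ x l →
      (∀ y, ‖y - x‖ ≤ 2 * r → 0 ≤ y l → y ∈ O ∧ ‖fderiv ℝ v y‖ ≤ N ∧
        32 * d ^ 3 * (r * hnorm v y) ≤ 1) →
      r * hnorm v x ≤ C * N := by
  have hd1 : (1 : ℝ) ≤ d := by exact_mod_cast hd
  obtain ⟨K, hK, hB⟩ := bernstein_estimate d (2 * 10 ^ 9 * d ^ 18) (1 / (256 * d ^ 6))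
    (by positivity)
  refine ⟨8 * d ^ 2 * √(K * (4 * d)), by positivity, ?_⟩
  intro l v O ε x r N H hε hr hxl hball
  have hO := H.isOpen
  have hv := H.smooth
  have hε1 := eps_mul_pow_le l hε (j := 0) (by norm_num)
  set x₀ : EuclideanSpace ℝ (Fin d) := x + (r / 8) • ev l with hx₀
  have hx0 : ‖x - x₀‖ = r / 8 := by
    simp [hx₀, norm_smul, abs_of_pos hr]
  have hx0l : r / 8 ≤ x₀ l := by simpa [hx₀] using hxl
  have hsub : ∀ y, ‖y - x₀‖ ≤ r → 0 ≤ y l → y ∈ O ∧ ‖fderiv ℝ v y‖ ≤ N ∧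
      32 * d ^ 3 * (r * hnorm v y) ≤ 1 := by
    intro y hy hyl
    refine hball y ?_ hyl
    have : ‖y - x‖ ≤ ‖y - x₀‖ + ‖x - x₀‖ := by
      rw [← norm_neg (x - x₀)]
      have : y - x = (y - x₀) + -(x - x₀) := by abel
      rw [this]; exact norm_add_le _ _
    linarith
  obtain ⟨hxO, hxN, -⟩ := hsub x (by rw [hx0]; linarith) hxl
  have hN0 : 0 ≤ N := (norm_nonneg _).trans hxN
  have key := hB (Fin d × Fin d) l v O ε x₀ r (4 * d * N ^ 2) (hes v l) (sumSq (grd v l)) H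
    (by linarith) hr hx0l (fun y h1 h2 => (hsub y h1 h2).1) (smoothOn_hes hO hv)
    (smoothOn_sumSq (smoothOn_grd hO hv)) (fun y h1 h2 => ?_) (fun y h1 h2 => ?_)
    (fun y h1 h2 => ?_) x (by rw [hx0]; linarith) hxl
  · have h1 := hnorm_le_hes H hε hxO hxl
    have h2 : r * √(sumSq (hes v l) x) ≤ √(K * (4 * d)) * N := by
      refine abs_le_of_sq_le_sq' ?_ (by positivity) |>.2
      rw [mul_pow, mul_pow, Real.sq_sqrt sumSq_nonneg, Real.sq_sqrt (by positivity)]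
      linarith
    calc r * hnorm v x ≤ r * (8 * d ^ 2 * √(sumSq (hes v l) x)) := by gcongr
      _ = 8 * d ^ 2 * (r * √(sumSq (hes v l) x)) := by ring
      _ ≤ 8 * d ^ 2 * (√(K * (4 * d)) * N) := by gcongr
      _ = _ := by ring
  · obtain ⟨hyO, hyN, -⟩ := hsub y h1 h2
    refine ⟨sumSq_nonneg, (sumSq_grd_le_norm (H.small y hyO h2) hε l).trans ?_⟩
    gcongr
  · obtain ⟨hyO, hyN, hyh⟩ := hsub y h1 h2.le
    have hs := H.small y hyO h2.le
    have hrh : 0 ≤ r * hnorm v y := mul_nonneg hr.le hnorm_nonneg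
    have hd3 : 1 ≤ (d : ℝ) ^ 3 := one_le_pow₀ hd1
    refine ⟨hes_interior H hε hyO h2 hr (by nlinarith), ?_⟩
    rw [Lop_sumSq hO (smoothOn_grd hO hv) hyO]
    have b1 := grd_interior H hε hyO h2
    have b2 := hnorm_sq_le_Gam H hε hyO h2
    set G := ∑ k, Gam v l (grd v l k) (grd v l k) y
    have b3 : sumSq (hes v l) y ≤ d ^ 2 * (4 * hnorm v y ^ 2) := by
      refine (le_abs_self _).trans (abs_sum_prod_le fun q => ?_)
      rw [abs_pow]
      have := abs_hes_le (l := l) hs hε hO hv hyO q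
      nlinarith [abs_nonneg (hes v l q y)]
    have b4 : sumSq (hes v l) y ≤ 256 * d ^ 6 * G := by
      calc _ ≤ (d : ℝ) ^ 2 * (4 * (64 * d ^ 4 * G)) := b3.trans (by gcongr)
        _ = _ := by ring
    calc 1 / (256 * (d : ℝ) ^ 6) * sumSq (hes v l) y
        ≤ 1 / (256 * (d : ℝ) ^ 6) * (256 * d ^ 6 * G) := by gcongr
      _ = G := by field_simp
      _ ≤ _ := by linarith
  · obtain ⟨hyO, hyN, hyh⟩ := hsub y h1 h2.ge
    refine ⟨hes_flat H hε hyO h2 hr hyh, ?_⟩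
    rw [pd_sumSq hO (smoothOn_grd hO hv) hyO, Finset.sum_eq_zero fun k _ => grd_flat H hyO h2 k]
    simp

lemma continuousOn_hnorm (hO : IsOpen O) (hv : SmoothOn O v) : ContinuousOn (hnorm v) O := by
  unfold hnorm
  refine ContinuousOn.sqrt ?_
  refine continuousOn_finsetSum _ fun i _ => continuousOn_finsetSum _ fun j _ => ?_
  exact ((hv.pd hO _).pd hO _).continuousOn.pow 2

/-- The interior and boundary Hessian estimate. -/
lemma hess_estimate (d : ℕ) (hd : 1 ≤ d) : ∃ ε₀ C : ℝ, 0 < ε₀ ∧ 0 < C ∧ ε₀ ≤ eps1 d ∧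
    ∀ (l : Fin d) (v : EuclideanSpace ℝ (Fin d) → ℝ) (O : Set (EuclideanSpace ℝ (Fin d)))
      (ε : ℝ) (x : EuclideanSpace ℝ (Fin d)) (r N : ℝ),
      HodLoc l v O ε → ε ≤ ε₀ → 0 < r → 0 ≤ x l →
      (∀ y, ‖y - x‖ ≤ 4 * r → 0 ≤ y l → y ∈ O ∧ ‖fderiv ℝ v y‖ ≤ N) →
      r * hnorm v x ≤ C * N := by
  have hd1 : (1 : ℝ) ≤ d := by exact_mod_cast hd
  obtain ⟨C, hC, hloc⟩ := hess_estimate_of_bound d hd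
  set κ : ℝ := 1 / (32 * d ^ 3) with hκ
  have hκ0 : 0 < κ := by positivity
  have hκ1 : 32 * (d : ℝ) ^ 3 * κ = 1 := by rw [hκ]; field_simp
  have hscale : ∀ a : ℝ, a ≤ κ → 32 * (d : ℝ) ^ 3 * a ≤ 1 := by
    intro a ha
    calc 32 * (d : ℝ) ^ 3 * a ≤ 32 * (d : ℝ) ^ 3 * κ := by gcongr
      _ = 1 := hκ1
  have he0 : 0 < eps1 d := by unfold eps1; positivity
  refine ⟨min (eps1 d) (κ / (4 * C)), C, by positivity, hC, min_le_left _ _, ?_⟩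
  intro l v O ε x r N H hε hr hxl hball
  have hO := H.isOpen
  have hv := H.smooth
  have hε1 : ε ≤ eps1 d := hε.trans (min_le_left _ _)
  have hε2 : ε ≤ κ / (4 * C) := hε.trans (min_le_right _ _)
  set D : Set (EuclideanSpace ℝ (Fin d)) := Metric.closedBall x (4 * r) ∩ {z | 0 ≤ z l} with hD
  have hDm : ∀ z, z ∈ D ↔ ‖z - x‖ ≤ 4 * r ∧ 0 ≤ z l := fun z => by simp [hD, dist_eq_norm]
  have hDO : ∀ z ∈ D, z ∈ O := fun z hz =>
    (hball z ((hDm z).1 hz).1 ((hDm z).1 hz).2).1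
  have hDc : IsCompact D := (isCompact_closedBall x (4 * r)).inter_right
    (isClosed_le continuous_const (by fun_prop))
  have hxD : x ∈ D := (hDm x).2 ⟨by simp; positivity, hxl⟩
  have hcont : ContinuousOn (fun z => (4 * r - ‖z - x‖) * hnorm v z) D :=
    (Continuous.continuousOn (by fun_prop)).mul ((continuousOn_hnorm hO hv).mono hDO)
  obtain ⟨z, hz, hmax⟩ := hDc.exists_isMaxOn ⟨x, hxD⟩ hcont
  have hmax' : ∀ w ∈ D, (4 * r - ‖w - x‖) * hnorm v w ≤ (4 * r - ‖z - x‖) * hnorm v z :=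
    fun w hw => hmax hw
  obtain ⟨hz1, hzl⟩ := (hDm z).1 hz
  have hbound : (4 * r - ‖z - x‖) * hnorm v z ≤ 2 * κ := by
    by_contra! hlt
    set ρ := 4 * r - ‖z - x‖ with hρ
    have hh0 : 0 ≤ hnorm v z := hnorm_nonneg
    have hh : 0 < hnorm v z := by
      rcases hh0.lt_or_eq with h | h
      · exact h
      · rw [← h] at hlt; nlinarith
    have hρ0 : 0 < ρ := by
      by_contra! h
      nlinarith
    set s := κ / (2 * hnorm v z) with hs
    have hs0 : 0 < s := by positivity
    have hsh : s * hnorm v z = κ / 2 := by rw [hs]; field_simp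
    have hs2 : 2 * s ≤ ρ / 2 := by
      have : 2 * s * hnorm v z ≤ ρ / 2 * hnorm v z := by nlinarith
      exact le_of_mul_le_mul_right this hh
    have := hloc l v O ε z s ε H hε1 hs0 hzl (fun y hy hyl => by
      have hyx : ‖y - x‖ ≤ ‖y - z‖ + ‖z - x‖ := by
        have : y - x = (y - z) + (z - x) := by abel
        rw [this]; exact norm_add_le _ _
      have hyD : y ∈ D := (hDm y).2 ⟨by linarith, hyl⟩
      refine ⟨hDO y hyD, H.small y (hDO y hyD) hyl, hscale _ ?_⟩
      have h1 := hmax' y hyD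
      have h2 : ρ / 2 ≤ 4 * r - ‖y - x‖ := by linarith
      have h3 : 0 ≤ hnorm v y := hnorm_nonneg
      have h4 : ρ / 2 * hnorm v y ≤ ρ * hnorm v z :=
        (mul_le_mul_of_nonneg_right h2 h3).trans h1
      have h5 : hnorm v y ≤ 2 * hnorm v z := by
        refine le_of_mul_le_mul_left ?_ hρ0
        linarith
      calc s * hnorm v y ≤ s * (2 * hnorm v z) := by gcongr
        _ = κ := by linarith)
    rw [hsh] at this
    have h6 : C * ε ≤ κ / 4 := by
      calc C * ε ≤ C * (κ / (4 * C)) := by gcongr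
        _ = κ / 4 := by field_simp
    linarith
  refine hloc l v O ε x r N H hε1 hr hxl fun y hy hyl => ?_
  have hyD : y ∈ D := (hDm y).2 ⟨by linarith, hyl⟩
  refine ⟨hDO y hyD, (hball y (by linarith) hyl).2, hscale _ ?_⟩
  have h1 := (hmax' y hyD).trans hbound
  have h2 : 2 * r * hnorm v y ≤ (4 * r - ‖y - x‖) * hnorm v y :=
    mul_le_mul_of_nonneg_right (by linarith) hnorm_nonneg
  linarith

end Hessian

section Barrier

variable {d : ℕ} {l : Fin d} {v : EuclideanSpace ℝ (Fin d) → ℝ}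
  {y z ξ : EuclideanSpace ℝ (Fin d)} {ε c p : ℝ}

lemma smoothOn_dist (z : EuclideanSpace ℝ (Fin d)) : SmoothOn {z}ᶜ fun y => ‖y - z‖ :=
  ContDiffOn.norm ℝ (contDiffOn_id.sub contDiffOn_const) fun _ hy => sub_ne_zero.2 hy

lemma dist_mul_pd_dist (hy : y ≠ z) (ξ : EuclideanSpace ℝ (Fin d)) :
    ‖y - z‖ * pd ξ (fun x => ‖x - z‖) y = inner ℝ (y - z) ξ := by
  have h1 := pd_sq ((smoothOn_dist z).differentiableAt isOpen_compl_singleton hy) ξ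
  have h2 : HasFDerivAt (fun x : EuclideanSpace ℝ (Fin d) => ‖x - z‖ ^ 2)
      ((2 : ℕ) • (innerSL ℝ (y - z)).comp (ContinuousLinearMap.id ℝ _)) y :=
    ((hasFDerivAt_id y).sub_const z).norm_sq
  have h3 : pd ξ (fun x => ‖x - z‖ ^ 2) y = 2 * inner ℝ (y - z) ξ := by
    rw [pd, h2.fderiv]; simp [two_mul, inner_sub_left]
  linarith

lemma pd_dist (hy : y ≠ z) (ξ : EuclideanSpace ℝ (Fin d)) :
    pd ξ (fun x => ‖x - z‖) y = inner ℝ (y - z) ξ / ‖y - z‖ := by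
  have : ‖y - z‖ ≠ 0 := norm_ne_zero_iff.2 (sub_ne_zero.2 hy)
  rw [eq_div_iff this, mul_comm, dist_mul_pd_dist hy]

lemma dist_mul_pd_pd_dist (hy : y ≠ z) (ξ : EuclideanSpace ℝ (Fin d)) :
    ‖y - z‖ * pd ξ (pd ξ fun x => ‖x - z‖) y = ‖ξ‖ ^ 2 - pd ξ (fun x => ‖x - z‖) y ^ 2 := by
  have hO : IsOpen ({z}ᶜ : Set (EuclideanSpace ℝ (Fin d))) := isOpen_compl_singleton
  have hs := smoothOn_dist z
  have h1 := pd_mul (hs.differentiableAt hO hy) ((hs.pd hO ξ).differentiableAt hO hy) ξ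
  rw [pd_congr hO (g := fun x => inner ℝ (x - z) ξ)
    (fun x hx => dist_mul_pd_dist hx ξ) hy] at h1
  have h2 : pd ξ (fun x => inner ℝ (x - z) ξ) y = ‖ξ‖ ^ 2 := by
    have : HasFDerivAt (fun x : EuclideanSpace ℝ (Fin d) => inner ℝ ξ (x - z))
        ((innerSL ℝ ξ).comp (ContinuousLinearMap.id ℝ _)) y :=
      (innerSL ℝ ξ).hasFDerivAt.comp y ((hasFDerivAt_id y).sub_const z)
    simp only [real_inner_comm ξ]
    rw [pd, this.fderiv]
    simp
  rw [h2] at h1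
  linarith

lemma pd_rpow {f : EuclideanSpace ℝ (Fin d) → ℝ} (hf : DifferentiableAt ℝ f y) (h : f y ≠ 0)
    (p : ℝ) (ξ : EuclideanSpace ℝ (Fin d)) :
    pd ξ (fun x => f x ^ p) y = p * f y ^ (p - 1) * pd ξ f y := by
  rw [pd, (hf.hasFDerivAt.rpow_const (Or.inl h)).fderiv]
  simp [pd]

lemma pd_pd_rpow {O : Set (EuclideanSpace ℝ (Fin d))} {f : EuclideanSpace ℝ (Fin d) → ℝ}
    (hO : IsOpen O) (hf : SmoothOn O f) (hpos : ∀ x ∈ O, 0 < f x) (hy : y ∈ O) (p : ℝ)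
    (ξ : EuclideanSpace ℝ (Fin d)) :
    pd ξ (pd ξ fun x => f x ^ p) y =
      p * f y ^ (p - 2) * ((p - 1) * pd ξ f y ^ 2 + f y * pd ξ (pd ξ f) y) := by
  have hne : ∀ x ∈ O, f x ≠ 0 := fun x hx => (hpos x hx).ne'
  rw [pd_congr hO (g := fun x => p * (f x ^ (p - 1) * pd ξ f x))
    (fun x hx => by
      rw [pd_rpow (hf.differentiableAt hO hx) (hne x hx), mul_assoc]) hy]
  have hd := hf.differentiableAt hO hy
  have h1 : DifferentiableAt ℝ (fun x => f x ^ (p - 1)) y :=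
    hd.rpow_const (Or.inl (hne y hy))
  have h2 := (hf.pd hO ξ).differentiableAt hO hy
  rw [pd_const_mul (f := fun x => f x ^ (p - 1) * pd ξ f x) (h1.mul h2), pd_mul h1 h2, pd_rpow hd (hne y hy)]
  have e1 : f y ^ (p - 1) = f y ^ (p - 2) * f y := by
    rw [← rpow_add_one (hne y hy)]; ring_nf
  have e2 : f y ^ (p - 1 - 1) = f y ^ (p - 2) := by ring_nf
  rw [e1, e2]
  ring

/-- A tilted norm centred at `z`. -/
def tilt (l : Fin d) (c : ℝ) (z y : EuclideanSpace ℝ (Fin d)) : ℝ := ‖y - z‖ + c * (y l - z l)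

lemma abs_apply_sub_le (l : Fin d) (y z : EuclideanSpace ℝ (Fin d)) : |y l - z l| ≤ ‖y - z‖ := by
  simpa using PiLp.norm_apply_le (y - z) l

lemma tilt_ge : (1 - |c|) * ‖y - z‖ ≤ tilt l c z y := by
  have h1 : |c * (y l - z l)| ≤ |c| * ‖y - z‖ := by
    rw [abs_mul]; exact mul_le_mul_of_nonneg_left (abs_apply_sub_le l y z) (abs_nonneg _)
  have := neg_abs_le (c * (y l - z l))
  unfold tilt; linarith

lemma tilt_le : tilt l c z y ≤ (1 + |c|) * ‖y - z‖ := by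
  have h1 : |c * (y l - z l)| ≤ |c| * ‖y - z‖ := by
    rw [abs_mul]; exact mul_le_mul_of_nonneg_left (abs_apply_sub_le l y z) (abs_nonneg _)
  have := le_abs_self (c * (y l - z l))
  unfold tilt; linarith

lemma tilt_pos (hc : |c| < 1) (hy : y ≠ z) : 0 < tilt l c z y :=
  (mul_pos (by linarith) (norm_pos_iff.2 (sub_ne_zero.2 hy))).trans_le tilt_ge

lemma smoothOn_tilt : SmoothOn {z}ᶜ (tilt l c z) := by
  have h1 : ContDiff ℝ (⊤ : ℕ∞) fun y : EuclideanSpace ℝ (Fin d) => c * (y l - z l) := by fun_prop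
  exact (smoothOn_dist z).add h1.contDiffOn

lemma pd_tilt (hy : y ≠ z) (ξ : EuclideanSpace ℝ (Fin d)) :
    pd ξ (tilt l c z) y = pd ξ (fun x => ‖x - z‖) y + c * ξ l := by
  have h1 : HasFDerivAt (fun y : EuclideanSpace ℝ (Fin d) => y l)
      (EuclideanSpace.proj (𝕜 := ℝ) l) y :=
    (EuclideanSpace.proj (𝕜 := ℝ) l : EuclideanSpace ℝ (Fin d) →L[ℝ] ℝ).hasFDerivAt
  have h2 := (h1.sub_const (z l)).const_mul c
  have := pd_add ((smoothOn_dist z).differentiableAt isOpen_compl_singleton hy)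
    h2.differentiableAt ξ
  change pd ξ (fun x => ‖x - z‖ + c * (x l - z l)) y = _
  rw [this]
  congr 1
  rw [pd, h2.fderiv]; simp

lemma pd_pd_tilt (hy : y ≠ z) (ξ : EuclideanSpace ℝ (Fin d)) :
    pd ξ (pd ξ (tilt l c z)) y = pd ξ (pd ξ fun x => ‖x - z‖) y := by
  have hO : IsOpen ({z}ᶜ : Set (EuclideanSpace ℝ (Fin d))) := isOpen_compl_singleton
  rw [pd_congr hO (g := fun x => pd ξ (fun x => ‖x - z‖) x + c * ξ l) (fun x hx => pd_tilt hx ξ) hy,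
    pd_add (((smoothOn_dist z).pd hO ξ).differentiableAt hO hy) (by fun_prop), pd_const, add_zero]

/-- Powers of the tilted norm. -/
def bar (l : Fin d) (c p : ℝ) (z y : EuclideanSpace ℝ (Fin d)) : ℝ := tilt l c z y ^ p

lemma smoothOn_bar (hc : |c| < 1) : SmoothOn {z}ᶜ (bar l c p z) :=
  smoothOn_tilt.rpow_const_of_ne fun _ hy => (tilt_pos hc hy).ne'

lemma norm_frame_sq (i : Fin d) :
    ‖frame v l i y‖ ^ 2 = cfA v l i y ^ 2 + cfB v l i y ^ 2 := by
  by_cases h : i = l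
  · subst h
    simp [frame, cfA, cfB, chi_self]
  · rw [EuclideanSpace.norm_sq_eq, ← Finset.sum_erase_add _ _ (Finset.mem_univ i),
      ← Finset.sum_erase_add (a := l) _ _ (Finset.mem_erase.2 ⟨Ne.symm h, Finset.mem_univ _⟩),
      Finset.sum_eq_zero]
    · simp [frame, h, Ne.symm h]; ring
    · intro j hj
      simp only [Finset.mem_erase] at hj
      simp [frame, hj.1, hj.2.1]

lemma pd_dist_frame (hy : y ≠ z) (i : Fin d) : pd (frame v l i y) (fun x => ‖x - z‖) y =
    cfA v l i y * ((y i - z i) / ‖y - z‖) + cfB v l i y * ((y l - z l) / ‖y - z‖) := by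
  rw [pd_frame, pd_dist hy, pd_dist hy]
  simp [EuclideanSpace.inner_single_right]

lemma abs_sum_add_sq_sub_one_le {F W : Fin d → ℝ} {q : ℝ} (hW : ∑ i, W i ^ 2 = 1)
    (hq1 : q ≤ 1) (h : ∀ i, |F i - W i| ≤ q) : |∑ i, F i ^ 2 - 1| ≤ d * (3 * q) := by
  rw [← hW, ← Finset.sum_sub_distrib]
  refine abs_sum_fin_le fun i => ?_
  have h1 : W i ^ 2 ≤ 1 := by
    rw [← hW]
    exact Finset.single_le_sum (f := fun i => W i ^ 2) (fun _ _ => sq_nonneg _) (Finset.mem_univ i)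
  have h2 : |W i| ≤ 1 := abs_le_one_iff_mul_self_le_one.2 (by linarith [sq (W i)])
  have e : F i ^ 2 - W i ^ 2 = (F i - W i) * (2 * W i + (F i - W i)) := by ring
  have h3 : |2 * W i + (F i - W i)| ≤ 3 := by
    have a1 := abs_le.1 h2
    have a2 := abs_le.1 ((h i).trans hq1)
    rw [abs_le]; constructor <;> linarith
  rw [e, abs_mul]
  nlinarith [abs_nonneg (F i - W i), abs_nonneg (2 * W i + (F i - W i)), h i]

lemma Lop_bar (hc : |c| < 1 / 10) (hs : ‖fderiv ℝ v y‖ ≤ ε) (hε : ε ≤ 1 / 10) (hy : y ≠ z) :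
    ∃ e, |e| ≤ (|p| + 2) * (20 * d * (ε + |c|)) ∧
      Lop v l (bar l c p z) y = p * tilt l c z y ^ (p - 2) * (p - 1 + (d - 1) + e) := by
  set N := ‖y - z‖ with hN
  have hN0 : 0 < N := norm_pos_iff.2 (sub_ne_zero.2 hy)
  have hε0 : 0 ≤ ε := (norm_nonneg _).trans hs
  set G := tilt l c z y with hG
  set W : Fin d → ℝ := fun i => (y i - z i) / N with hWdef
  have hW : ∑ i, W i ^ 2 = 1 := by
    have : N ^ 2 = ∑ i, (y i - z i) ^ 2 := by
      rw [hN, EuclideanSpace.norm_sq_eq]; simp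
    simp only [hWdef, div_pow, ← Finset.sum_div]
    rw [← this, div_self (by positivity)]
  have hW1 : ∀ i, |W i| ≤ 1 := fun i => by
    rw [hWdef, abs_div, abs_of_pos hN0]
    exact div_le_one_of_le₀ (abs_apply_sub_le i y z) hN0.le
  set a : Fin d → ℝ := fun i => pd (frame v l i y) (fun x => ‖x - z‖) y with ha
  set b : Fin d → ℝ := fun i => pd (frame v l i y) (tilt l c z) y with hb
  have hframe_l : ∀ i, |frame v l i y l| ≤ 2 := by
    intro i
    by_cases h : i = l
    · subst h; simp [frame, cfA, cfB, chi_self]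
    · have := abs_cfB_le (l := l) hs i
      simp [frame, Ne.symm h]; linarith
  have haW : ∀ i, |a i - W i| ≤ 2 * ε := by
    intro i
    have e : a i - W i = (cfA v l i y - 1) * W i + cfB v l i y * W l := by
      simp only [ha, hWdef]; rw [pd_dist_frame hy]; ring
    rw [e]
    refine (abs_add_le _ _).trans ?_
    rw [abs_mul, abs_mul]
    have h1 := mul_le_mul (abs_cfA_sub_one_le (l := l) hs i) (hW1 i) (abs_nonneg _) hε0
    have h2 := mul_le_mul (abs_cfB_le (l := l) hs i) (hW1 l) (abs_nonneg _) hε0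
    linarith
  have hbW : ∀ i, |b i - W i| ≤ 2 * ε + 2 * |c| := by
    intro i
    have e : b i - W i = (a i - W i) + c * frame v l i y l := by
      simp only [hb, ha]; rw [pd_tilt hy]; ring
    rw [e]
    refine (abs_add_le _ _).trans ?_
    rw [abs_mul]
    have h1 := mul_le_mul_of_nonneg_left (hframe_l i) (abs_nonneg c)
    linarith [haW i]
  have hP := abs_sum_add_sq_sub_one_le hW (by linarith) hbW
  have hA := abs_sum_add_sq_sub_one_le hW (by linarith) haW
  have hR : |∑ i, (‖frame v l i y‖ ^ 2 - 1)| ≤ d * (3 * ε) := by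
    refine abs_sum_fin_le fun i => ?_
    rw [norm_frame_sq]
    have h1 := abs_le.1 (abs_cfA_sub_one_le (l := l) hs i)
    have h2 := abs_le.1 (abs_cfB_le (l := l) hs i)
    have h3 : cfB v l i y ^ 2 ≤ ε ^ 2 := sq_le_sq' h2.1 h2.2
    have h4 : (cfA v l i y - 1) ^ 2 ≤ ε ^ 2 := sq_le_sq' h1.1 h1.2
    rw [abs_le]; constructor <;> nlinarith [sq_nonneg (cfB v l i y), sq_nonneg (cfA v l i y - 1)]
  have hRsum : ∑ i, (‖frame v l i y‖ ^ 2 - 1) = ∑ i, ‖frame v l i y‖ ^ 2 - d := by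
    simp [Finset.sum_sub_distrib]
  set R := ∑ i, (‖frame v l i y‖ ^ 2 - a i ^ 2) with hRdef
  have hR2 : |R - (d - 1)| ≤ d * (9 * ε) := by
    have e : R - (d - 1) = ∑ i, (‖frame v l i y‖ ^ 2 - 1) - (∑ i, a i ^ 2 - 1) := by
      rw [hRdef, Finset.sum_sub_distrib, hRsum]; ring
    rw [e]
    refine (abs_sub _ _).trans ?_
    linarith
  have hd1 : (1 : ℝ) ≤ d := by exact_mod_cast Fin.pos l
  have hγ : |G / N - 1| ≤ |c| := by
    have h1 := tilt_ge (l := l) (c := c) (y := y) (z := z)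
    have h2 := tilt_le (l := l) (c := c) (y := y) (z := z)
    have : G / N - 1 = (G - N) / N := by field_simp
    rw [this, abs_div, abs_of_pos hN0, div_le_iff₀ hN0, abs_le]
    constructor <;> linarith
  have hQ : |G / N * R - (d - 1)| ≤ 20 * d * (ε + |c|) := by
    have e : G / N * R - (d - 1) = (G / N - 1) * (R - (d - 1)) + (G / N - 1) * (d - 1) +
      (R - (d - 1)) := by ring
    rw [e]
    have a1 : |(G / N - 1) * (R - (d - 1))| ≤ 1 * (d * (9 * ε)) := by
      rw [abs_mul]
      exact mul_le_mul (by linarith) hR2 (abs_nonneg _) zero_le_one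
    have a2 : |(G / N - 1) * (d - 1)| ≤ |c| * d := by
      rw [abs_mul]
      refine mul_le_mul hγ ?_ (abs_nonneg _) (abs_nonneg _)
      rw [abs_of_nonneg] <;> linarith
    have a3 := (abs_add_le ((G / N - 1) * (R - (d - 1)) + (G / N - 1) * (d - 1))
      (R - (d - 1))).trans (add_le_add_left (abs_add_le _ _) _)
    have a4 : 0 ≤ d * |c| := by positivity
    have a5 : 0 ≤ d * ε := by positivity
    linarith
  have hL : Lop v l (bar l c p z) y = p * G ^ (p - 2) * ((p - 1) * ∑ i, b i ^ 2 + G / N * R) := by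
    have hO : IsOpen ({z}ᶜ : Set (EuclideanSpace ℝ (Fin d))) := isOpen_compl_singleton
    have : ∀ i, pd (frame v l i y) (pd (frame v l i y) (bar l c p z)) y =
        p * G ^ (p - 2) * ((p - 1) * b i ^ 2 + G / N * (‖frame v l i y‖ ^ 2 - a i ^ 2)) := by
      intro i
      have h1 := pd_pd_rpow hO (smoothOn_tilt (l := l) (c := c))
        (fun x hx => tilt_pos (by linarith) hx) hy p (frame v l i y)
      have h2 := dist_mul_pd_pd_dist hy (frame v l i y)
      rw [pd_pd_tilt hy] at h1
      have h3 : G / N * (‖frame v l i y‖ ^ 2 - a i ^ 2) =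
          G * pd (frame v l i y) (pd (frame v l i y) fun x => ‖x - z‖) y := by
        simp only [ha]
        rw [← h2, ← hN]; field_simp
      rw [h3]
      exact h1
    simp only [Lop, this, ← Finset.mul_sum, Finset.sum_add_distrib, hRdef]
  refine ⟨(p - 1) * (∑ i, b i ^ 2 - 1) + (G / N * R - (d - 1)), ?_, by rw [hL]; ring⟩
  have a1 : |(p - 1) * (∑ i, b i ^ 2 - 1)| ≤ (|p| + 1) * (20 * d * (ε + |c|)) := by
    rw [abs_mul]
    refine mul_le_mul ?_ (hP.trans ?_) (abs_nonneg _) (by positivity)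
    · have := abs_sub p 1; simpa using this
    · have : 0 ≤ d * (ε + |c|) := by positivity
      linarith
  have := abs_add_le ((p - 1) * (∑ i, b i ^ 2 - 1)) (G / N * R - (d - 1))
  linarith

/-- The doubled oblique direction, annihilating the solution on the flat boundary. -/
def bh (v : EuclideanSpace ℝ (Fin d) → ℝ) (l : Fin d) (y : EuclideanSpace ℝ (Fin d)) :
    EuclideanSpace ℝ (Fin d) := bv v l y + ev l

lemma bh_apply_self : bh v l y l = 2 + pd (ev l) v y := by
  simp [bh, bv_apply_self]; ring

lemma pd_bh_self (h : zet v l y = 0) : pd (bh v l y) v y = 0 := by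
  have h1 := pd_bv_self h
  simp only [pd, bh, map_add] at h1 ⊢
  rw [h1]; ring

lemma bh_apply_self_ge (hs : ‖fderiv ℝ v y‖ ≤ ε) (hε : ε ≤ 1) : 1 ≤ bh v l y l := by
  rw [bh_apply_self]
  have := abs_le.1 ((abs_pd_ev_le (f := v) (y := y) l).trans hs)
  linarith

lemma inner_bh_le (hs : ‖fderiv ℝ v y‖ ≤ ε) (x : EuclideanSpace ℝ (Fin d)) :
    |inner ℝ x (bh v l y) - bh v l y l * x l| ≤ 2 * ε * ‖x‖ := by
  have h := sum_chi_le (l := l) hs x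
  have e : inner ℝ x (bh v l y) - bh v l y l * x l = -∑ i, chi l i * pd (ev i) v y * x i := by
    rw [bh_apply_self]
    simp only [bh, bv, inner_add_right, inner_sub_right, inner_smul_right, inner_sum]
    simp [EuclideanSpace.inner_single_right]
    ring
  rw [e, abs_neg]; exact h

lemma pd_bh_tilt (hy : y ≠ z) (hs : ‖fderiv ℝ v y‖ ≤ ε) :
    |pd (bh v l y) (tilt l c z) y - bh v l y l * ((y l - z l) / ‖y - z‖ + c)| ≤ 2 * ε := by
  have hN0 : 0 < ‖y - z‖ := norm_pos_iff.2 (sub_ne_zero.2 hy)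
  have h1 := inner_bh_le (l := l) hs (y - z)
  have h2 := dist_mul_pd_dist hy (bh v l y)
  rw [pd_tilt hy]
  have e : pd (bh v l y) (fun x => ‖x - z‖) y + c * bh v l y l -
      bh v l y l * ((y l - z l) / ‖y - z‖ + c) =
      (inner ℝ (y - z) (bh v l y) - bh v l y l * (y - z) l) / ‖y - z‖ := by
    rw [pd_dist hy]; simp; ring
  rw [e, abs_div, abs_norm, div_le_iff₀ hN0]
  exact h1

lemma pd_bar (hc : |c| < 1) (hy : y ≠ z) (ξ : EuclideanSpace ℝ (Fin d)) :
    pd ξ (bar l c p z) y = p * tilt l c z y ^ (p - 1) * pd ξ (tilt l c z) y :=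
  pd_rpow (smoothOn_tilt.differentiableAt isOpen_compl_singleton hy) (tilt_pos hc hy).ne' p ξ

end Barrier

section Comparison

variable {d : ℕ} {l : Fin d} {v u w : EuclideanSpace ℝ (Fin d) → ℝ}
  {O : Set (EuclideanSpace ℝ (Fin d))} {x y z : EuclideanSpace ℝ (Fin d)} {ε C δ k a b : ℝ}

/-- The tilting parameter of the barriers. -/
def tiltC (d : ℕ) (δ : ℝ) : ℝ := δ / (100 * d ^ 2)

lemma tiltC_pos (l : Fin d) (hδ : 0 < δ) : 0 < tiltC d δ := by
  have : (0 : ℝ) < d := by exact_mod_cast Fin.pos l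
  unfold tiltC; positivity

lemma tiltC_mul (l : Fin d) : tiltC d δ * d ^ 2 = δ / 100 := by
  have : (0 : ℝ) < d := by exact_mod_cast Fin.pos l
  unfold tiltC; field_simp

lemma tiltC_lt (l : Fin d) (hδ : 0 < δ) (hδ1 : δ ≤ 1) : tiltC d δ < 1 / 10 := by
  have h1 : (1 : ℝ) ≤ d := by exact_mod_cast Fin.pos l
  have h2 := tiltC_pos l hδ
  have h3 := tiltC_mul (δ := δ) l
  have h4 : (1 : ℝ) ≤ d ^ 2 := one_le_pow₀ h1
  nlinarith

lemma barrier_error_le (l : Fin d) {p e : ℝ} (hp : |p| ≤ d) (hδ : 0 < δ) (hε0 : 0 ≤ ε)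
    (hε : ε ≤ tiltC d δ / 10) (he : |e| ≤ (|p| + 2) * (20 * d * (ε + tiltC d δ))) :
    |e| ≤ 66 / 100 * δ := by
  have h1 : (1 : ℝ) ≤ d := by exact_mod_cast Fin.pos l
  have h2 := tiltC_pos l hδ
  have h3 := tiltC_mul (δ := δ) l
  calc |e| ≤ (|p| + 2) * (20 * d * (ε + tiltC d δ)) := he
    _ ≤ (3 * d) * (20 * d * (tiltC d δ / 10 + tiltC d δ)) := by
        have : |p| + 2 ≤ 3 * d := by linarith
        gcongr
    _ = 66 * (tiltC d δ * d ^ 2) := by ring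
    _ = _ := by rw [h3]; ring

/-- The decaying (or growing, if `s < 0`) strict supersolution. -/
def supBar (l : Fin d) (δ s : ℝ) (y : EuclideanSpace ℝ (Fin d)) : ℝ :=
  s⁻¹ * bar l (tiltC d δ) (-s) 0 y

lemma smoothOn_supBar {s : ℝ} (hδ : 0 < δ) (hδ1 : δ ≤ 1) : SmoothOn {0}ᶜ (supBar l δ s) := by
  have := tiltC_lt l hδ hδ1
  have := tiltC_pos l hδ
  exact contDiffOn_const.mul (smoothOn_bar (by rw [abs_of_pos] <;> linarith))

lemma Lop_supBar_neg {s : ℝ} (hd : 2 ≤ d) (hδ : 0 < δ) (hδ1 : δ ≤ 1) (hs : s = d - 2 - δ)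
    (hs0 : s ≠ 0) (hv : ‖fderiv ℝ v y‖ ≤ ε) (hε : ε ≤ tiltC d δ / 10) (hy : y ≠ 0) :
    Lop v l (supBar l δ s) y < 0 := by
  have hc := tiltC_lt l hδ hδ1
  have hc0 := tiltC_pos l hδ
  have hca : |tiltC d δ| = tiltC d δ := abs_of_pos hc0
  have hd2 : (2 : ℝ) ≤ d := by exact_mod_cast hd
  obtain ⟨e, he, hL⟩ := Lop_bar (l := l) (p := -s) (by rwa [hca]) hv (by linarith) hy
  rw [hca] at he
  have hp : |(-s)| ≤ d := by rw [abs_neg, abs_le]; constructor <;> linarith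
  have he2 := abs_le.1 (barrier_error_le l hp hδ ((norm_nonneg _).trans hv) hε he)
  have hO : IsOpen ({0}ᶜ : Set (EuclideanSpace ℝ (Fin d))) := isOpen_compl_singleton
  unfold supBar
  rw [Lop_const_mul hO (smoothOn_bar (by rw [hca]; linarith)) hy, hL]
  have hG : 0 < tilt l (tiltC d δ) 0 y ^ (-s - 2) :=
    rpow_pos_of_pos (tilt_pos (by rw [hca]; linarith) hy) _
  have e1 : s⁻¹ * (-s * tilt l (tiltC d δ) 0 y ^ (-s - 2) * (-s - 1 + (d - 1) + e)) =
      -(tilt l (tiltC d δ) 0 y ^ (-s - 2) * (δ + e)) := by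
    field_simp
    rw [hs]; ring
  rw [e1, neg_lt_zero]
  exact mul_pos hG (by linarith)

lemma pd_supBar_neg {s : ℝ} (hδ : 0 < δ) (hδ1 : δ ≤ 1) (hs0 : s ≠ 0)
    (hv : ‖fderiv ℝ v y‖ ≤ ε) (hε : ε ≤ tiltC d δ / 10) (hy : y ≠ 0) (hyl : y l = 0) :
    pd (bh v l y) (supBar l δ s) y < 0 := by
  have hc := tiltC_lt l hδ hδ1
  have hc0 := tiltC_pos l hδ
  have hca : |tiltC d δ| = tiltC d δ := abs_of_pos hc0
  have hO : IsOpen ({0}ᶜ : Set (EuclideanSpace ℝ (Fin d))) := isOpen_compl_singleton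
  unfold supBar
  rw [pd_const_mul ((smoothOn_bar (by rw [hca]; linarith)).differentiableAt hO hy),
    pd_bar (by rw [hca]; linarith) hy]
  have hG : 0 < tilt l (tiltC d δ) 0 y ^ (-s - 1) :=
    rpow_pos_of_pos (tilt_pos (by rw [hca]; linarith) hy) _
  have h1 := abs_le.1 (pd_bh_tilt (l := l) (c := tiltC d δ) hy hv)
  have h2 := bh_apply_self_ge (l := l) hv (by linarith)
  have h3 : 0 < pd (bh v l y) (tilt l (tiltC d δ) 0) y := by
    simp only [hyl, PiLp.zero_apply, sub_zero, zero_div, zero_add] at h1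
    nlinarith
  have e1 : s⁻¹ * (-s * tilt l (tiltC d δ) 0 y ^ (-s - 1) *
      pd (bh v l y) (tilt l (tiltC d δ) 0) y) =
      -(tilt l (tiltC d δ) 0 y ^ (-s - 1) * pd (bh v l y) (tilt l (tiltC d δ) 0) y) := by
    field_simp
  rw [e1, neg_lt_zero]
  exact mul_pos hG h3

/-- The strict subsolution with a pole at `z`. -/
def subBar (l : Fin d) (z y : EuclideanSpace ℝ (Fin d)) : ℝ := bar l (-tiltC d 1) (-d) z y

lemma abs_neg_tiltC_lt (l : Fin d) : |(-tiltC d 1)| < 1 / 10 := by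
  rw [abs_neg, abs_of_pos (tiltC_pos l one_pos)]
  exact tiltC_lt l one_pos le_rfl

lemma smoothOn_subBar : SmoothOn {z}ᶜ (subBar l z) :=
  smoothOn_bar ((abs_neg_tiltC_lt l).trans (by norm_num))

lemma Lop_subBar_pos (hv : ‖fderiv ℝ v y‖ ≤ ε) (hε : ε ≤ tiltC d 1 / 10)
    (hy : y ≠ z) : 0 < Lop v l (subBar l z) y := by
  have hc := abs_neg_tiltC_lt l
  have hc1 := tiltC_lt l one_pos le_rfl
  have hd : (1 : ℝ) ≤ d := by exact_mod_cast Fin.pos l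
  obtain ⟨e, he, hL⟩ := Lop_bar (l := l) (p := -d) hc hv (by linarith) hy
  rw [abs_neg (tiltC d 1), abs_of_pos (tiltC_pos l one_pos)] at he
  have hp : |(-d : ℝ)| ≤ d := by rw [abs_neg, abs_of_pos]; linarith
  have he2 := abs_le.1 (barrier_error_le l hp one_pos ((norm_nonneg _).trans hv) hε he)
  have hG : 0 < tilt l (-tiltC d 1) z y ^ (-d - 2 : ℝ) :=
    rpow_pos_of_pos (tilt_pos (hc.trans (by norm_num)) hy) _
  unfold subBar
  rw [hL]
  have e1 : -d * tilt l (-tiltC d 1) z y ^ (-d - 2 : ℝ) * (-d - 1 + (d - 1) + e) =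
      d * (tilt l (-tiltC d 1) z y ^ (-d - 2 : ℝ) * (2 - e)) := by ring
  rw [e1]
  exact mul_pos (by linarith) (mul_pos hG (by linarith))

lemma pd_subBar_pos (hv : ‖fderiv ℝ v y‖ ≤ ε) (hε : ε ≤ tiltC d 1 / 10)
    (hy : y ≠ z) (hyl : y l = 0) (hz : 0 ≤ z l) : 0 < pd (bh v l y) (subBar l z) y := by
  have hc := abs_neg_tiltC_lt l
  have hc1 := tiltC_lt l one_pos le_rfl
  have hc0 := tiltC_pos l one_pos
  have hd : (1 : ℝ) ≤ d := by exact_mod_cast Fin.pos l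
  have hG : 0 < tilt l (-tiltC d 1) z y ^ (-d - 1 : ℝ) :=
    rpow_pos_of_pos (tilt_pos (hc.trans (by norm_num)) hy) _
  unfold subBar
  rw [pd_bar (hc.trans (by norm_num)) hy]
  have h1 := abs_le.1 (pd_bh_tilt (l := l) (c := -tiltC d 1) hy hv)
  have h2 := bh_apply_self_ge (l := l) hv (by linarith)
  have h3 : pd (bh v l y) (tilt l (-tiltC d 1) z) y < 0 := by
    have h4 : 0 ≤ z l / ‖y - z‖ := by positivity
    simp only [hyl, zero_sub, neg_div] at h1
    nlinarith
  have e1 : -d * tilt l (-tiltC d 1) z y ^ (-d - 1 : ℝ) * pd (bh v l y) (tilt l (-tiltC d 1) z) y =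
      d * (tilt l (-tiltC d 1) z y ^ (-d - 1 : ℝ) *
        -pd (bh v l y) (tilt l (-tiltC d 1) z) y) := by ring
  rw [e1]
  exact mul_pos (by linarith) (mul_pos hG (by linarith))

/-- Solutions of the linear oblique derivative problem solved by `v`, with an interior gradient
estimate. -/
structure LinSol (l : Fin d) (v : EuclideanSpace ℝ (Fin d) → ℝ)
    (O : Set (EuclideanSpace ℝ (Fin d))) (ε C : ℝ) (u : EuclideanSpace ℝ (Fin d) → ℝ) : Prop where
  isOpen : IsOpen O
  small : ∀ y ∈ O, 0 ≤ y l → ‖fderiv ℝ v y‖ ≤ ε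
  smooth : SmoothOn O u
  lop : ∀ y ∈ O, 0 < y l → Lop v l u y = 0
  flat : ∀ y ∈ O, y l = 0 → pd (bh v l y) u y = 0
  grad : ∀ x r m M, 0 < r → 0 ≤ x l →
    (∀ y, ‖y - x‖ ≤ 2 * r → 0 ≤ y l → y ∈ O ∧ m ≤ u y ∧ u y ≤ M) →
    r * ‖fderiv ℝ u x‖ ≤ C * (M - m)

lemma LinSol.neg (h : LinSol l v O ε C u) : LinSol l v O ε C fun y => -u y where
  isOpen := h.isOpen
  small := h.small
  smooth := h.smooth.neg
  lop y hy hyl := by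
    have : (fun y => -u y) = fun y => (-1) * u y := by ext; ring
    rw [this, Lop_const_mul h.isOpen h.smooth hy, h.lop y hy hyl, mul_zero]
  flat y hy hyl := by
    have : (fun y => -u y) = fun y => (-1) * u y := by ext; ring
    rw [this, pd_const_mul (h.smooth.differentiableAt h.isOpen hy), h.flat y hy hyl, mul_zero]
  grad x r m M hr hx hb := by
    rw [fderiv_fun_neg, norm_neg]
    have := h.grad x r (-M) (-m) hr hx fun y h1 h2 => by
      obtain ⟨h3, h4, h5⟩ := hb y h1 h2
      exact ⟨h3, by linarith, by linarith⟩
    linarith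

lemma LinSol.sub_const (h : LinSol l v O ε C u) (k : ℝ) : LinSol l v O ε C fun y => u y - k where
  isOpen := h.isOpen
  small := h.small
  smooth := h.smooth.sub contDiffOn_const
  lop y hy hyl := by
    rw [Lop_sub h.isOpen h.smooth contDiffOn_const hy, h.lop y hy hyl, Lop_const, sub_zero]
  flat y hy hyl := by
    rw [pd_sub (h.smooth.differentiableAt h.isOpen hy) (by fun_prop), h.flat y hy hyl, pd_const,
      sub_zero]
  grad x r m M hr hx hb := by
    rw [fderiv_sub_const]
    have := h.grad x r (m + k) (M + k) hr hx fun y h1 h2 => by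
      obtain ⟨h3, h4, h5⟩ := hb y h1 h2
      exact ⟨h3, by linarith, by linarith⟩
    linarith

/-- Comparison with strict subsolutions on half annuli. -/
lemma LinSol.compare (h : LinSol l v O ε C u) (hε : ε ≤ 1) (ha : 0 < a)
    (hA : ∀ y, a < ‖y - x‖ → ‖y - x‖ ≤ b → 0 ≤ y l → y ∈ O)
    (hu : ContinuousOn u {y | a ≤ ‖y - x‖ ∧ ‖y - x‖ ≤ b ∧ 0 ≤ y l}) (hw : SmoothOn {x}ᶜ w)
    (hL : ∀ y ∈ O, y ≠ x → 0 < y l → 0 < Lop v l w y)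
    (hb : ∀ y ∈ O, y ≠ x → y l = 0 → 0 < pd (bh v l y) w y)
    (hy1 : a ≤ ‖y - x‖) (hy2 : ‖y - x‖ ≤ b) (hyl : 0 ≤ y l) :
    ∃ z, 0 ≤ z l ∧ (‖z - x‖ = a ∨ ‖z - x‖ = b) ∧ w y - u y ≤ w z - u z := by
  set D : Set (EuclideanSpace ℝ (Fin d)) := {y | a ≤ ‖y - x‖ ∧ ‖y - x‖ ≤ b ∧ 0 ≤ y l} with hD
  set S : Set (EuclideanSpace ℝ (Fin d)) := {y | ‖y - x‖ = a ∨ ‖y - x‖ = b} with hS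
  set O' : Set (EuclideanSpace ℝ (Fin d)) := {y | a < ‖y - x‖ ∧ ‖y - x‖ < b} ∩ O with hO'
  have hcn : Continuous fun y : EuclideanSpace ℝ (Fin d) => ‖y - x‖ := by fun_prop
  have hcl : Continuous fun y : EuclideanSpace ℝ (Fin d) => y l := by fun_prop
  have hne : ∀ y : EuclideanSpace ℝ (Fin d), a ≤ ‖y - x‖ → y ≠ x := by
    rintro y hy rfl
    simp at hy; linarith
  have hO'o : IsOpen O' :=
    ((isOpen_lt continuous_const hcn).inter (isOpen_lt hcn continuous_const)).inter h.isOpen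
  have hDc : IsCompact D := by
    have h1 : IsClosed D := (isClosed_le continuous_const hcn).inter
      ((isClosed_le hcn continuous_const).inter (isClosed_le continuous_const hcl))
    refine (isCompact_closedBall x b).of_isClosed_subset h1 fun y hy => ?_
    rw [Metric.mem_closedBall, dist_eq_norm]; exact hy.2.1
  have hlt : ∀ y ∈ D, y ∉ S → a < ‖y - x‖ ∧ ‖y - x‖ < b := by
    intro y hy hyS
    simp only [hS, mem_ofPred_eq, not_or] at hyS
    exact ⟨lt_of_le_of_ne hy.1 (Ne.symm hyS.1), lt_of_le_of_ne hy.2.1 hyS.2⟩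
  have hDO : ∀ y ∈ D, y ∉ S → y ∈ O := fun y hy hyS => hA y (hlt y hy hyS).1 hy.2.1 hy.2.2
  have hsm : SmoothOn (O ∩ {x}ᶜ) fun y => w y - u y :=
    (hw.mono inter_subset_right).sub (h.smooth.mono inter_subset_left)
  have hO'sub : O' ⊆ O ∩ {x}ᶜ := fun y hy => ⟨hy.2, hne y hy.1.1.le⟩
  have hOo : IsOpen (O ∩ {x}ᶜ) := h.isOpen.inter isOpen_compl_singleton
  obtain ⟨z, hzD, hzS, hz⟩ := max_principle (v := v) (l := l) (S := S) (f := fun y => w y - u y)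
    hO'o hDc ((hw.continuousOn.mono fun y hy => hne y hy.1).sub hu) (hsm.mono hO'sub)
    (fun y hy hyS => ⟨hlt y hy hyS, hDO y hy hyS⟩)
    (fun y hy hyl => ⟨hy.1.1.le, hy.1.2.le, hyl⟩) (fun y hy => hy.2.2)
    (fun y hy hyS hyl => by
      have hyO : y ∈ O ∩ {x}ᶜ := ⟨hDO y hy hyS, hne y hy.1⟩
      rw [Lop_sub hOo (hw.mono inter_subset_right) (h.smooth.mono inter_subset_left) hyO,
        h.lop y hyO.1 hyl, sub_zero]
      exact hL y hyO.1 hyO.2 hyl)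
    (fun y hy hyS hyl => by
      refine ⟨bh v l y, ?_, ?_⟩
      · linarith [bh_apply_self_ge (l := l) (h.small y (hDO y hy hyS) hy.2.2) hε]
      rw [pd_sub (hw.differentiableAt isOpen_compl_singleton (hne y hy.1))
        (h.smooth.differentiableAt h.isOpen (hDO y hy hyS)), h.flat y (hDO y hy hyS) hyl, sub_zero]
      exact hb y (hDO y hy hyS) (hne y hy.1) hyl)
    (y := y) ⟨hy1, hy2, hyl⟩
  exact ⟨z, hzD.2.2, hzS, hz⟩

end Comparison

section Harnack

variable {d : ℕ} {l : Fin d} {v u w : EuclideanSpace ℝ (Fin d) → ℝ}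
  {O : Set (EuclideanSpace ℝ (Fin d))} {x y z : EuclideanSpace ℝ (Fin d)} {ε C δ k a b t : ℝ}

lemma subBar_eq (hy : y ≠ z) : subBar l z y = (tilt l (-tiltC d 1) z y ^ d)⁻¹ := by
  have h := tilt_pos (l := l) ((abs_neg_tiltC_lt l).trans (by norm_num)) hy
  rw [subBar, bar, rpow_neg h.le, rpow_natCast]

lemma subBar_le (ht : 0 < t) (h : t ≤ ‖y - z‖) : subBar l z y ≤ ((9 / 10 * t) ^ d)⁻¹ := by
  have hy : y ≠ z := by rintro rfl; simp at h; linarith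
  rw [subBar_eq hy]
  have h1 := tilt_ge (l := l) (c := -tiltC d 1) (y := y) (z := z)
  have h2 := abs_neg_tiltC_lt l
  gcongr
  nlinarith

lemma le_subBar (hy : y ≠ z) (h : ‖y - z‖ ≤ t) : ((11 / 10 * t) ^ d)⁻¹ ≤ subBar l z y := by
  rw [subBar_eq hy]
  have h0 := tilt_pos (l := l) ((abs_neg_tiltC_lt l).trans (by norm_num)) hy
  have h1 := tilt_le (l := l) (c := -tiltC d 1) (y := y) (z := z)
  have h2 := abs_neg_tiltC_lt l
  have h3 := norm_nonneg (y - z)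
  gcongr
  nlinarith

/-- A positivity estimate spreading a lower bound on a half ball. -/
lemma LinSol.spread (h : LinSol l v O ε C u) (hε : ε ≤ tiltC d 1 / 10) {s R c : ℝ} (hs : 0 < s)
    (hc : 0 ≤ c) (hz : 0 ≤ z l) (hA : ∀ y, ‖y - z‖ ≤ 3 * R → 0 ≤ y l → y ∈ O ∧ 0 ≤ u y)
    (hin : ∀ y, ‖y - z‖ = s → 0 ≤ y l → c ≤ u y) (hy1 : s ≤ ‖y - z‖) (hy2 : ‖y - z‖ ≤ 3 / 2 * R)
    (hyl : 0 ≤ y l) :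
    c * (9 / 10 * s) ^ d * (((33 / 20 * R) ^ d)⁻¹ - ((27 / 10 * R) ^ d)⁻¹) ≤ u y := by
  have hc1 := tiltC_lt l one_pos le_rfl
  have hR : 0 < R := by linarith
  have hne : y ≠ z := by rintro rfl; simp at hy1; linarith
  set A := c * (9 / 10 * s) ^ d with hAdef
  have hA0 : 0 ≤ A := by positivity
  rcases hA0.lt_or_eq with hApos | hAzero
  swap
  · rw [← hAzero, zero_mul]
    exact (hA y (by linarith) hyl).2
  have hO : IsOpen ({z}ᶜ : Set (EuclideanSpace ℝ (Fin d))) := isOpen_compl_singleton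
  obtain ⟨p, hpl, hpS, hp⟩ := h.compare (w := fun x => A * subBar l z x) (by linarith) hs
    (fun y _ h2 h3 => (hA y h2 h3).1)
    (h.smooth.continuousOn.mono fun y hy => (hA y hy.2.1 hy.2.2).1) (contDiffOn_const.mul smoothOn_subBar)
    (fun y hy hyz hyl => by
      rw [Lop_const_mul hO smoothOn_subBar hyz]
      exact mul_pos hApos (Lop_subBar_pos (h.small y hy hyl.le) hε hyz))
    (fun y hy hyz hyl => by
      rw [pd_const_mul (smoothOn_subBar.differentiableAt hO hyz)]
      exact mul_pos hApos (pd_subBar_pos (h.small y hy hyl.ge) hε hyz hyl hz))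
    hy1 (by linarith : ‖y - z‖ ≤ 3 * R) hyl
  have hb : A * subBar l z p - u p ≤ A * ((27 / 10 * R) ^ d)⁻¹ := by
    rcases hpS with hpS | hpS
    · have h1 := subBar_le (l := l) hs hpS.ge
      have h2 : A * subBar l z p ≤ c := by
        calc A * subBar l z p ≤ A * ((9 / 10 * s) ^ d)⁻¹ := by gcongr
          _ = c := by rw [hAdef]; field_simp
      have h3 := hin p hpS hpl
      have : 0 ≤ A * ((27 / 10 * R) ^ d)⁻¹ := by positivity
      linarith
    · have h1 := subBar_le (l := l) (by linarith) hpS.ge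
      have h2 := (hA p hpS.le hpl).2
      have h3 : A * subBar l z p ≤ A * ((9 / 10 * (3 * R)) ^ d)⁻¹ := by gcongr
      have e : 9 / 10 * (3 * R) = 27 / 10 * R := by ring
      rw [e] at h3
      linarith
  have hlow := le_subBar (l := l) hne hy2
  have e : 11 / 10 * (3 / 2 * R) = 33 / 20 * R := by ring
  rw [e] at hlow
  have := mul_le_mul_of_nonneg_left hlow hA0
  rw [mul_sub]
  linarith

lemma halfBall_sub_le (hO : IsOpen O) (hu : SmoothOn O u) {r B : ℝ} (hz : 0 ≤ z l)
    (h : ∀ y, ‖y - z‖ ≤ r → 0 ≤ y l → y ∈ O ∧ ‖fderiv ℝ u y‖ ≤ B) (hy : ‖y - z‖ ≤ r)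
    (hyl : 0 ≤ y l) : |u y - u z| ≤ B * ‖y - z‖ := by
  set S : Set (EuclideanSpace ℝ (Fin d)) := Metric.closedBall z r ∩ {y | 0 ≤ y l} with hS
  have hconv : Convex ℝ S := by
    refine (convex_closedBall z r).inter ?_
    exact convex_halfSpace_ge
      (EuclideanSpace.proj (𝕜 := ℝ) l : EuclideanSpace ℝ (Fin d) →L[ℝ] ℝ).isLinear 0
  have hmem : ∀ y ∈ S, y ∈ O ∧ ‖fderiv ℝ u y‖ ≤ B := fun y hy =>
    h y (by simpa [dist_eq_norm] using hy.1) hy.2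
  have := hconv.norm_image_sub_le_of_norm_fderiv_le (𝕜 := ℝ) (f := u) (x := z) (y := y)
    (fun y hy => hu.differentiableAt hO (hmem y hy).1) (fun y hy => (hmem y hy).2)
    ⟨by simpa using (norm_nonneg _).trans hy, hz⟩ ⟨by simpa [dist_eq_norm] using hy, hyl⟩
  simpa using this

lemma exists_local_harnack (d : ℕ) (hd : 1 ≤ d) {C : ℝ} (hC : 0 < C) :
    ∃ A, 0 < A ∧ ∀ (l : Fin d) (v u : EuclideanSpace ℝ (Fin d) → ℝ)
      (O : Set (EuclideanSpace ℝ (Fin d))) (ε r : ℝ) (x₀ : EuclideanSpace ℝ (Fin d)),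
      LinSol l v O ε C u → ε ≤ tiltC d 1 / 10 → 0 < r → 0 ≤ x₀ l →
      (∀ y, ‖y - x₀‖ ≤ 4 * r → 0 ≤ y l → y ∈ O ∧ 0 ≤ u y) →
      ∀ x y, 0 ≤ x l → 0 ≤ y l → ‖x - x₀‖ ≤ r / 2 → ‖y - x₀‖ ≤ r / 2 → u x ≤ A * u y := by
  set κ : ℝ := 1 / (2 + 8 * C * 2 ^ d) with hκ
  have hκ0 : 0 < κ := by positivity
  have hκe : κ * (2 + 8 * C * 2 ^ d) = 1 := by rw [hκ]; field_simp
  have hκ2 : κ ≤ 1 / 2 := by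
    have : 0 ≤ κ * (8 * C * 2 ^ d) := by positivity
    linarith
  set θ : ℝ := ((33 / 20 : ℝ) ^ d)⁻¹ - ((27 / 10 : ℝ) ^ d)⁻¹ with hθ
  have hθ0 : 0 < θ := by
    rw [hθ, sub_pos]
    exact inv_strictAnti₀ (by positivity) (pow_lt_pow_left₀ (by norm_num) (by norm_num) (by omega))
  set B : ℝ := 2 / (θ * (9 / 10 * κ) ^ d) + 2 with hB
  have hB0 : 0 < B := by positivity
  refine ⟨4 ^ d * B, by positivity, ?_⟩
  intro l v u O ε r x₀ h hε hr hx₀ hA x y hxl hyl hx hy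
  set D : Set (EuclideanSpace ℝ (Fin d)) := Metric.closedBall x₀ r ∩ {y | 0 ≤ y l} with hD
  have hDmem : ∀ y, y ∈ D ↔ ‖y - x₀‖ ≤ r ∧ 0 ≤ y l := fun y => by
    simp [hD, dist_eq_norm]
  have hcl : Continuous fun y : EuclideanSpace ℝ (Fin d) => y l := by fun_prop
  have hDc : IsCompact D :=
    (isCompact_closedBall x₀ r).inter_right (isClosed_le continuous_const hcl)
  have hDO : ∀ y ∈ D, y ∈ O ∧ 0 ≤ u y := fun y hy => by
    rw [hDmem] at hy; exact hA y (by linarith) hy.2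
  have hcont : ContinuousOn (fun y => (r - ‖y - x₀‖) ^ d * u y) D :=
    (Continuous.continuousOn (by fun_prop)).mul
      (h.smooth.continuousOn.mono fun y hy => (hDO y hy).1)
  obtain ⟨z, hzD, hmax⟩ := hDc.exists_isMaxOn ⟨x₀, (hDmem _).2 ⟨by simpa using hr.le, hx₀⟩⟩ hcont
  have hz := (hDmem z).1 hzD
  set ρ := (r - ‖z - x₀‖) / 2 with hρ
  have hρ0 : 0 ≤ ρ := by rw [hρ]; linarith
  have hρr : ρ ≤ r := by rw [hρ]; linarith [norm_nonneg (z - x₀)]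
  have huz := (hDO z hzD).2
  have hm : ∀ p ∈ D, (r - ‖p - x₀‖) ^ d * u p ≤ (2 * ρ) ^ d * u z := by
    intro p hp
    have := hmax hp
    have e : 2 * ρ = r - ‖z - x₀‖ := by rw [hρ]; ring
    rw [e]; exact this
  have hxO := hA x (by linarith) hxl
  have hyO := hA y (by linarith) hyl
  set q := (ρ / r) ^ d * u z with hq
  have hq0 : 0 ≤ q := by positivity
  have hxq : u x ≤ 4 ^ d * q := by
    have h1 := hm x ((hDmem x).2 ⟨by linarith, hxl⟩)
    have h2 : (r / 2) ^ d * u x ≤ (r - ‖x - x₀‖) ^ d * u x := by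
      have := hxO.2
      gcongr
      linarith
    have h3 : (2 * ρ) ^ d * u z = (r / 2) ^ d * (4 ^ d * q) := by
      rw [hq, ← mul_assoc, ← mul_assoc, ← mul_pow, ← mul_pow]
      congr 2; field_simp; ring
    rw [h3] at h1
    exact le_of_mul_le_mul_left (h2.trans h1) (by positivity)
  suffices hqy : q ≤ B * u y by
    calc u x ≤ 4 ^ d * q := hxq
      _ ≤ 4 ^ d * (B * u y) := by gcongr
      _ = _ := by ring
  rcases hq0.lt_or_eq with hqpos | hqzero
  swap
  · rw [← hqzero]; exact mul_nonneg hB0.le hyO.2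
  have hρpos : 0 < ρ := by
    rcases hρ0.lt_or_eq with h0 | h0
    · exact h0
    · rw [hq, ← h0, zero_div, zero_pow (by omega), zero_mul] at hqpos
      exact absurd hqpos (lt_irrefl _)
  have hball : ∀ p, ‖p - z‖ ≤ ρ → 0 ≤ p l → p ∈ O ∧ 0 ≤ u p ∧ u p ≤ 2 ^ d * u z := by
    intro p hp hpl
    have h1 : ‖p - x₀‖ ≤ r - ρ := by
      have : ‖p - x₀‖ ≤ ‖p - z‖ + ‖z - x₀‖ := norm_sub_le_norm_sub_add_norm_sub _ _ _
      have e : 2 * ρ = r - ‖z - x₀‖ := by rw [hρ]; ring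
      linarith
    have hpD : p ∈ D := (hDmem p).2 ⟨by linarith, hpl⟩
    refine ⟨(hDO p hpD).1, (hDO p hpD).2, ?_⟩
    have h2 := hm p hpD
    have h3 : ρ ^ d * u p ≤ (r - ‖p - x₀‖) ^ d * u p := by
      have := (hDO p hpD).2
      gcongr
      linarith
    have h4 : (2 * ρ) ^ d * u z = ρ ^ d * (2 ^ d * u z) := by rw [mul_pow]; ring
    rw [h4] at h2
    exact le_of_mul_le_mul_left (h3.trans h2) (by positivity)
  have hnear : ∀ p, ‖p - z‖ ≤ κ * ρ → 0 ≤ p l → u z / 2 ≤ u p := by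
    intro p hp hpl
    have hκρ : κ * ρ ≤ 1 / 2 * ρ := by gcongr
    have h1 := halfBall_sub_le (B := 4 * C * 2 ^ d * u z / ρ) h.isOpen h.smooth hz.2 (fun p hp hpl => by
      refine ⟨(hball p (by linarith) hpl).1, ?_⟩
      have h2 := h.grad p (ρ / 4) 0 (2 ^ d * u z) (by positivity) hpl (fun p' hp' hpl' =>
        hball p' (by
          have : ‖p' - z‖ ≤ ‖p' - p‖ + ‖p - z‖ := norm_sub_le_norm_sub_add_norm_sub _ _ _
          linarith) hpl')
      rw [le_div_iff₀ hρpos]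
      linarith) hp hpl
    have h3 : 4 * C * 2 ^ d * u z / ρ * ‖p - z‖ ≤ 4 * C * 2 ^ d * u z / ρ * (κ * ρ) := by gcongr
    have h4 : 4 * C * 2 ^ d * u z / ρ * (κ * ρ) = (κ * (8 * C * 2 ^ d)) * (u z / 2) := by
      field_simp; ring
    have h5 : (κ * (8 * C * 2 ^ d)) * (u z / 2) ≤ 1 * (u z / 2) := by
      gcongr; linarith
    have := (abs_le.1 h1).1
    linarith
  have hqz : q ≤ u z := by
    have : (ρ / r) ^ d ≤ 1 := pow_le_one₀ (by positivity) ((div_le_one hr).2 hρr)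
    rw [hq]; nlinarith
  rcases le_total ‖y - z‖ (κ * ρ) with hyz | hyz
  · have h1 := hnear y hyz hyl
    have h2 : 2 * u y ≤ B * u y := by
      have := hyO.2
      gcongr
      rw [hB]
      have : 0 ≤ 2 / (θ * (9 / 10 * κ) ^ d) := by positivity
      linarith
    linarith
  · have h1 := h.spread (s := κ * ρ) (R := r) (c := u z / 2) (z := z) hε (by positivity)
      (by positivity) hz.2 (fun p hp hpl => hA p (by
        have : ‖p - x₀‖ ≤ ‖p - z‖ + ‖z - x₀‖ := norm_sub_le_norm_sub_add_norm_sub _ _ _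
        linarith) hpl) (fun p hp hpl => hnear p hp.le hpl) hyz (by
        have : ‖y - z‖ ≤ ‖y - x₀‖ + ‖x₀ - z‖ := norm_sub_le_norm_sub_add_norm_sub _ _ _
        rw [norm_sub_rev x₀ z] at this
        linarith) hyl
    have e : u z / 2 * (9 / 10 * (κ * ρ)) ^ d *
        (((33 / 20 * r) ^ d)⁻¹ - ((27 / 10 * r) ^ d)⁻¹) = (θ * (9 / 10 * κ) ^ d) / 2 * q := by
      rw [hq, hθ]
      simp only [mul_pow, div_pow, mul_inv]
      field_simp
    rw [e] at h1
    have h2 : q = 2 / (θ * (9 / 10 * κ) ^ d) * ((θ * (9 / 10 * κ) ^ d) / 2 * q) := by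
      field_simp
    have hyO2 := hyO.2
    calc q = 2 / (θ * (9 / 10 * κ) ^ d) * ((θ * (9 / 10 * κ) ^ d) / 2 * q) := h2
      _ ≤ 2 / (θ * (9 / 10 * κ) ^ d) * u y := by gcongr
      _ ≤ B * u y := by
        gcongr
        rw [hB]; linarith

/-- Harnack's inequality on half spheres for nonnegative exterior solutions. -/
lemma exists_sphere_harnack (d : ℕ) (hd : 1 ≤ d) {C : ℝ} (hC : 0 < C) :
    ∃ A, 0 < A ∧ ∀ (l : Fin d) (v u : EuclideanSpace ℝ (Fin d) → ℝ)
      (O : Set (EuclideanSpace ℝ (Fin d))) (ε R : ℝ),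
      LinSol l v O ε C u → ε ≤ tiltC d 1 / 10 → 0 < R →
      (∀ y, R < ‖y‖ → 0 ≤ y l → y ∈ O ∧ 0 ≤ u y) →
      ∀ x y, 0 ≤ x l → 0 ≤ y l → ‖x‖ = 2 * R → ‖y‖ = 2 * R → u x ≤ A * u y := by
  obtain ⟨A, hA0, hA⟩ := exists_local_harnack d hd hC
  refine ⟨A ^ 80 * A ^ 80, by positivity, ?_⟩
  intro l v u O ε R h hε hR hu
  set e : EuclideanSpace ℝ (Fin d) := (2 * R) • ev l with he
  have hel : e l = 2 * R := by simp [he]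
  have hen : ‖e‖ = 2 * R := by simp [he, norm_smul, abs_of_pos hR]
  have key : ∀ x, 0 ≤ x l → ‖x‖ = 2 * R → u x ≤ A ^ 80 * u e ∧ u e ≤ A ^ 80 * u x := by
    intro x hxl hx
    set γ : ℕ → EuclideanSpace ℝ (Fin d) := fun n => x + ((n : ℝ) / 80) • (e - x) with hγ
    have hdiff : ‖e - x‖ ≤ 4 * R := (norm_sub_le _ _).trans (by linarith)
    have hγl : ∀ n ≤ 80, 0 ≤ γ n l := by
      intro n hn
      have hn1 : (n : ℝ) / 80 ≤ 1 := by
        rw [div_le_one (by norm_num)]; exact_mod_cast hn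
      have hn0 : 0 ≤ (n : ℝ) / 80 := by positivity
      simp only [hγ, PiLp.add_apply, PiLp.smul_apply, PiLp.sub_apply, smul_eq_mul, hel]
      nlinarith
    have hγn : ∀ n ≤ 80, 141 / 100 * R ≤ ‖γ n‖ := by
      intro n hn
      set t := (n : ℝ) / 80 with ht
      have hn1 : t ≤ 1 := by
        rw [ht, div_le_one (by norm_num)]; exact_mod_cast hn
      have hn0 : 0 ≤ t := by positivity
      have e1 : γ n = (1 - t) • x + t • e := by simp only [hγ]; module
      have hin : 0 ≤ inner ℝ x e := by
        rw [he, inner_smul_right]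
        simp only [EuclideanSpace.inner_single_right]
        simp; positivity
      have e2 : ‖γ n‖ ^ 2 = ((1 - t) ^ 2 + t ^ 2) * (2 * R) ^ 2 + 2 * (t * (1 - t) * inner ℝ x e) := by
        rw [e1, norm_add_sq_real, norm_smul, norm_smul, mul_pow, mul_pow, hx, hen, inner_smul_left,
          inner_smul_right]
        simp; ring
      have h3 : 0 ≤ t * (1 - t) * inner ℝ x e :=
        mul_nonneg (mul_nonneg hn0 (by linarith)) hin
      refine abs_le_of_sq_le_sq' ?_ (norm_nonneg _) |>.2
      rw [e2]
      nlinarith [sq_nonneg (2 * t - 1), mul_nonneg (sq_nonneg (2 * t - 1)) (sq_nonneg R)]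
    have hstep : ∀ n < 80, u (γ n) ≤ A * u (γ (n + 1)) ∧ u (γ (n + 1)) ≤ A * u (γ n) := by
      intro n hn
      have h1 : γ (n + 1) - γ n = (1 / 80 : ℝ) • (e - x) := by
        simp only [hγ]; push_cast; module
      have h2 : ‖γ (n + 1) - γ n‖ ≤ R / 10 / 2 := by
        rw [h1, norm_smul]
        norm_num
        linarith
      have h3 : ‖γ n - γ n‖ ≤ R / 10 / 2 := by simp; positivity
      have h4 : ∀ y, ‖y - γ n‖ ≤ 4 * (R / 10) → 0 ≤ y l → y ∈ O ∧ 0 ≤ u y := by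
        intro y hy hyl
        refine hu y ?_ hyl
        have h5 := hγn n hn.le
        have h6 : ‖γ n‖ ≤ ‖y‖ + ‖y - γ n‖ := by
          have := norm_sub_norm_le (γ n) y
          rw [norm_sub_rev] at this
          linarith
        linarith
      have h5 := hA l v u O ε (R / 10) (γ n) h hε (by positivity) (hγl n hn.le) h4
      exact ⟨h5 _ _ (hγl n hn.le) (hγl (n + 1) hn) h3 h2,
        h5 _ _ (hγl (n + 1) hn) (hγl n hn.le) h2 h3⟩
    have hchain : ∀ n ≤ 80, u x ≤ A ^ n * u (γ n) ∧ u (γ n) ≤ A ^ n * u x := by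
      intro n
      induction n with
      | zero => intro _; simp [hγ]
      | succ n ih =>
        intro hn
        obtain ⟨i1, i2⟩ := ih (by omega)
        obtain ⟨s1, s2⟩ := hstep n (by omega)
        constructor
        · calc u x ≤ A ^ n * u (γ n) := i1
            _ ≤ A ^ n * (A * u (γ (n + 1))) := by gcongr
            _ = _ := by ring
        · calc u (γ (n + 1)) ≤ A * u (γ n) := s2
            _ ≤ A * (A ^ n * u x) := by gcongr
            _ = _ := by ring
    have hend : γ 80 = e := by simp only [hγ]; norm_num
    have := hchain 80 le_rfl
    rwa [hend] at this
  intro x y hxl hyl hx hy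
  calc u x ≤ A ^ 80 * u e := (key x hxl hx).1
    _ ≤ A ^ 80 * (A ^ 80 * u y) := by
      gcongr
      exact (key y hyl hy).2
    _ = _ := by ring

end Harnack

section Decay

variable {d : ℕ} {l : Fin d} {v u w : EuclideanSpace ℝ (Fin d) → ℝ}
  {O : Set (EuclideanSpace ℝ (Fin d))} {x y z : EuclideanSpace ℝ (Fin d)}
  {ε C δ k a b t s α β ρ R κ : ℝ}

/-- The radial profile of the barriers. -/
def prof (s t : ℝ) : ℝ := s⁻¹ * t ^ (-s)

lemma prof_lt (hs : s ≠ 0) {p q : ℝ} (hp : 0 < p) (hpq : p < q) : prof s q < prof s p := by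
  unfold prof
  rcases hs.lt_or_gt with h | h
  · have h1 : p ^ (-s) < q ^ (-s) := rpow_lt_rpow hp.le hpq (by linarith)
    exact mul_lt_mul_of_neg_left h1 (inv_lt_zero.2 h)
  · have h1 : q ^ (-s) < p ^ (-s) := rpow_lt_rpow_of_neg hp hpq (by linarith)
    exact mul_lt_mul_of_pos_left h1 (inv_pos.2 h)

lemma prof_le (hs : s ≠ 0) {p q : ℝ} (hp : 0 < p) (hpq : p ≤ q) : prof s q ≤ prof s p := by
  rcases hpq.lt_or_eq with h | rfl
  · exact (prof_lt hs hp h).le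
  · exact le_rfl

lemma supBar_eq_prof : supBar l δ s y = prof s (tilt l (tiltC d δ) 0 y) := rfl

lemma supBar_le (hδ : 0 < δ) (hs : s ≠ 0) (hy : y ≠ 0) (hyl : 0 ≤ y l) :
    supBar l δ s y ≤ prof s ‖y‖ := by
  rw [supBar_eq_prof]
  refine prof_le hs (norm_pos_iff.2 hy) ?_
  have := mul_nonneg (tiltC_pos l hδ).le hyl
  simpa [tilt] using this

lemma le_supBar (hδ : 0 < δ) (hδ1 : δ ≤ 1) (hs : s ≠ 0) (hy : y ≠ 0) :
    prof s (11 / 10 * ‖y‖) ≤ supBar l δ s y := by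
  rw [supBar_eq_prof]
  have hc := tiltC_lt l hδ hδ1
  have hca : |tiltC d δ| = tiltC d δ := abs_of_pos (tiltC_pos l hδ)
  refine prof_le hs (tilt_pos (by rw [hca]; linarith) hy) (tilt_le.trans ?_)
  rw [hca, sub_zero]
  gcongr
  linarith

lemma LinSol.barrier (h : LinSol l v O ε C u) (hd : 2 ≤ d) (hδ : 0 < δ) (hδ1 : δ ≤ 1)
    (hs : s = d - 2 - δ) (hs0 : s ≠ 0) (hε : ε ≤ tiltC d δ / 10) (ha : 0 < a)
    (hA : ∀ y, a < ‖y‖ → ‖y‖ ≤ b → 0 ≤ y l → y ∈ O)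
    (hcu : ContinuousOn u {y | a ≤ ‖y‖ ∧ 0 ≤ y l}) (hβ : 0 ≤ β)
    (h1 : ∀ y, ‖y‖ = a → 0 ≤ y l → α - β * supBar l δ s y ≤ u y)
    (h2 : ∀ y, ‖y‖ = b → 0 ≤ y l → α - β * supBar l δ s y ≤ u y)
    (hy1 : a ≤ ‖y‖) (hy2 : ‖y‖ ≤ b) (hyl : 0 ≤ y l) : α - β * supBar l δ s y ≤ u y := by
  have hc := tiltC_lt l hδ hδ1
  have hO : IsOpen ({0}ᶜ : Set (EuclideanSpace ℝ (Fin d))) := isOpen_compl_singleton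
  have hsm : SmoothOn {0}ᶜ (supBar l δ s) := smoothOn_supBar hδ hδ1
  have hne : ∀ y : EuclideanSpace ℝ (Fin d), a ≤ ‖y‖ → y ≠ 0 := by
    rintro y hy rfl
    simp at hy; linarith
  have hb0 : 0 < b := by linarith
  set P := |prof s a| + |prof s (11 / 10 * b)| with hP
  have hbd : ∀ y : EuclideanSpace ℝ (Fin d), a ≤ ‖y‖ → ‖y‖ ≤ b → 0 ≤ y l →
      |supBar l δ s y| ≤ P := by
    intro y h3 h4 h5
    have e1 := (supBar_le hδ hs0 (hne y h3) h5).trans (prof_le hs0 ha h3)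
    have e2 := (prof_le hs0 (by linarith) (by linarith : 11 / 10 * ‖y‖ ≤ 11 / 10 * b)).trans
      (le_supBar (l := l) hδ hδ1 hs0 (hne y h3))
    rw [abs_le]
    constructor
    · linarith [neg_abs_le (prof s (11 / 10 * b)), abs_nonneg (prof s a)]
    · linarith [le_abs_self (prof s a), abs_nonneg (prof s (11 / 10 * b))]
  refine le_of_forall_pos_le_add fun η hη => ?_
  set τ := η / (2 * P + 1) with hτ
  have hP0 : 0 ≤ P := by positivity
  have hτ0 : 0 < τ := by positivity
  obtain ⟨p, hpl, hpS, hp⟩ := h.compare (x := 0) (a := a) (b := b)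
    (w := fun x => -(β + τ) * supBar l δ s x) (y := y) (by linarith) ha
    (by simpa using hA)
    (hcu.mono fun y hy => by simpa using And.intro hy.1 hy.2.2) (contDiffOn_const.mul hsm)
    (fun y hy hyz hyl => by
      rw [Lop_const_mul hO hsm hyz]
      have := Lop_supBar_neg (l := l) hd hδ hδ1 hs hs0 (h.small y hy hyl.le) hε hyz
      nlinarith)
    (fun y hy hyz hyl => by
      rw [pd_const_mul (hsm.differentiableAt hO hyz)]
      have := pd_supBar_neg (s := s) hδ hδ1 hs0 (h.small y hy hyl.ge) hε hyz hyl
      nlinarith)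
    (by simpa using hy1) (by simpa using hy2) hyl
  simp only [sub_zero] at hpS
  have hpa : a ≤ ‖p‖ ∧ ‖p‖ ≤ b := by
    rcases hpS with h3 | h3 <;> rw [h3] <;> constructor <;> linarith
  have hpu : α - β * supBar l δ s p ≤ u p := by
    rcases hpS with h3 | h3
    · exact h1 p h3 hpl
    · exact h2 p h3 hpl
  have b1 := abs_le.1 (hbd p hpa.1 hpa.2 hpl)
  have b2 := abs_le.1 (hbd y hy1 hy2 hyl)
  have b3 : τ * (supBar l δ s y - supBar l δ s p) ≤ η := by
    calc τ * (supBar l δ s y - supBar l δ s p) ≤ τ * (2 * P + 1) := by gcongr; linarith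
      _ = η := by rw [hτ]; field_simp
  linarith

lemma LinSol.min_principle (h : LinSol l v O ε C u) (hd : 2 ≤ d) (hδ : 0 < δ) (hδ1 : δ < 1)
    (hs : s = d - 2 - δ) (hs0 : s ≠ 0)
    (hε : ε ≤ tiltC d δ / 10) (ha : 0 < a)
    (hA : ∀ y, a < ‖y‖ → ‖y‖ ≤ b → 0 ≤ y l → y ∈ O)
    (hcu : ContinuousOn u {y | a ≤ ‖y‖ ∧ 0 ≤ y l})
    (h1 : ∀ y, ‖y‖ = a → 0 ≤ y l → α ≤ u y) (h2 : ∀ y, ‖y‖ = b → 0 ≤ y l → α ≤ u y)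
    (hy1 : a ≤ ‖y‖) (hy2 : ‖y‖ ≤ b) (hyl : 0 ≤ y l) : α ≤ u y := by
  have := h.barrier (β := 0) (α := α) (y := y) hd hδ hδ1.le hs hs0 hε ha hA hcu le_rfl
    (by simpa using h1) (by simpa using h2) hy1 hy2 hyl
  simpa using this

lemma exists_mem_sphere (l : Fin d) (hR : 0 ≤ R) :
    ∃ y : EuclideanSpace ℝ (Fin d), ‖y‖ = R ∧ 0 ≤ y l :=
  ⟨R • ev l, by simp [norm_smul, abs_of_nonneg hR], by simpa using hR⟩

/-- A large lower bound on a far sphere forces a large oscillation. -/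
lemma LinSol.lower_bound_le (h : LinSol l v O ε C u) (hd : 2 ≤ d) (hδ : 0 < δ) (hδ1 : δ < 1)
    (hs : s = d - 2 - δ) (hs0 : s ≠ 0) (hε : ε ≤ tiltC d δ / 10)
    (hO : ∀ y, 1 < ‖y‖ → 0 ≤ y l → y ∈ O) (hcu : ContinuousOn u {y | 1 ≤ ‖y‖ ∧ 0 ≤ y l})
    (hab : ∀ y, 1 ≤ ‖y‖ → ‖y‖ ≤ 2 → 0 ≤ y l → a ≤ u y ∧ u y ≤ b) (hR : 2 ≤ R)
    (hκ : a ≤ κ) (hu : ∀ y, ‖y‖ = R → 0 ≤ y l → κ ≤ u y) :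
    κ - a ≤ (b - a) * ((prof s (11 / 10) - prof s (11 / 10 * R)) /
      (prof s (11 / 10) - prof s 2)) := by
  set h1 := prof s (11 / 10) with hh1
  set hR' := prof s (11 / 10 * R) with hhR
  set h2 := prof s 2 with hh2
  have c1 : 0 < h1 - h2 := sub_pos.2 (prof_lt hs0 (by norm_num) (by norm_num))
  have c2 : 0 < h1 - hR' := sub_pos.2 (prof_lt hs0 (by norm_num) (by linarith))
  set β := (κ - a) / (h1 - hR') with hβ
  have hβ0 : 0 ≤ β := div_nonneg (by linarith) c2.le
  have hβe : β * (h1 - hR') = κ - a := by rw [hβ]; field_simp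
  obtain ⟨y, hy, hyl⟩ := exists_mem_sphere l (R := 2) (by norm_num)
  have hne : ∀ y : EuclideanSpace ℝ (Fin d), 1 ≤ ‖y‖ → y ≠ 0 := by
    rintro y hy rfl
    simp at hy; linarith
  have key := h.barrier (a := 1) (b := R) (α := a + β * h1) (y := y) hd hδ hδ1.le hs hs0 hε one_pos
    (fun y h3 _ h4 => hO y h3 h4) hcu hβ0
    (fun y h3 h4 => by
      have e1 := le_supBar (l := l) hδ hδ1.le hs0 (hne y h3.ge)
      rw [h3, mul_one] at e1
      have e2 := (hab y h3.ge (by linarith) h4).1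
      have e3 := mul_le_mul_of_nonneg_left e1 hβ0
      linarith)
    (fun y h3 h4 => by
      have e1 := le_supBar (l := l) hδ hδ1.le hs0 (hne y (by linarith))
      rw [h3] at e1
      have e2 := hu y h3 h4
      have e3 := mul_le_mul_of_nonneg_left e1 hβ0
      linarith)
    (by linarith) (by linarith) hyl
  have e1 := supBar_le hδ hs0 (hne y (by linarith)) hyl
  rw [hy] at e1
  have e2 := mul_le_mul_of_nonneg_left e1 hβ0
  have e3 := (hab y (by linarith) hy.le hyl).2
  have e4 : β * (h1 - h2) ≤ b - a := by linarith
  calc κ - a = (β * (h1 - h2)) * ((h1 - hR') / (h1 - h2)) := by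
        rw [← hβe]; field_simp
    _ ≤ _ := by gcongr

/-- Solutions bounded below with a finite lower limit are nearly constant on some far spheres. -/
lemma exists_almost_const_spheres {A L B : ℝ} (hA : 0 < A)
    (hu : ∀ y : EuclideanSpace ℝ (Fin d), 1 ≤ ‖y‖ → 0 ≤ y l → B ≤ u y)
    (hH : ∀ k R, 1 ≤ R → (∀ y, R < ‖y‖ → 0 ≤ y l → k ≤ u y) →
      ∀ x y, 0 ≤ x l → 0 ≤ y l → ‖x‖ = 2 * R → ‖y‖ = 2 * R → u x - k ≤ A * (u y - k))
    (hL : ∀ R, 1 ≤ R → ∃ y, R ≤ ‖y‖ ∧ 0 ≤ y l ∧ u y ≤ L) :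
    ∃ ℓ ≤ L, ∀ η > 0, ∀ R, ∃ ρ ≥ R, ∀ y, ‖y‖ = ρ → 0 ≤ y l → |u y - ℓ| ≤ η := by
  set S : Set ℝ := {k | ∃ R, 1 ≤ R ∧ ∀ y : EuclideanSpace ℝ (Fin d), R ≤ ‖y‖ → 0 ≤ y l → k ≤ u y}
    with hS
  have hSL : ∀ k ∈ S, k ≤ L := by
    rintro k ⟨R, hR, hk⟩
    obtain ⟨y, h1, h2, h3⟩ := hL R hR
    exact (hk y h1 h2).trans h3
  have hSne : S.Nonempty := ⟨B, 1, le_rfl, hu⟩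
  have hSb : BddAbove S := ⟨L, hSL⟩
  refine ⟨sSup S, csSup_le hSne hSL, fun η hη R => ?_⟩
  set ℓ := sSup S with hℓ
  set η' := η / (2 * A + 1) with hη'
  have hη'0 : 0 < η' := by positivity
  obtain ⟨k, ⟨R₁, hR₁, hk⟩, hkl⟩ := exists_lt_of_lt_csSup hSne (by linarith : ℓ - η' < sSup S)
  set R₂ := max R R₁ with hR₂
  have hR₂1 : 1 ≤ R₂ := hR₁.trans (le_max_right _ _)
  have hnot : ℓ + η' ∉ S := fun hmem => by
    have := le_csSup hSb hmem
    linarith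
  have : ∃ y : EuclideanSpace ℝ (Fin d), 2 * R₂ ≤ ‖y‖ ∧ 0 ≤ y l ∧ u y < ℓ + η' := by
    by_contra! hcon
    exact hnot ⟨2 * R₂, by linarith, hcon⟩
  obtain ⟨y, hy1, hyl, hy2⟩ := this
  have hR₃ : R₂ ≤ ‖y‖ / 2 := by linarith
  refine ⟨‖y‖, by linarith [le_max_left R R₁], fun x hx hxl => ?_⟩
  have hk' : ∀ y : EuclideanSpace ℝ (Fin d), ‖y‖ / 2 ≤ ‖y‖ := fun y => by
    linarith [norm_nonneg y]
  have h1 := hH k (‖y‖ / 2) (by linarith) (fun p hp hpl =>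
    hk p (by linarith [le_max_right R R₁]) hpl) x y hxl hyl (by linarith) (by linarith)
  have h2 := hk x (by linarith [le_max_right R R₁]) hxl
  have h3 : A * (u y - k) ≤ A * (2 * η') := by gcongr; linarith
  have h4 : (2 * A + 1) * η' = η := by rw [hη']; field_simp
  have h5 : k ≤ ℓ := le_csSup hSb ⟨R₁, hR₁, hk⟩
  have h6 : η' ≤ η := by nlinarith
  rw [abs_le]
  constructor <;> linarith

/-- Decay at infinity in the case of a decaying barrier. -/
lemma LinSol.decay_of_pos {A B : ℝ} (h : LinSol l v O ε C u) (hd : 2 ≤ d) (hδ : 0 < δ) (hδ1 : δ < 1)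
    (hs : s = d - 2 - δ) (hs0 : 0 < s) (hε : ε ≤ tiltC d δ / 10) (hA : 0 < A)
    (hO : ∀ y, 1 < ‖y‖ → 0 ≤ y l → y ∈ O) (hcu : ContinuousOn u {y | 1 ≤ ‖y‖ ∧ 0 ≤ y l})
    (hab : ∀ y, 1 ≤ ‖y‖ → ‖y‖ ≤ 2 → 0 ≤ y l → a ≤ u y ∧ u y ≤ b)
    (hB : ∀ y : EuclideanSpace ℝ (Fin d), 1 ≤ ‖y‖ → 0 ≤ y l → B ≤ u y)
    (hH : ∀ k R, 1 ≤ R → (∀ y, R < ‖y‖ → 0 ≤ y l → k ≤ u y) →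
      ∀ x y, 0 ≤ x l → 0 ≤ y l → ‖x‖ = 2 * R → ‖y‖ = 2 * R → u x - k ≤ A * (u y - k)) :
    ∃ k, ∀ y, 1 ≤ ‖y‖ → 0 ≤ y l → |u y - k| ≤
      prof s 1 / (prof s (11 / 10) - prof s 2) * (b - a) / prof s (11 / 10) * prof s ‖y‖ := by
  have hs0' := hs0.ne'
  set h1 := prof s (11 / 10) with hh1
  have hprof : ∀ t, 0 < t → 0 < prof s t := fun t ht => mul_pos (inv_pos.2 hs0) (rpow_pos_of_pos ht _)
  have c1 : 0 < h1 - prof s 2 := sub_pos.2 (prof_lt hs0' (by norm_num) (by norm_num))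
  have c2 : h1 ≤ prof s 1 := prof_le hs0' (by norm_num) (by norm_num)
  have c3 : 0 < h1 := hprof _ (by norm_num)
  obtain ⟨y₀, hy₀, hy₀l⟩ := exists_mem_sphere l (R := 1) (by norm_num)
  have hab0 : 0 ≤ b - a := by
    have := hab y₀ hy₀.ge (by linarith) hy₀l
    linarith
  set M := prof s 1 / (h1 - prof s 2) * (b - a) with hM
  have hM0 : 0 ≤ M := mul_nonneg (div_nonneg (hprof 1 one_pos).le c1.le) hab0
  have hlow : ∀ w, LinSol l v O ε C w → ContinuousOn w {y | 1 ≤ ‖y‖ ∧ 0 ≤ y l} → ∀ a' b' κ R, b' - a' = b - a →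
      (∀ y, 1 ≤ ‖y‖ → ‖y‖ ≤ 2 → 0 ≤ y l → a' ≤ w y ∧ w y ≤ b') → 2 ≤ R →
      (∀ y, ‖y‖ = R → 0 ≤ y l → κ ≤ w y) → κ - a' ≤ M := by
    intro w hw hcw a' b' κ R he hab' hR hκ
    rcases le_total κ a' with hle | hle
    · linarith
    refine (hw.lower_bound_le hd hδ hδ1 hs hs0' hε hO hcw hab' hR hle hκ).trans ?_
    rw [he, hM, mul_comm]
    have := hprof (11 / 10 * R) (by linarith)
    gcongr
    linarith
  obtain ⟨ℓ, -, hℓ⟩ := exists_almost_const_spheres (L := a + M + 1) hA hB hH (by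
    intro R hR
    by_contra! hcon
    have := hlow u h hcu a b (a + M + 1) (2 * R) rfl hab (by linarith) fun y hy hyl =>
      (hcon y (by linarith) hyl).le
    linarith)
  have hbneg : ∀ y : EuclideanSpace ℝ (Fin d), 1 ≤ ‖y‖ → ‖y‖ ≤ 2 → 0 ≤ y l →
      -b ≤ -u y ∧ -u y ≤ -a := fun y e1 e2 e3 =>
    ⟨by linarith [(hab y e1 e2 e3).2], by linarith [(hab y e1 e2 e3).1]⟩
  have d1 : ℓ - a ≤ M := by
    refine le_of_forall_pos_le_add fun η hη => ?_
    obtain ⟨ρ, hρ, hρu⟩ := hℓ η hη 2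
    have := hlow u h hcu a b (ℓ - η) ρ rfl hab hρ fun y hy hyl => by
      linarith [(abs_le.1 (hρu y hy hyl)).1]
    linarith
  have d2 : b - ℓ ≤ M := by
    refine le_of_forall_pos_le_add fun η hη => ?_
    obtain ⟨ρ, hρ, hρu⟩ := hℓ η hη 2
    have := hlow _ h.neg hcu.neg (-b) (-a) (-ℓ - η) ρ (by ring) hbneg hρ fun y hy hyl => by
      linarith [(abs_le.1 (hρu y hy hyl)).2]
    linarith
  have hM1 : M / h1 * h1 = M := by field_simp
  have hfar : ∀ w, LinSol l v O ε C w → ContinuousOn w {y | 1 ≤ ‖y‖ ∧ 0 ≤ y l} → ∀ ℓ' a', ℓ' - a' ≤ M →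
      (∀ y : EuclideanSpace ℝ (Fin d), ‖y‖ = 1 → 0 ≤ y l → a' ≤ w y) →
      (∀ η > 0, ∀ R, ∃ ρ ≥ R, ∀ y, ‖y‖ = ρ → 0 ≤ y l → ℓ' - η ≤ w y) →
      ∀ y, 1 ≤ ‖y‖ → 0 ≤ y l → ℓ' - M / h1 * prof s ‖y‖ ≤ w y := by
    intro w hw hcw ℓ' a' hla hw1 hw2 y hy hyl
    have hne : ∀ y : EuclideanSpace ℝ (Fin d), 1 ≤ ‖y‖ → y ≠ 0 := by
      rintro y hy rfl
      simp at hy; linarith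
    have hMh : 0 ≤ M / h1 := by positivity
    refine le_of_forall_pos_le_add fun η hη => ?_
    obtain ⟨ρ, hρ, hρu⟩ := hw2 η hη ‖y‖
    have key := hw.barrier (a := 1) (b := ρ) (α := ℓ' - η) (β := M / h1) (y := y) hd hδ hδ1.le
      hs hs0' hε one_pos (fun y e1 _ e2 => hO y e1 e2) hcw hMh
      (fun y e1 e2 => by
        have e3 := le_supBar (l := l) hδ hδ1.le hs0' (hne y e1.ge)
        rw [e1, mul_one] at e3
        have e4 := mul_le_mul_of_nonneg_left e3 hMh
        have := hw1 y e1 e2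
        linarith)
      (fun y e1 e2 => by
        have hy1 : y ≠ 0 := hne y (by linarith)
        have e3 := (hprof (11 / 10 * ‖y‖) (by linarith)).le.trans
          (le_supBar (l := l) hδ hδ1.le hs0' hy1)
        have e4 := mul_nonneg hMh e3
        have := hρu y e1 e2
        linarith) hy hρ hyl
    have e1 := mul_le_mul_of_nonneg_left (supBar_le hδ hs0' (hne y hy) hyl) hMh
    linarith
  refine ⟨ℓ, fun y hy hyl => ?_⟩
  have f1 := hfar u h hcu ℓ a d1 (fun y e1 e2 => (hab y e1.ge (by linarith) e2).1)
    (fun η hη R => by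
      obtain ⟨ρ, hρ, hρu⟩ := hℓ η hη R
      exact ⟨ρ, hρ, fun y e1 e2 => by linarith [(abs_le.1 (hρu y e1 e2)).1]⟩) y hy hyl
  have f2 := hfar _ h.neg hcu.neg (-ℓ) (-b) (by linarith)
    (fun y e1 e2 => (hbneg y e1.ge (by linarith) e2).1)
    (fun η hη R => by
      obtain ⟨ρ, hρ, hρu⟩ := hℓ η hη R
      exact ⟨ρ, hρ, fun y e1 e2 => by linarith [(abs_le.1 (hρu y e1 e2)).2]⟩) y hy hyl
  rw [abs_le]
  constructor <;> linarith

/-- Growth at infinity, for a growing barrier, of solutions above their infimum near the inner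
boundary. -/
lemma LinSol.growth_of_neg {A : ℝ} (h : LinSol l v O ε C u) (hd : 2 ≤ d) (hδ : 0 < δ) (hδ1 : δ < 1)
    (hs : s = d - 2 - δ) (hs0 : s < 0) (hε : ε ≤ tiltC d δ / 10) (hA : 0 < A)
    (hO : ∀ y, 1 < ‖y‖ → 0 ≤ y l → y ∈ O) (hcu : ContinuousOn u {y | 1 ≤ ‖y‖ ∧ 0 ≤ y l})
    (hab : ∀ y, 1 ≤ ‖y‖ → ‖y‖ ≤ 2 → 0 ≤ y l → a ≤ u y ∧ u y ≤ b)
    (ha : ∀ y : EuclideanSpace ℝ (Fin d), 1 ≤ ‖y‖ → 0 ≤ y l → a ≤ u y)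
    (hH : ∀ k R, 1 ≤ R → (∀ y, R < ‖y‖ → 0 ≤ y l → k ≤ u y) →
      ∀ x y, 0 ≤ x l → 0 ≤ y l → ‖x‖ = 2 * R → ‖y‖ = 2 * R → u x - k ≤ A * (u y - k))
    (hy : 1 ≤ ‖y‖) (hyl : 0 ≤ y l) :
    |u y - a| ≤ (1 + A * (-prof s (11 / 10) / (prof s (11 / 10) - prof s 2))) * (b - a) *
      ‖y‖ ^ (-s) := by
  have hs0' := hs0.ne
  set h1 := prof s (11 / 10) with hh1
  have c1 : 0 < h1 - prof s 2 := sub_pos.2 (prof_lt hs0' (by norm_num) (by norm_num))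
  have hprof : ∀ t, 0 < t → prof s t < 0 := fun t ht =>
    mul_neg_of_neg_of_pos (inv_lt_zero.2 hs0) (rpow_pos_of_pos ht _)
  have c3 : h1 < 0 := hprof _ (by norm_num)
  obtain ⟨y₀, hy₀, hy₀l⟩ := exists_mem_sphere l (R := 1) (by norm_num)
  have hab0 : 0 ≤ b - a := by
    have := hab y₀ hy₀.ge (by linarith) hy₀l
    linarith
  have hD : 0 ≤ -h1 / (h1 - prof s 2) := div_nonneg (by linarith) c1.le
  have hyp : 1 ≤ ‖y‖ ^ (-s) := one_le_rpow hy (by linarith)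
  rw [abs_of_nonneg (by linarith [ha y hy hyl])]
  rcases le_total ‖y‖ 2 with hy2 | hy2
  · have e1 := (hab y hy hy2 hyl).2
    have e2 : 1 * (b - a) * 1 ≤ (1 + A * (-h1 / (h1 - prof s 2))) * (b - a) * ‖y‖ ^ (-s) := by
      gcongr
      have := mul_nonneg hA.le hD
      linarith
    linarith
  · set Q := (b - a) * ((-h1 / (h1 - prof s 2)) * ‖y‖ ^ (-s)) with hQ
    have hQ0 : 0 ≤ Q := by positivity
    have hQA : u y - a ≤ A * Q := by
      refine le_of_forall_pos_le_add fun η hη => ?_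
      have : ∃ x : EuclideanSpace ℝ (Fin d), ‖x‖ = ‖y‖ ∧ 0 ≤ x l ∧ u x ≤ a + Q + η / A := by
        by_contra! hcon
        have hηA : 0 < η / A := by positivity
        have e1 := h.lower_bound_le hd hδ hδ1 hs hs0' hε hO hcu hab hy2 (κ := a + Q + η / A)
          (by linarith) (fun x e1 e2 => (hcon x e1 e2).le)
        have e2 : prof s (11 / 10) - prof s (11 / 10 * ‖y‖) ≤ -h1 * ‖y‖ ^ (-s) := by
          have : prof s (11 / 10 * ‖y‖) = h1 * ‖y‖ ^ (-s) := by
            rw [hh1, prof, prof, mul_rpow (by norm_num) (by positivity)]; ring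
          rw [this]; linarith
        have e3 : (b - a) * ((prof s (11 / 10) - prof s (11 / 10 * ‖y‖)) / (h1 - prof s 2)) ≤ Q := by
          rw [hQ]
          refine mul_le_mul_of_nonneg_left ?_ hab0
          rw [div_mul_eq_mul_div (-h1)]
          exact div_le_div_of_nonneg_right e2 c1.le
        linarith
      obtain ⟨x, hx, hxl, hxu⟩ := this
      have e1 := hH a (‖y‖ / 2) (by linarith) (fun p hp hpl => ha p (by linarith) hpl) y x hyl hxl
        (by linarith) (by linarith)
      have e2 : A * (u x - a) ≤ A * (Q + η / A) := by gcongr; linarith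
      have e3 : A * (Q + η / A) = A * Q + η := by field_simp
      linarith
    have e4 : 0 ≤ (b - a) * ‖y‖ ^ (-s) := by positivity
    have e5 : A * Q = A * (-h1 / (h1 - prof s 2)) * ((b - a) * ‖y‖ ^ (-s)) := by rw [hQ]; ring
    rw [e5] at hQA
    linarith

/-- Decay (or slow growth) at infinity of solutions bounded below. -/
lemma exists_decay (d : ℕ) (hd : 2 ≤ d) (hδ : 0 < δ) (hδ1 : δ < 1) (hs : s = d - 2 - δ)
    {C : ℝ} (hC : 0 < C) :
    ∃ K, 0 < K ∧ ∀ (l : Fin d) (v u : EuclideanSpace ℝ (Fin d) → ℝ)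
      (O : Set (EuclideanSpace ℝ (Fin d))) (ε a b : ℝ),
      LinSol l v O ε C u → ε ≤ tiltC d δ / 10 → (∀ y, 1 < ‖y‖ → 0 ≤ y l → y ∈ O) →
      ContinuousOn u {y | 1 ≤ ‖y‖ ∧ 0 ≤ y l} →
      (∀ y, 1 ≤ ‖y‖ → ‖y‖ ≤ 2 → 0 ≤ y l → a ≤ u y ∧ u y ≤ b) →
      (∃ B, ∀ y : EuclideanSpace ℝ (Fin d), 1 ≤ ‖y‖ → 0 ≤ y l → B ≤ u y) →
      ∃ k, ∀ y, 1 ≤ ‖y‖ → 0 ≤ y l → |u y - k| ≤ K * (b - a) * ‖y‖ ^ (-s) := by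
  obtain ⟨A, hA, hHar⟩ := exists_sphere_harnack d (by omega) hC
  have hs0' : s ≠ 0 := by
    intro h0
    have h1 : (d : ℝ) = 2 + δ := by linarith
    have h2 : (2 : ℝ) < d := by linarith
    have h3 : 2 < d := by exact_mod_cast h2
    have h4 : (3 : ℝ) ≤ d := by exact_mod_cast h3
    linarith
  have hHar' : ∀ (l : Fin d) (v u : EuclideanSpace ℝ (Fin d) → ℝ)
      (O : Set (EuclideanSpace ℝ (Fin d))) (ε : ℝ), LinSol l v O ε C u → ε ≤ tiltC d δ / 10 →
      (∀ y, 1 < ‖y‖ → 0 ≤ y l → y ∈ O) →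
      ∀ k R, 1 ≤ R → (∀ y, R < ‖y‖ → 0 ≤ y l → k ≤ u y) →
      ∀ x y, 0 ≤ x l → 0 ≤ y l → ‖x‖ = 2 * R → ‖y‖ = 2 * R → u x - k ≤ A * (u y - k) := by
    intro l v u O ε h hε hO k R hR hk
    have h1 : tiltC d δ ≤ tiltC d 1 := by unfold tiltC; gcongr
    exact hHar l v _ O ε R (h.sub_const k) (by linarith) (by linarith) fun y e1 e2 =>
      ⟨hO y (by linarith) e2, by linarith [hk y e1 e2]⟩
  set h1 := prof s (11 / 10) with hh1
  have c1 : 0 < h1 - prof s 2 := sub_pos.2 (prof_lt hs0' (by norm_num) (by norm_num))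
  rcases hs0'.lt_or_gt with hs0 | hs0
  · have c3 : h1 < 0 := mul_neg_of_neg_of_pos (inv_lt_zero.2 hs0) (rpow_pos_of_pos (by norm_num) _)
    have hD : 0 ≤ -h1 / (h1 - prof s 2) := div_nonneg (by linarith) c1.le
    refine ⟨1 + A * (-h1 / (h1 - prof s 2)), by positivity, ?_⟩
    intro l v u O ε a b h hε hO hcu hab ⟨B, hB⟩
    by_cases ha : ∀ y : EuclideanSpace ℝ (Fin d), 1 ≤ ‖y‖ → 0 ≤ y l → a ≤ u y
    · exact ⟨a, fun y hy hyl => h.growth_of_neg hd hδ hδ1 hs hs0 hε hA hO hcu hab ha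
        (hHar' l v u O ε h hε hO) hy hyl⟩
    push Not at ha
    obtain ⟨y₀, hy₀, hy₀l, hy₀u⟩ := ha
    obtain ⟨ℓ, hℓL, hℓ⟩ := exists_almost_const_spheres (L := (a + u y₀) / 2) hA hB
      (hHar' l v u O ε h hε hO) (by
        intro R hR
        by_contra! hcon
        have := h.min_principle (a := 1) (b := max R ‖y₀‖) (α := (a + u y₀) / 2) (y := y₀)
          hd hδ hδ1 hs hs0' hε one_pos (fun y e1 _ e2 => hO y e1 e2) hcu
          (fun y e1 e2 => by linarith [(hab y e1.ge (by linarith) e2).1])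
          (fun y e1 e2 => (hcon y (by rw [e1]; exact le_max_left _ _) e2).le) hy₀
          (le_max_right _ _) hy₀l
        linarith)
    have hbneg : ∀ y : EuclideanSpace ℝ (Fin d), 1 ≤ ‖y‖ → ‖y‖ ≤ 2 → 0 ≤ y l →
        -b ≤ -u y ∧ -u y ≤ -a := fun y e1 e2 e3 =>
      ⟨by linarith [(hab y e1 e2 e3).2], by linarith [(hab y e1 e2 e3).1]⟩
    obtain ⟨y₁, hy₁, hy₁l⟩ := exists_mem_sphere l (R := 1) (by norm_num)
    have hab0 := hab y₁ hy₁.ge (by linarith) hy₁l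
    have hb : ∀ y : EuclideanSpace ℝ (Fin d), 1 ≤ ‖y‖ → 0 ≤ y l → -b ≤ -u y := by
      intro y hy hyl
      obtain ⟨ρ, hρ, hρu⟩ := hℓ (a - (a + u y₀) / 2) (by linarith) ‖y‖
      exact h.neg.min_principle (a := 1) (b := ρ) hd hδ hδ1 hs hs0' hε one_pos
        (fun y e1 _ e2 => hO y e1 e2) hcu.neg (fun y e1 e2 => (hbneg y e1.ge (by linarith) e2).1)
        (fun y e1 e2 => by linarith [(abs_le.1 (hρu y e1 e2)).2]) hy hρ hyl
    refine ⟨b, fun y hy hyl => ?_⟩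
    have := h.neg.growth_of_neg hd hδ hδ1 hs hs0 hε hA hO hcu.neg hbneg hb
      (hHar' l v _ O ε h.neg hε hO) hy hyl
    have e1 : |u y - b| = |(-u y) - (-b)| := by rw [← abs_neg]; ring_nf
    have e2 : -a - -b = b - a := by ring
    rw [e1]
    rw [e2] at this
    exact this
  · have c3 : 0 < h1 := mul_pos (inv_pos.2 hs0) (rpow_pos_of_pos (by norm_num) _)
    have c4 : 0 < prof s 1 := mul_pos (inv_pos.2 hs0) (rpow_pos_of_pos (by norm_num) _)
    refine ⟨prof s 1 / (h1 - prof s 2) / h1 * s⁻¹, by positivity, ?_⟩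
    intro l v u O ε a b h hε hO hcu hab ⟨B, hB⟩
    obtain ⟨k, hk⟩ := h.decay_of_pos hd hδ hδ1 hs hs0 hε hA hO hcu hab hB (hHar' l v u O ε h hε hO)
    refine ⟨k, fun y hy hyl => (hk y hy hyl).trans_eq ?_⟩
    rw [show prof s ‖y‖ = s⁻¹ * ‖y‖ ^ (-s) from rfl]
    ring

end Decay

section Conclusion

variable {d : ℕ} {l : Fin d} {v : EuclideanSpace ℝ (Fin d) → ℝ}
  {O : Set (EuclideanSpace ℝ (Fin d))} {y : EuclideanSpace ℝ (Fin d)} {ε C δ a b : ℝ}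

lemma rpow_le_of_comparable {p t : ℝ} (hp : 0 < p) (h1 : p / 2 ≤ t) (h2 : t ≤ 2 * p) (e : ℝ) :
    t ^ e ≤ 2 ^ |e| * p ^ e := by
  have ht : 0 < t := by linarith
  rcases le_total 0 e with h | h
  · rw [abs_of_nonneg h, ← mul_rpow (by norm_num) hp.le]
    exact rpow_le_rpow ht.le h2 h
  · rw [abs_of_nonpos h]
    have e1 : (2 : ℝ) ^ (-e) * p ^ e = (p / 2) ^ e := by
      rw [div_rpow hp.le (by norm_num), rpow_neg (by norm_num)]
      field_simp
    rw [e1]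
    exact rpow_le_rpow_of_nonpos (by linarith) h1 h

lemma HodLoc.linSol (H : HodLoc l v O ε) (hC : ∀ x r m M, 0 < r → 0 ≤ x l →
    (∀ y, ‖y - x‖ ≤ 2 * r → 0 ≤ y l → y ∈ O ∧ m ≤ v y ∧ v y ≤ M) →
    r * ‖fderiv ℝ v x‖ ≤ C * (M - m)) : LinSol l v O ε C v where
  isOpen := H.isOpen
  small := H.small
  smooth := H.smooth
  lop := H.pde
  flat := fun y hy hyl => pd_bh_self (H.bc y hy hyl)
  grad := hC

/-- Decay of the gradient and of the Hessian. -/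
lemma exists_deriv_decay (d : ℕ) (hd : 2 ≤ d) (hδ : 0 < δ) (hδ1 : δ < 1) :
    ∃ ε₀ K : ℝ, 0 < ε₀ ∧ 0 < K ∧ ε₀ ≤ 1 / 2 ∧ ∀ (l : Fin d) (v : EuclideanSpace ℝ (Fin d) → ℝ)
      (O : Set (EuclideanSpace ℝ (Fin d))) (ε a b : ℝ), HodLoc l v O ε → ε ≤ ε₀ →
      (∀ y, 1 < ‖y‖ → 0 ≤ y l → y ∈ O) → ContinuousOn v {y | 1 ≤ ‖y‖ ∧ 0 ≤ y l} →
      (∀ y, 1 ≤ ‖y‖ → ‖y‖ ≤ 2 → 0 ≤ y l → a ≤ v y ∧ v y ≤ b) →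
      ((∃ B, ∀ y : EuclideanSpace ℝ (Fin d), 1 ≤ ‖y‖ → 0 ≤ y l → v y ≤ B) ∨
        (∃ B, ∀ y : EuclideanSpace ℝ (Fin d), 1 ≤ ‖y‖ → 0 ≤ y l → B ≤ v y)) →
      ∀ y, 2 ≤ ‖y‖ → 0 ≤ y l →
        ‖fderiv ℝ v y‖ ≤ K * (b - a) * ‖y‖ ^ (1 - d + δ) ∧
        hnorm v y ≤ K * (b - a) * ‖y‖ ^ (-d + δ) := by
  obtain ⟨Cg, hCg, hgrad⟩ := grad_estimate d (by omega)
  obtain ⟨ε₁, Ch, hε₁, hCh, hε₁', hhess⟩ := hess_estimate d (by omega)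
  set s : ℝ := d - 2 - δ with hs
  obtain ⟨K₁, hK₁, hdec⟩ := exists_decay d hd hδ hδ1 hs hCg
  set K₂ : ℝ := 16 * Cg * K₁ * 2 ^ |-s| with hK₂
  set K₃ : ℝ := 16 * Ch * K₂ * 2 ^ |1 - d + δ| with hK₃
  have hK₂0 : 0 < K₂ := by positivity
  have hK₃0 : 0 < K₃ := by positivity
  have hd0 : 0 < d := by omega
  have hl0 : 0 < tiltC d δ / 10 := by
    have := tiltC_pos (⟨0, hd0⟩ : Fin d) hδ
    positivity
  refine ⟨min (min ε₁ (tiltC d δ / 10)) (1 / 2), K₂ + K₃, by positivity, by positivity,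
    min_le_right _ _, ?_⟩
  intro l v O ε a b H hε hO hcv hab hB
  have hε1 : ε ≤ ε₁ := hε.trans ((min_le_left _ _).trans (min_le_left _ _))
  have hε2 : ε ≤ tiltC d δ / 10 := hε.trans ((min_le_left _ _).trans (min_le_right _ _))
  have hL : LinSol l v O ε Cg v := H.linSol fun x r m M h1 h2 h3 =>
    hgrad l v O ε x r m M H (hε1.trans hε₁') h1 h2 h3
  obtain ⟨y₀, hy₀, hy₀l⟩ := exists_mem_sphere l (R := 1) (by norm_num)
  have hD : 0 ≤ b - a := by
    have := hab y₀ hy₀.ge (by linarith) hy₀l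
    linarith
  have hk : ∃ k, ∀ y, 1 ≤ ‖y‖ → 0 ≤ y l → |v y - k| ≤ K₁ * (b - a) * ‖y‖ ^ (-s) := by
    rcases hB with ⟨B, hB⟩ | hB
    · obtain ⟨k, hk⟩ := hdec l v _ O ε (-b) (-a) hL.neg hε2 hO hcv.neg
        (fun y e1 e2 e3 => ⟨by linarith [(hab y e1 e2 e3).2], by linarith [(hab y e1 e2 e3).1]⟩)
        ⟨-B, fun y e1 e2 => neg_le_neg (hB y e1 e2)⟩
      refine ⟨-k, fun y e1 e2 => ?_⟩
      have := hk y e1 e2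
      rwa [show -v y - k = -(v y - -k) by ring, abs_neg, show -a - -b = b - a by ring] at this
    · exact hdec l v v O ε a b hL hε2 hO hcv hab hB
  obtain ⟨k, hk⟩ := hk
  have hG : ∀ y, 3 / 2 ≤ ‖y‖ → 0 ≤ y l → ‖fderiv ℝ v y‖ ≤ K₂ * (b - a) * ‖y‖ ^ (1 - d + δ) := by
    intro x hx hxl
    have hx0 : 0 < ‖x‖ := by linarith
    set N := K₁ * (b - a) * (2 ^ |-s| * ‖x‖ ^ (-s)) with hN
    have e1 := hL.grad x (‖x‖ / 8) (k - N) (k + N) (by linarith) hxl (by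
      intro y hy hyl
      have h1 := abs_le.1 ((abs_norm_sub_norm_le y x).trans hy)
      have h2 := hk y (by linarith) hyl
      have h3 := rpow_le_of_comparable hx0 (by linarith : ‖x‖ / 2 ≤ ‖y‖) (by linarith) (-s)
      have h4 : K₁ * (b - a) * ‖y‖ ^ (-s) ≤ N := by rw [hN]; gcongr
      have h5 := abs_le.1 (h2.trans h4)
      exact ⟨hO y (by linarith) hyl, by linarith, by linarith⟩)
    have e2 : ‖x‖ ^ (-s) = ‖x‖ * ‖x‖ ^ (1 - d + δ) := by
      rw [mul_comm, ← rpow_add_one hx0.ne']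
      congr 1; rw [hs]; ring
    have e3 : ‖x‖ * ‖fderiv ℝ v x‖ ≤ ‖x‖ * (K₂ * (b - a) * ‖x‖ ^ (1 - d + δ)) := by
      calc ‖x‖ * ‖fderiv ℝ v x‖ = 8 * (‖x‖ / 8 * ‖fderiv ℝ v x‖) := by ring
        _ ≤ 8 * (Cg * (k + N - (k - N))) := by gcongr
        _ = _ := by rw [hN, e2, hK₂]; ring
    exact le_of_mul_le_mul_left e3 hx0
  intro x hx hxl
  have hx0 : 0 < ‖x‖ := by linarith
  constructor
  · refine (hG x (by linarith) hxl).trans ?_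
    gcongr
    linarith
  · have e1 := hhess l v O ε x (‖x‖ / 16) (K₂ * (b - a) * (2 ^ |1 - d + δ| * ‖x‖ ^ (1 - d + δ)))
      H hε1 (by linarith) hxl (by
      intro y hy hyl
      have h1 := abs_le.1 ((abs_norm_sub_norm_le y x).trans hy)
      have h2 := hG y (by linarith) hyl
      have h3 := rpow_le_of_comparable hx0 (by linarith : ‖x‖ / 2 ≤ ‖y‖) (by linarith) (1 - d + δ)
      exact ⟨hO y (by linarith) hyl, h2.trans (by gcongr)⟩)
    have e2 : ‖x‖ ^ (1 - d + δ) = ‖x‖ * ‖x‖ ^ (-d + δ) := by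
      rw [mul_comm, ← rpow_add_one hx0.ne']
      congr 1; ring
    have e3 : ‖x‖ * hnorm v x ≤ ‖x‖ * (K₃ * (b - a) * ‖x‖ ^ (-d + δ)) := by
      calc ‖x‖ * hnorm v x = 16 * (‖x‖ / 16 * hnorm v x) := by ring
        _ ≤ 16 * (Ch * (K₂ * (b - a) * (2 ^ |1 - d + δ| * ‖x‖ ^ (1 - d + δ)))) := by gcongr
        _ = _ := by rw [e2, hK₃]; ring
    refine (le_of_mul_le_mul_left e3 hx0).trans ?_
    gcongr
    linarith

lemma tangSq_eq (hd : 0 < d) : tangSq d hd (fun m => gradC d v y m) =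
    ∑ m, chi (lastIdx d hd) m * pd (ev m) v y ^ 2 := by
  refine Finset.sum_congr rfl fun m _ => ?_
  rw [chi]
  split_ifs
  · ring
  · rw [one_mul]; rfl

/-- The frame operator is a multiple of the hodograph operator. -/
lemma Lop_eq_hodOp (hd : 0 < d) (hO : IsOpen O) (hv : SmoothOn O v) (hy : y ∈ O)
    (h1 : 1 + pd (ev (lastIdx d hd)) v y ≠ 0) :
    Lop v (lastIdx d hd) v y = (1 + pd (ev (lastIdx d hd)) v y) ^ 2 * hodOp d hd v y := by
  set l := lastIdx d hd with hl
  set q := pd (ev l) v y with hq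
  have hess : ∀ i j, hessC d v y i j = pd (ev i) (pd (ev j) v) y := fun i j =>
    pd_comm hO hv hy (ev j) (ev i)
  have hA : ∀ i j, hodA d hd (fun m => gradC d v y m) i j =
      (if i = j then chi l i else 0) + (if j = l then chi l i * pd (ev i) v y / (1 + q) else 0) +
      (if i = l then chi l j * pd (ev j) v y / (1 + q) else 0) +
      (if i = l then if j = l then (1 + ∑ m, chi l m * pd (ev m) v y ^ 2) / (1 + q) ^ 2 else 0
        else 0) := by
    intro i j
    rw [hodA, tangSq_eq, ← hl]
    by_cases hi : i = l
    · by_cases hj : j = l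
      · subst hj; subst hi; simp [chi_self, hq, pd, gradC]
      · have : l ≠ j := fun h => hj h.symm
        subst hi; simp [hj, this, chi, hq, pd, gradC]
    · by_cases hj : j = l
      · subst hj; simp [hi, chi, hq, pd, gradC]
      · simp [hi, hj, chi]
  have hsum : hodOp d hd v y = ∑ i, (chi l i * pd (ev i) (pd (ev i) v) y +
      2 * (chi l i * pd (ev i) v y / (1 + q)) * pd (ev l) (pd (ev i) v) y) +
      (1 + ∑ m, chi l m * pd (ev m) v y ^ 2) / (1 + q) ^ 2 * pd (ev l) (pd (ev l) v) y := by
    have hc : ∀ i, pd (ev i) (pd (ev l) v) y = pd (ev l) (pd (ev i) v) y := fun i =>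
      pd_comm hO hv hy _ _
    simp only [hodOp, hA, hess, add_mul, ite_mul, zero_mul, Finset.sum_add_distrib,
      Finset.sum_ite_eq, Finset.mem_univ, if_true, Finset.sum_ite_irrel, Finset.sum_const_zero,
      Finset.sum_ite_eq', hc]
    simp only [two_mul, add_mul, Finset.sum_add_distrib]
    ring
  rw [hsum, Lop_coord hO hv hy]
  have : ∀ i, cfA v l i y ^ 2 * pd (ev i) (pd (ev i) v) y +
      2 * cfA v l i y * cfB v l i y * pd (ev l) (pd (ev i) v) y +
      cfB v l i y ^ 2 * pd (ev l) (pd (ev l) v) y =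
      (1 + q) ^ 2 * (chi l i * pd (ev i) (pd (ev i) v) y +
      2 * (chi l i * pd (ev i) v y / (1 + q)) * pd (ev l) (pd (ev i) v) y) +
      chi l i * pd (ev i) v y ^ 2 * pd (ev l) (pd (ev l) v) y +
      (if i = l then pd (ev l) (pd (ev l) v) y else 0) := by
    intro i
    by_cases hi : i = l
    · subst hi; simp [cfA, cfB, chi_self]
    · simp [hi, cfA, cfB, chi, ← hq]; field_simp
  simp only [this, Finset.sum_add_distrib, Finset.sum_ite_eq', Finset.mem_univ, if_true, mul_add,
    ← Finset.mul_sum, ← Finset.sum_mul]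
  field_simp
  ring

lemma tangSq_nonneg (hd : 0 < d) (p : Fin d → ℝ) : 0 ≤ tangSq d hd p :=
  Finset.sum_nonneg fun i _ => by split_ifs <;> positivity

/-- Solutions of the exterior problem satisfy the local form of the equations. -/
lemma IsHodSol.hodLoc (hd : 0 < d) (h : IsHodSol d hd v (extDom d hd))
    (hs : ∀ y ∈ extDom d hd, ‖fderiv ℝ v y‖ ≤ ε) (hε : ε ≤ 1 / 2) :
    ∃ O, HodLoc (lastIdx d hd) v O ε ∧ ∀ y, 1 < ‖y‖ → 0 ≤ y (lastIdx d hd) → y ∈ O := by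
  obtain ⟨⟨W, hW, hUW, hv⟩, hpde, hbc⟩ := h
  have hO : IsOpen (W ∩ {y | 1 < ‖y‖}) := hW.inter (isOpen_lt continuous_const continuous_norm)
  have hvO : SmoothOn (W ∩ {y | 1 < ‖y‖}) v := hv.mono inter_subset_left
  have hmem : ∀ y ∈ W ∩ {y | 1 < ‖y‖}, 0 ≤ y (lastIdx d hd) → y ∈ extDom d hd :=
    fun y hy hyl => ⟨hyl, le_of_lt hy.2⟩
  refine ⟨W ∩ {y | 1 < ‖y‖}, ⟨hO, hvO, ?_, ?_, fun y hy hyl => hs y (hmem y hy hyl)⟩,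
    fun y hy hyl => ⟨hUW ⟨hyl, hy.le⟩, hy⟩⟩
  · intro y hy hyl
    have h1 := abs_le.1 ((abs_pd_ev_le (f := v) (y := y) (lastIdx d hd)).trans
      ((hs y (hmem y hy hyl.le)).trans hε))
    rw [Lop_eq_hodOp hd hO hvO hy (by linarith), hpde y (hmem y hy hyl.le) hyl, mul_zero]
  · intro y hy hyl
    have h1 : pd (ev (lastIdx d hd)) v y = _ := hbc y (hmem y hy hyl.ge) hyl
    rw [hodN, tangSq_eq] at h1
    have h2 := tangSq_nonneg hd fun m => gradC d v y m
    rw [tangSq_eq] at h2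
    have h3 := Real.sq_sqrt (by linarith :
      0 ≤ 1 + ∑ m, chi (lastIdx d hd) m * pd (ev m) v y ^ 2)
    rw [show √(1 + ∑ m, chi (lastIdx d hd) m * pd (ev m) v y ^ 2) =
      1 + pd (ev (lastIdx d hd)) v y by linarith] at h3
    linarith

lemma norm_clm_le_of_ev {F : Type*} [NormedAddCommGroup F] [NormedSpace ℝ F]
    (L : EuclideanSpace ℝ (Fin d) →L[ℝ] F) {M : ℝ} (hM : 0 ≤ M) (h : ∀ i, ‖L (ev i)‖ ≤ M) :
    ‖L‖ ≤ d * M := by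
  refine L.opNorm_le_bound (by positivity) fun x => ?_
  have hx : x = ∑ i, x i • ev i := by
    simpa using ((EuclideanSpace.basisFun (Fin d) ℝ).sum_repr x).symm
  calc ‖L x‖ = ‖∑ i, x i • L (ev i)‖ := by
        conv_lhs => rw [hx]
        simp only [map_sum, map_smul]
    _ ≤ ∑ _i : Fin d, ‖x‖ * M := by
        refine (norm_sum_le _ _).trans (Finset.sum_le_sum fun i _ => ?_)
        rw [norm_smul]
        exact mul_le_mul (PiLp.norm_apply_le x i) (h i) (norm_nonneg _) (norm_nonneg _)
    _ = _ := by simp; ring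

lemma norm_iteratedFDeriv_two_le (hO : IsOpen O) (hv : SmoothOn O v) (hy : y ∈ O) :
    ‖iteratedFDeriv ℝ 2 v y‖ ≤ d ^ 2 * hnorm v y := by
  have h0 := hnorm_nonneg (v := v) (y := y)
  rw [← norm_iteratedFDeriv_fderiv, ← norm_iteratedFDeriv_fderiv, norm_iteratedFDeriv_zero]
  refine (norm_clm_le_of_ev _ (M := d * hnorm v y) (by positivity) fun i =>
    norm_clm_le_of_ev _ h0 fun j => ?_).trans_eq (by ring)
  rw [← pd_pd_eq hO hv hy]
  exact abs_le_hnorm i j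

lemma HodLoc.abs_laplacian_le (H : HodLoc l v O ε) (hε : ε ≤ 1) (hy : y ∈ O) (hyl : 0 < y l) :
    |∑ i, pd (ev i) (pd (ev i) v) y| ≤ 8 * d * (‖fderiv ℝ v y‖ * hnorm v y) := by
  set G := ‖fderiv ℝ v y‖ with hG
  have hG0 : 0 ≤ G := norm_nonneg _
  have hG1 : G ≤ 1 := (H.small y hy hyl.le).trans hε
  have h0 := hnorm_nonneg (v := v) (y := y)
  have h1 := H.pde y hy hyl
  rw [Lop_coord H.isOpen H.smooth hy] at h1
  have h2 : ∑ i, pd (ev i) (pd (ev i) v) y = -∑ i, ((cfA v l i y ^ 2 - 1) *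
      pd (ev i) (pd (ev i) v) y + 2 * cfA v l i y * cfB v l i y * pd (ev l) (pd (ev i) v) y +
      cfB v l i y ^ 2 * pd (ev l) (pd (ev l) v) y) := by
    rw [eq_neg_iff_add_eq_zero, ← Finset.sum_add_distrib, ← h1]
    exact Finset.sum_congr rfl fun i _ => by ring
  rw [h2, abs_neg]
  refine (abs_sum_fin_le (c := 8 * (G * hnorm v y)) fun i => ?_).trans_eq (by ring)
  have a1 := abs_cfA_sub_one_le (v := v) (l := l) (y := y) hG.ge i
  have a2 := abs_cfB_le (v := v) (l := l) (y := y) hG.ge i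
  have a3 := abs_le.1 a1
  have a4 : |cfA v l i y| ≤ 2 := abs_le.2 ⟨by linarith, by linarith⟩
  have b1 : |(cfA v l i y ^ 2 - 1) * pd (ev i) (pd (ev i) v) y| ≤ (G * 3) * hnorm v y := by
    rw [show cfA v l i y ^ 2 - 1 = (cfA v l i y - 1) * (cfA v l i y + 1) by ring, abs_mul, abs_mul]
    gcongr
    · exact abs_le.2 ⟨by linarith, by linarith⟩
    · exact abs_le_hnorm i i
  have b2 : |2 * cfA v l i y * cfB v l i y * pd (ev l) (pd (ev i) v) y| ≤
      2 * 2 * G * hnorm v y := by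
    rw [abs_mul, abs_mul, abs_mul, abs_two]
    gcongr
    exact abs_le_hnorm l i
  have b3 : |cfB v l i y ^ 2 * pd (ev l) (pd (ev l) v) y| ≤ G * 1 * hnorm v y := by
    rw [pow_two, abs_mul, abs_mul]
    gcongr
    · linarith
    · exact abs_le_hnorm l l
  refine (abs_add_three _ _ _).trans ?_
  linarith

lemma HodLoc.flat_bounds (H : HodLoc l v O ε) (hε : ε ≤ 1) (hy : y ∈ O) (hyl : y l = 0) :
    0 ≤ pd (ev l) v y ∧ pd (ev l) v y ≤ d * ‖fderiv ℝ v y‖ ^ 2 := by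
  have h := H.bc y hy hyl
  refine ⟨pd_normal_nonneg h (H.small y hy hyl.ge) hε, ?_⟩
  have h1 : |∑ i, chi l i * pd (ev i) v y ^ 2| ≤ d * ‖fderiv ℝ v y‖ ^ 2 :=
    abs_sum_fin_le fun i => by
      rw [abs_mul, abs_pow, abs_of_nonneg (chi_nonneg l i)]
      calc chi l i * |pd (ev i) v y| ^ 2 ≤ 1 * ‖fderiv ℝ v y‖ ^ 2 := by
            gcongr
            · exact chi_le_one l i
            · exact abs_pd_ev_le i
        _ = _ := one_mul _
  have h2 := le_abs_self (∑ i, chi l i * pd (ev i) v y ^ 2)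
  have h3 := sq_nonneg (pd (ev l) v y)
  have h4 : 0 ≤ d * ‖fderiv ℝ v y‖ ^ 2 := by positivity
  linarith

lemma isCompact_halfAnn (hd : 0 < d) (r : ℝ) : IsCompact (halfAnn d hd r) := by
  have h1 : IsClosed (halfAnn d hd r) :=
    (isClosed_le continuous_const (by fun_prop : Continuous fun y : EuclideanSpace ℝ (Fin d) =>
      y (lastIdx d hd))).inter
      ((isClosed_le continuous_const continuous_norm).inter
        (isClosed_le continuous_norm continuous_const))
  exact (isCompact_closedBall 0 r).of_isClosed_subset h1 fun y hy => by simpa using hy.2.2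

end Conclusion

/-- Decay estimates on the first and second derivatives, and the resulting quantitative
linearization of the hodograph PDE. -/
theorem stmt10 (d : ℕ) (hd : 2 ≤ d) (δ : ℝ) (hδ : 0 < δ) :
    ∃ η₀ : ℝ, 0 < η₀ ∧ ∃ C₁ C₂ C : ℝ,
      ∀ v : EuclideanSpace ℝ (Fin d) → ℝ,
        IsHodSol d (by omega) v (extDom d (by omega)) →
        (∀ y ∈ extDom d (by omega), ‖fderiv ℝ v y‖ ≤ η₀) →
        ((∃ M : ℝ, ∀ y ∈ extDom d (by omega), v y ≤ M) ∨
         (∃ m : ℝ, ∀ y ∈ extDom d (by omega), m ≤ v y)) →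
        ∀ m : ℝ,
          m = sSup (v '' halfAnn d (by omega) 2) - sInf (v '' halfAnn d (by omega) 2) →
          (∀ y : EuclideanSpace ℝ (Fin d), 0 ≤ y (lastIdx d (by omega)) → 2 ≤ ‖y‖ →
            ‖y‖ ^ ((d : ℝ) - 1 - δ) * ‖fderiv ℝ v y‖ ≤ C₁ * m ∧
            ‖y‖ ^ ((d : ℝ) - δ) * ‖iteratedFDeriv ℝ 2 v y‖ ≤ C₂ * m) ∧
          (∀ y : EuclideanSpace ℝ (Fin d), 0 < y (lastIdx d (by omega)) → 2 ≤ ‖y‖ →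
            |∑ i : Fin d, hessC d v y i i| ≤ C * m ^ 2 * ‖y‖ ^ (1 - 2 * (d : ℝ) + δ)) ∧
          (∀ y : EuclideanSpace ℝ (Fin d), y (lastIdx d (by omega)) = 0 → 2 ≤ ‖y‖ →
            0 ≤ gradC d v y (lastIdx d (by omega)) ∧
            gradC d v y (lastIdx d (by omega)) ≤ C * m ^ 2 * ‖y‖ ^ (2 - 2 * (d : ℝ) + δ)) := by
  have hd0 : 0 < d := by omega
  set δ₀ : ℝ := min δ 1 / 2 with hδ₀
  have hmin : 0 < min δ 1 := lt_min hδ one_pos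
  have hδ₀0 : 0 < δ₀ := by positivity
  have hδ₀1 : δ₀ < 1 := by linarith [min_le_right δ 1]
  have hδ₀δ : 2 * δ₀ ≤ δ := by linarith [min_le_left δ 1]
  obtain ⟨ε₀, K, hε₀, hK, hε₀', hdec⟩ := exists_deriv_decay d hd hδ₀0 hδ₀1
  refine ⟨ε₀, hε₀, K, d ^ 2 * K, 8 * d * K ^ 2, ?_⟩
  intro v hv hs hb m hm
  obtain ⟨O, H, hO⟩ := hv.hodLoc hd0 hs hε₀'
  set l := lastIdx d hd0 with hl
  obtain ⟨W, hW, hUW, hvW⟩ := hv.1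
  have hcv : ContinuousOn v {y | 1 ≤ ‖y‖ ∧ 0 ≤ y l} :=
    hvW.continuousOn.mono fun y hy => hUW ⟨hy.2, hy.1⟩
  have hKc := (isCompact_halfAnn hd0 2).image_of_continuousOn
    (hcv.mono fun y hy => ⟨hy.2.1, hy.1⟩)
  have hest := hdec l v O ε₀ (sInf (v '' halfAnn d hd0 2)) (sSup (v '' halfAnn d hd0 2)) H le_rfl
    hO hcv (fun y e1 e2 e3 => ⟨csInf_le hKc.bddBelow ⟨y, ⟨e3, e1, e2⟩, rfl⟩,
      le_csSup hKc.bddAbove ⟨y, ⟨e3, e1, e2⟩, rfl⟩⟩)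
    (hb.imp (fun ⟨B, hB⟩ => ⟨B, fun y e1 e2 => hB y ⟨e2, e1⟩⟩)
      (fun ⟨B, hB⟩ => ⟨B, fun y e1 e2 => hB y ⟨e2, e1⟩⟩))
  rw [← hm] at hest
  have hmem : ∀ y : EuclideanSpace ℝ (Fin d), 0 ≤ y l → 2 ≤ ‖y‖ → y ∈ O := fun y hyl hy =>
    hO y (by linarith) hyl
  have hm0 : 0 ≤ m := by
    obtain ⟨y, hy, hyl⟩ := exists_mem_sphere l (R := 1) (by norm_num)
    have hy' : v y ∈ v '' halfAnn d hd0 2 := ⟨y, ⟨hyl, hy.ge, by linarith⟩, rfl⟩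
    rw [hm]
    linarith [csInf_le hKc.bddBelow hy', le_csSup hKc.bddAbove hy']
  refine ⟨fun y hyl hy => ?_, fun y hyl hy => ?_, fun y hyl hy => ?_⟩
  · have hy0 : 0 < ‖y‖ := by linarith
    obtain ⟨h1, h2⟩ := hest y hy hyl
    have h3 := norm_iteratedFDeriv_two_le H.isOpen H.smooth (hmem y hyl hy)
    have hpow : ∀ p q : ℝ, p + q ≤ 0 → ‖y‖ ^ p * ‖y‖ ^ q ≤ 1 := fun p q hpq => by
      rw [← rpow_add hy0]
      exact rpow_le_one_of_one_le_of_nonpos (by linarith) hpq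
    constructor
    · calc ‖y‖ ^ ((d : ℝ) - 1 - δ) * ‖fderiv ℝ v y‖
          ≤ ‖y‖ ^ ((d : ℝ) - 1 - δ) * (K * m * ‖y‖ ^ (1 - d + δ₀)) := by gcongr
        _ = K * m * (‖y‖ ^ ((d : ℝ) - 1 - δ) * ‖y‖ ^ (1 - d + δ₀)) := by ring
        _ ≤ K * m * 1 := by gcongr; exact hpow _ _ (by linarith)
        _ = K * m := mul_one _
    · calc ‖y‖ ^ ((d : ℝ) - δ) * ‖iteratedFDeriv ℝ 2 v y‖
          ≤ ‖y‖ ^ ((d : ℝ) - δ) * (d ^ 2 * (K * m * ‖y‖ ^ (-d + δ₀))) := by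
            gcongr
            exact h3.trans (by gcongr)
        _ = d ^ 2 * K * m * (‖y‖ ^ ((d : ℝ) - δ) * ‖y‖ ^ (-d + δ₀)) := by ring
        _ ≤ d ^ 2 * K * m * 1 := by gcongr; exact hpow _ _ (by linarith)
        _ = d ^ 2 * K * m := mul_one _
  · have hy0 : 0 < ‖y‖ := by linarith
    obtain ⟨h1, h2⟩ := hest y hy hyl.le
    have h3 := H.abs_laplacian_le (hε₀'.trans (by norm_num)) (hmem y hyl.le hy) hyl
    calc |∑ i : Fin d, hessC d v y i i|
        ≤ 8 * d * (‖fderiv ℝ v y‖ * hnorm v y) := h3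
      _ ≤ 8 * d * ((K * m * ‖y‖ ^ (1 - d + δ₀)) * (K * m * ‖y‖ ^ (-d + δ₀))) := by
          have := hnorm_nonneg (v := v) (y := y)
          gcongr
      _ = 8 * d * K ^ 2 * m ^ 2 * (‖y‖ ^ (1 - d + δ₀) * ‖y‖ ^ (-d + δ₀)) := by ring
      _ ≤ 8 * d * K ^ 2 * m ^ 2 * ‖y‖ ^ (1 - 2 * (d : ℝ) + δ) := by
          rw [← rpow_add hy0]
          exact mul_le_mul_of_nonneg_left
            (rpow_le_rpow_of_exponent_le (by linarith) (by linarith)) (by positivity)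
  · have hy0 : 0 < ‖y‖ := by linarith
    obtain ⟨h1, h2⟩ := hest y hy hyl.ge
    obtain ⟨h3, h4⟩ := H.flat_bounds (hε₀'.trans (by norm_num)) (hmem y hyl.ge hy) hyl
    refine ⟨h3, h4.trans ?_⟩
    calc d * ‖fderiv ℝ v y‖ ^ 2 ≤ 8 * d * (K * m * ‖y‖ ^ (1 - d + δ₀)) ^ 2 := by
          gcongr
          have : (0 : ℝ) ≤ d := by positivity
          linarith
      _ = 8 * d * K ^ 2 * m ^ 2 * (‖y‖ ^ (1 - d + δ₀) * ‖y‖ ^ (1 - d + δ₀)) := by ring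
      _ ≤ 8 * d * K ^ 2 * m ^ 2 * ‖y‖ ^ (2 - 2 * (d : ℝ) + δ) := by
          rw [← rpow_add hy0]
          exact mul_le_mul_of_nonneg_left
            (rpow_le_rpow_of_exponent_le (by linarith) (by linarith)) (by positivity)
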